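/- Let f be a homeomorphism of ℝ² and x₀ a point with proper orbit. Let α₀ and α₁ be two translation arcs for f at the point x₀. Then α₀ and α₁ are homotopic with fixed endpoints relative to the orbit O(x₀) = {f^n(x₀) : n ∈ ℤ}: there is a continuous family of curves (α_t) from x₀ to f(x₀), each meeting O(x₀) only at its endpoints, interpolating between α₀ and α₁. -/

import Mathlib

def OrientationPreserving {X : Type*} [TopologicalSpace X] (f : X ≃ₜ X) : Prop :=
  ∃ F : ℝ → X ≃ₜ X, (Continuous fun p : ℝ × X => F p.1 p.2) ∧
    F 0 = Homeomorph.refl X ∧ F 1 = f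

/-- The full orbit of `x` under a homeomorphism `f`. -/
def orbitZ (f : ℂ ≃ₜ ℂ) (x : ℂ) : Set ℂ := Set.range fun n : ℤ => (f.toEquiv ^ n) x

/-- A translation arc for `f` at `x`. -/
def TranslationArc (f : ℂ ≃ₜ ℂ) (x : ℂ) (γ : C(unitInterval, ℂ)) : Prop :=
  Function.Injective γ ∧ γ 0 = x ∧ γ 1 = f x ∧
  Set.range γ ∩ f '' Set.range γ = {γ 1}

/-- Homotopy with fixed end-points relative to a set `O`. -/
def HomotopicRelSet (O : Set ℂ) (γ γ' : C(unitInterval, ℂ)) : Prop :=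
  γ 0 = γ' 0 ∧ γ 1 = γ' 1 ∧
  ∃ H : C(unitInterval × unitInterval, ℂ),
    (∀ s, H (0, s) = γ s) ∧ (∀ s, H (1, s) = γ' s) ∧
    (∀ t, H (t, 0) = γ 0) ∧ (∀ t, H (t, 1) = γ 1) ∧
    (∀ t s, s ≠ 0 → s ≠ 1 → H (t, s) ∉ O)

section

open Set Filter Topology

section LogTools

theorem Convex.locallyPathConnectedSpace' {E : Type*} [NormedAddCommGroup E] [NormedSpace ℝ E]
    {S : Set E} (hS : Convex ℝ S) : LocallyPathConnectedSpace S := by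
  refine LocallyPathConnectedSpace.of_bases (ι := ℝ) (p := fun _ r => 0 < r)
    (s := fun x r => Metric.ball x r) (fun x => Metric.nhds_basis_ball) ?_
  intro x r hr
  have h : IsPathConnected (S ∩ Metric.ball (x : E) r) :=
    (hS.inter (convex_ball _ _)).isPathConnected ⟨x, x.2, Metric.mem_ball_self hr⟩
  have h2 : (Subtype.val : S → E) ⁻¹' (S ∩ Metric.ball (x : E) r) = Metric.ball x r := by
    ext y; simp [Subtype.dist_eq]
  rw [← h2]
  exact h.preimage_coe inter_subset_left

/-- A continuous nonvanishing function on a convex set has a continuous logarithm. -/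
theorem exists_log_of_convex {E : Type*} [NormedAddCommGroup E] [NormedSpace ℝ E]
    {S : Set E} (hS : Convex ℝ S) {F : E → ℂ} (hF : ContinuousOn F S) (h0 : ∀ x ∈ S, F x ≠ 0) :
    ∃ L : E → ℂ, ContinuousOn L S ∧ ∀ x ∈ S, Complex.exp (L x) = F x := by
  classical
  rcases S.eq_empty_or_nonempty with rfl | ⟨x₀, hx₀⟩
  · exact ⟨0, by simp, by simp⟩
  have := hS.locallyPathConnectedSpace'
  have : ContractibleSpace S := hS.contractibleSpace ⟨x₀, hx₀⟩
  obtain ⟨g, ⟨-, hg⟩, -⟩ := Complex.isCoveringMapOn_exp.existsUnique_continuousMap_lifts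
    ⟨S.domRestrict F, continuousOn_iff_continuous_domRestrict.mp hF⟩
    (a₀ := ⟨x₀, hx₀⟩) (Complex.exp_log (h0 x₀ hx₀)) (fun x => h0 x x.2)
  refine ⟨fun z => if hz : z ∈ S then g ⟨z, hz⟩ else 0, ?_, ?_⟩
  · rw [continuousOn_iff_continuous_domRestrict]
    convert! map_continuous g using 1
    ext z
    simp
  · intro x hx
    simpa [hx] using congr_fun hg ⟨x, hx⟩

theorem IsPreconnected.eq_of_int_valued {X : Type*} [TopologicalSpace X] {S : Set X}
    (hS : IsPreconnected S) {u : X → ℝ} (hu : ContinuousOn u S)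
    (hi : ∀ x ∈ S, ∃ n : ℤ, u x = n) {x y : X} (hx : x ∈ S) (hy : y ∈ S) : u x = u y := by
  wlog hlt : u x < u y generalizing x y
  · rcases lt_trichotomy (u x) (u y) with h | h | h
    · exact this hx hy h
    · exact h
    · exact (this hy hx h).symm
  obtain ⟨n, hn⟩ := hi x hx
  obtain ⟨m, hm⟩ := hi y hy
  have hnm : n + 1 ≤ m := by
    rw [hn, hm] at hlt; exact_mod_cast hlt
  have hnm' : (n : ℝ) + 1 ≤ m := by exact_mod_cast hnm
  have := hS.intermediate_value hx hy hu (show (n : ℝ) + 1 / 2 ∈ Icc (u x) (u y) by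
    constructor <;> linarith)
  obtain ⟨z, hz, hz'⟩ := this
  obtain ⟨k, hk⟩ := hi z hz
  rw [hk] at hz'
  have h1 : n < k := by
    have : (n : ℝ) < k := by linarith
    exact_mod_cast this
  have h2 : k < n + 1 := by
    have : (k : ℝ) < n + 1 := by linarith
    exact_mod_cast this
  omega

/-- Two logarithms of the same function differ by a constant. -/
theorem log_sub_const {X : Type*} [TopologicalSpace X] {S : Set X}
    (hS : IsPreconnected S) {L M : X → ℂ} (hL : ContinuousOn L S) (hM : ContinuousOn M S)
    (h : ∀ x ∈ S, Complex.exp (L x) = Complex.exp (M x)) :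
    ∃ m : ℤ, ∀ x ∈ S, L x = M x + m * (2 * Real.pi * Complex.I) := by
  rcases S.eq_empty_or_nonempty with rfl | ⟨x₀, hx₀⟩
  · exact ⟨0, by simp⟩
  have hpi := Real.pi_pos
  have key : ∀ x ∈ S, ∃ n : ℤ, L x = M x + n * (2 * Real.pi * Complex.I) := fun x hx =>
    Complex.exp_eq_exp_iff_exists_int.1 (h x hx)
  have him : ∀ x (n : ℤ), L x = M x + n * (2 * Real.pi * Complex.I) →
      ((L x - M x) / (2 * Real.pi * Complex.I)).re = n := by
    intro x n hn
    have : (L x - M x) / (2 * Real.pi * Complex.I) = ((n : ℝ) : ℂ) := by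
      rw [hn]
      have := Complex.two_pi_I_ne_zero
      push_cast
      field_simp
      ring
    rw [this, Complex.ofReal_re]
  obtain ⟨m, hm⟩ := key x₀ hx₀
  refine ⟨m, fun x hx => ?_⟩
  obtain ⟨n, hn⟩ := key x hx
  have hc : ContinuousOn (fun x => ((L x - M x) / (2 * Real.pi * Complex.I)).re) S :=
    Complex.continuous_re.comp_continuousOn ((hL.sub hM).div_const _)
  have := hS.eq_of_int_valued hc (fun x hx => by
    obtain ⟨n, hn⟩ := key x hx
    exact ⟨n, him x n hn⟩) hx hx₀
  rw [him x n hn, him x₀ m hm] at this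
  have : n = m := by exact_mod_cast this
  rw [hn, this]

/-- Logarithms of two opposite functions differ by a constant, an odd multiple of `π i`. -/
theorem log_sub_const_of_neg {X : Type*} [TopologicalSpace X] {S : Set X}
    (hS : IsPreconnected S) {L M : X → ℂ} (hL : ContinuousOn L S) (hM : ContinuousOn M S)
    (h : ∀ x ∈ S, Complex.exp (L x) = - Complex.exp (M x)) :
    ∃ c : ℂ, c ≠ 0 ∧ ∀ x ∈ S, L x = M x + c := by
  obtain ⟨m, hm⟩ := log_sub_const hS hL (hM.add_const (Real.pi * Complex.I)) (fun x hx => by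
    rw [Complex.exp_add, Complex.exp_pi_mul_I, h x hx]; ring)
  refine ⟨(2 * m + 1 : ℤ) * (Real.pi * Complex.I), ?_, fun x hx => ?_⟩
  · refine mul_ne_zero ?_ (by simp [Real.pi_ne_zero])
    exact_mod_cast (by omega : (2 * m + 1 : ℤ) ≠ 0)
  · rw [hm x hx]; push_cast; ring

end LogTools

/-- A fixed point free map of the plane for which the difference quotient has a symmetric
continuous logarithm. -/
structure HasIdx (f : ℂ ≃ₜ ℂ) : Prop where
  free : ∀ z, f z ≠ z
  exists_log : ∃ E : ℂ × ℂ → ℂ, ContinuousOn E {p | p.1 ≠ p.2} ∧ (∀ z w, E (z, w) = E (w, z)) ∧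
    ∀ z w, z ≠ w → Complex.exp (E (z, w)) = (f z - f w) / (z - w)

theorem HasIdx.symm {f : ℂ ≃ₜ ℂ} (hf : HasIdx f) : HasIdx f.symm := by
  obtain ⟨E, hE, hs, he⟩ := hf.exists_log
  refine ⟨fun z h => hf.free (f.symm z) (by simpa using h.symm),
    fun p => - E (f.symm p.1, f.symm p.2), ?_, fun z w => by simp [hs], ?_⟩
  · refine ContinuousOn.neg (hE.comp (by fun_prop) ?_)
    intro p hp h
    exact hp (f.symm.injective h)
  · intro z w hzw
    have : f.symm z ≠ f.symm w := fun h => hzw (f.symm.injective h)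
    simp only [Complex.exp_neg]
    rw [he _ _ this]
    simp

abbrev OffDiag := {p : ℂ × ℂ // p.1 ≠ p.2}

theorem OrientationPreserving.hasIdx {f : ℂ ≃ₜ ℂ} (hor : OrientationPreserving f)
    (hfree : ∀ z, f z ≠ z) : HasIdx f := by
  classical
  refine ⟨hfree, ?_⟩
  obtain ⟨F, hF, hF0, hF1⟩ := hor
  let H : C(unitInterval × OffDiag, {z : ℂ // z ≠ 0}) :=
    ⟨fun q => ⟨(F q.1 q.2.1.1 - F q.1 q.2.1.2) / (q.2.1.1 - q.2.1.2), by
      refine div_ne_zero (sub_ne_zero.2 fun h => q.2.2 ((F q.1).injective h)) (sub_ne_zero.2 q.2.2)⟩,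
      by
        refine Continuous.subtype_mk (Continuous.div ?_ (by fun_prop)
          fun q => sub_ne_zero.2 q.2.2) _
        refine Continuous.sub ?_ ?_
        · exact hF.comp (by fun_prop : Continuous fun q : unitInterval × OffDiag =>
            ((q.1 : ℝ), (q.2.1.1 : ℂ)))
        · exact hF.comp (by fun_prop : Continuous fun q : unitInterval × OffDiag =>
            ((q.1 : ℝ), (q.2.1.2 : ℂ)))⟩
  have H0 : ∀ a, H (0, a) = (fun z : ℂ ↦ (⟨_, z.exp_ne_zero⟩ : {z : ℂ // z ≠ 0}))
      ((0 : C(OffDiag, ℂ)) a) := by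
    intro a
    apply Subtype.ext
    have := sub_ne_zero.2 a.2
    simp [H, hF0, this]
  obtain ⟨G, hlift, hzero, huniq⟩ : ∃ G : C(unitInterval × OffDiag, ℂ),
      (∀ q, Complex.exp (G q) = H q) ∧ (∀ a, G (0, a) = 0) ∧
      ∀ G' : C(unitInterval × OffDiag, ℂ), (∀ q, Complex.exp (G' q) = H q) →
        (∀ a, G' (0, a) = 0) → G' = G := by
    refine ⟨Complex.isCoveringMap_exp.liftHomotopy H 0 H0, fun q => ?_, fun a => ?_,
      fun G' h1 h2 => ?_⟩
    · exact congr_arg Subtype.val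
        (congr_fun (Complex.isCoveringMap_exp.liftHomotopy_lifts H 0 H0) q)
    · exact Complex.isCoveringMap_exp.liftHomotopy_zero H 0 H0 a
    · rw [Complex.isCoveringMap_exp.eq_liftHomotopy_iff']
      exact ⟨funext fun q => Subtype.ext (h1 q), h2⟩
  let sw : C(OffDiag, OffDiag) := ⟨fun a => ⟨a.1.swap, fun h => a.2 h.symm⟩, by fun_prop⟩
  have hGG : G.comp ⟨fun q => (q.1, sw q.2), by fun_prop⟩ = G := by
    refine huniq _ (fun q => ?_) fun a => hzero (sw a)
    rw [ContinuousMap.comp_apply, hlift]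
    simp only [H, sw, ContinuousMap.coe_mk, Prod.fst_swap, Prod.snd_swap]
    rw [← neg_sub, ← neg_sub q.2.1.1, neg_div_neg_eq]
  refine ⟨fun p => if h : p.1 ≠ p.2 then G (1, ⟨p, h⟩) else 0, ?_, ?_, ?_⟩
  · rw [continuousOn_iff_continuous_domRestrict]
    convert! (map_continuous G).comp
      (by fun_prop : Continuous fun a : OffDiag => ((1 : unitInterval), a)) using 1
    ext z
    simp only [domRestrict_apply, Function.comp_apply]
    exact dif_pos z.2
  · intro z w
    by_cases h : z = w
    · simp [h]
    · refine (dif_pos h).trans (Eq.trans ?_ (dif_pos (Ne.symm h)).symm)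
      exact (DFunLike.congr_fun hGG (1, ⟨(z, w), h⟩)).symm
  · intro z w h
    rw [show (fun p : ℂ × ℂ => if h : p.1 ≠ p.2 then G (1, ⟨p, h⟩) else 0) (z, w) =
      G (1, ⟨(z, w), h⟩) from dif_pos h, hlift]
    simp [H, hF1]

theorem log_delta {X : Type*} [TopologicalSpace X] {S : Set X}
    (hS : IsPreconnected S) {L M : X → ℂ} (hL : ContinuousOn L S) (hM : ContinuousOn M S)
    {k : ℂ} (hk : k ≠ 0) (h : ∀ x ∈ S, Complex.exp (L x) = k * Complex.exp (M x))
    {x y : X} (hx : x ∈ S) (hy : y ∈ S) : L x - L y = M x - M y := by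
  obtain ⟨m, hm⟩ := log_sub_const hS hL (hM.const_add (Complex.log k)) (fun x hx => by
    rw [Complex.exp_add, Complex.exp_log hk, h x hx])
  rw [hm x hx, hm y hy]; ring

theorem HasIdx.exists_displacement_log {f : ℂ ≃ₜ ℂ} (hf : HasIdx f) :
    ∃ Θ : ℂ → ℂ, Continuous Θ ∧ ∀ z, Complex.exp (Θ z) = f z - z := by
  obtain ⟨L, hL, h⟩ := exists_log_of_convex (convex_univ (𝕜 := ℝ) (E := ℂ))
    (F := fun z => f z - z) (by fun_prop) (fun z _ => sub_ne_zero.2 (hf.free z))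
  exact ⟨L, continuousOn_univ.1 hL, fun z => h z (mem_univ z)⟩

/-- `A` conjugates the translation by `T` to `f`. -/
def Equivar (f : ℂ ≃ₜ ℂ) (T : ℝ) (A : ℝ → ℂ) : Prop := ∀ s, f (A s) = A (s + T)

theorem Equivar.zpow {f : ℂ ≃ₜ ℂ} {T : ℝ} {A : ℝ → ℂ} (h : Equivar f T A) (k : ℤ) (s : ℝ) :
    (f.toEquiv ^ k) (A s) = A (s + k * T) := by
  induction k using Int.induction_on with
  | zero => simp
  | succ n ih =>
    rw [add_comm, zpow_add, zpow_one, Equiv.Perm.mul_apply, ih]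
    refine (h _).trans ?_
    congr 1; push_cast; ring
  | pred n ih =>
    rw [sub_eq_add_neg, add_comm, zpow_add, zpow_neg_one, Equiv.Perm.mul_apply, ih,
      Equiv.Perm.inv_eq_iff_eq]
    refine Eq.symm ((h _).trans ?_)
    congr 1; push_cast; ring

/-- An injective equivariant line. -/
structure Line (f : ℂ ≃ₜ ℂ) (T : ℝ) (A : ℝ → ℂ) : Prop where
  pos : 0 < T
  cont : Continuous A
  inj : Function.Injective A
  equi : Equivar f T A

theorem convex_strip (ℓ : ℝ) : Convex ℝ {p : ℝ × ℝ | 0 < p.2 - p.1 ∧ p.2 - p.1 < ℓ} := by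
  have h : IsLinearMap ℝ (fun p : ℝ × ℝ => p.2 - p.1) :=
    ⟨fun a b => by simp; ring, fun c a => by simp; ring⟩
  exact (convex_halfSpace_gt h 0).inter (convex_halfSpace_lt h ℓ)

/-- The logarithm of the chord of an equivariant curve without short loops. -/
theorem exists_chord_log {f : ℂ ≃ₜ ℂ} {T ℓ : ℝ} {A : ℝ → ℂ}
    (hT : 0 < T) (hA : Continuous A) (hfA : Equivar f T A) (hℓ : T < ℓ)
    (hne : ∀ s t, 0 < t - s → t - s < ℓ → A s ≠ A t)
    {E : ℂ × ℂ → ℂ} (hE : ContinuousOn E {p | p.1 ≠ p.2})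
    (hexp : ∀ z w, z ≠ w → Complex.exp (E (z, w)) = (f z - f w) / (z - w))
    {Θ : ℂ → ℂ} (hΘ : Continuous Θ) (hΘexp : ∀ z, Complex.exp (Θ z) = f z - z) :
    ∃ L : ℝ × ℝ → ℂ, ContinuousOn L {p : ℝ × ℝ | 0 < p.2 - p.1 ∧ p.2 - p.1 < ℓ} ∧
      (∀ s t, 0 < t - s → t - s < ℓ → Complex.exp (L (s, t)) = A t - A s) ∧
      (∃ c, ∀ s t, 0 < t - s → t - s < ℓ → L (s + T, t + T) = L (s, t) + E (A s, A t) + c) ∧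
      ∃ c, ∀ s, L (s, s + T) = Θ (A s) + c := by
  obtain ⟨L, hL, h⟩ := exists_log_of_convex (convex_strip ℓ)
    (F := fun p => A p.2 - A p.1) (by fun_prop)
    (fun p hp => sub_ne_zero.2 (hne _ _ hp.1 hp.2).symm)
  have h' : ∀ s t, 0 < t - s → t - s < ℓ → Complex.exp (L (s, t)) = A t - A s :=
    fun s t h1 h2 => h (s, t) ⟨h1, h2⟩
  refine ⟨L, hL, h', ?_, ?_⟩
  · obtain ⟨m, hm⟩ := log_sub_const (convex_strip ℓ).isPreconnected
      (L := fun p => L (p.1 + T, p.2 + T)) (M := fun p => L p + E (A p.1, A p.2))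
      (hL.comp (by fun_prop) (fun p hp => by simpa using hp))
      (hL.add (hE.comp (by fun_prop) (fun p hp => hne _ _ hp.1 hp.2)))
      (fun p hp => by
        have h1 := hne _ _ hp.1 hp.2
        have h2 := sub_ne_zero.2 h1
        rw [h' (p.1 + T) (p.2 + T) (by simpa using hp.1) (by simpa using hp.2), Complex.exp_add,
          h p hp, hexp _ _ h1, hfA, hfA]
        field_simp
        ring)
    exact ⟨_, fun s t h1 h2 => hm (s, t) ⟨h1, h2⟩⟩
  · obtain ⟨m, hm⟩ := log_sub_const (isPreconnected_univ (α := ℝ))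
      (L := fun s => L (s, s + T)) (M := fun s => Θ (A s))
      (hL.comp (by fun_prop) (fun p hp => by simp [hT, hℓ])) (by fun_prop)
      (fun s hp => by rw [h' _ _ (by simpa) (by simpa), hΘexp, hfA])
    exact ⟨_, fun s => hm s (mem_univ s)⟩

/-- **Brouwer's lemma**: an equivariant curve without short loops is injective. -/
theorem HasIdx.injective_of_no_short {f : ℂ ≃ₜ ℂ} (hf : HasIdx f) {T : ℝ} {A : ℝ → ℂ}
    (hT : 0 < T) (hA : Continuous A) (hfA : Equivar f T A)
    (hshort : ∀ s h, 0 < h → h ≤ T → A (s + h) ≠ A s) : Function.Injective A := by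
  by_contra hinj
  have hred : ∀ s h, A (s + h) = A s → ∃ s' ∈ Icc 0 T, A (s' + h) = A s' := by
    intro s h hs
    refine ⟨s + (-⌊s / T⌋ : ℤ) * T, ⟨?_, ?_⟩, ?_⟩
    · have := Int.floor_le (s / T)
      rw [le_div_iff₀ hT] at this
      push_cast; linarith
    · have := Int.lt_floor_add_one (s / T)
      rw [div_lt_iff₀ hT] at this
      push_cast; linarith
    · rw [add_right_comm, ← hfA.zpow, ← hfA.zpow, hs]
  obtain ⟨a₀, ℓ₀, hℓ₀, ha₀⟩ : ∃ a ℓ, 0 < ℓ ∧ A (a + ℓ) = A a := by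
    simp only [Function.Injective, not_forall] at hinj
    obtain ⟨x, y, hxy, hne⟩ := hinj
    rcases lt_or_gt_of_ne hne with h | h
    · exact ⟨x, y - x, by linarith, by rw [add_sub_cancel]; exact hxy.symm⟩
    · exact ⟨y, x - y, by linarith, by rw [add_sub_cancel]; exact hxy⟩
  have hlong : ∀ s h, 0 < h → A (s + h) = A s → T < h := fun s h h0 hs => by
    by_contra hle
    exact hshort s h h0 (not_lt.1 hle) hs
  obtain ⟨s₀, hs₀, hs₀'⟩ := hred _ _ ha₀
  have hK : IsCompact ((Icc 0 T ×ˢ Icc T ℓ₀) ∩ {p : ℝ × ℝ | A (p.1 + p.2) = A p.1}) :=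
    (isCompact_Icc.prod isCompact_Icc).inter_right (isClosed_eq (by fun_prop) (by fun_prop))
  obtain ⟨⟨a, ℓ⟩, ⟨hmem, hal⟩, hmin⟩ := hK.exists_isMinOn
    ⟨(s₀, ℓ₀), ⟨hs₀, (hlong _ _ hℓ₀ ha₀).le, le_rfl⟩, hs₀'⟩ continuous_snd.continuousOn
  simp only [mem_ofPred_eq, mem_prod] at hal hmem
  have hℓT : T < ℓ := hlong a ℓ (hT.trans_le hmem.2.1) hal
  have hne : ∀ s t, 0 < t - s → t - s < ℓ → A s ≠ A t := by
    intro s t h0 h1 hst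
    obtain ⟨s', hs', hs''⟩ := hred s (t - s) (by rw [add_sub_cancel]; exact hst.symm)
    have := hmin (a := (s', t - s)) ⟨⟨hs', (hlong _ _ h0 hs'').le, by
      have := hmem.2.2
      simp only; linarith⟩, hs''⟩
    simp only [mem_ofPred_eq] at this
    linarith
  obtain ⟨E, hE, hsymm, hexp⟩ := hf.exists_log
  obtain ⟨Θ, hΘ, hΘexp⟩ := hf.exists_displacement_log
  obtain ⟨L, hL, hLexp, ⟨c₁, hc₁⟩, c₂, hc₂⟩ :=
    exists_chord_log hT hA hfA hℓT hne hE hexp hΘ hΘexp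
  set b := a + ℓ with hb
  obtain ⟨c, hc0, hc⟩ := log_sub_const_of_neg (isPreconnected_Ioo (a := a) (b := b))
    (L := fun t => L (t, b)) (M := fun t => L (a, t))
    (hL.comp (by fun_prop) (fun t ht => by
      constructor <;> simp only <;> linarith [ht.1, ht.2]))
    (hL.comp (by fun_prop) (fun t ht => by
      constructor <;> simp only <;> linarith [ht.1, ht.2]))
    (fun t ht => by
      have := ht.1
      have := ht.2
      rw [hLexp _ _ (by linarith) (by linarith), hLexp _ _ (by linarith) (by linarith), hal]
      ring)
  have e1 := hc (a + T) ⟨by linarith, by linarith⟩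
  have e2 := hc (b - T) ⟨by linarith, by linarith⟩
  have e3 := hc₁ (b - T) b (by linarith) (by linarith)
  have e4 := hc₁ a (b - T) (by linarith) (by linarith)
  rw [hal, hsymm] at e3
  rw [sub_add_cancel] at e3 e4
  have e5 := hc₂ a
  have e6 := hc₂ b
  rw [hal] at e6
  apply hc0
  have : 2 * c = 0 := by linear_combination e4 - e3 - e2 - e1 + e6 - e5
  simpa using this

theorem exists_equivar {f : ℂ ≃ₜ ℂ} {T s₀ : ℝ} (hT : 0 < T) {c : ℝ → ℂ}
    (hc : ContinuousOn c (Icc s₀ (s₀ + T))) (hend : c (s₀ + T) = f (c s₀)) :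
    ∃ A : ℝ → ℂ, Continuous A ∧ Equivar f T A ∧ EqOn A c (Icc s₀ (s₀ + T)) := by
  let A : ℝ → ℂ := fun s => (f.toEquiv ^ ⌊(s - s₀) / T⌋) (c (s - ⌊(s - s₀) / T⌋ * T))
  have hAk : ∀ (k : ℤ) s, s ∈ Icc (s₀ + k * T) (s₀ + (k + 1) * T) →
      A s = (f.toEquiv ^ k) (c (s - k * T)) := by
    intro k s hs
    rcases hs.2.lt_or_eq with h | h
    · have : ⌊(s - s₀) / T⌋ = k := by
        rw [Int.floor_eq_iff]
        constructor
        · rw [le_div_iff₀ hT]; linarith [hs.1]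
        · rw [div_lt_iff₀ hT]; linarith
      simp only [A, this]
    · have : ⌊(s - s₀) / T⌋ = k + 1 := by
        rw [h, show (s₀ + (k + 1) * T - s₀) / T = ((k + 1 : ℤ) : ℝ) by
          push_cast; field_simp; ring, Int.floor_intCast]
      simp only [A, this]
      rw [zpow_add, zpow_one, Equiv.Perm.mul_apply, h]
      congr 1
      rw [show s₀ + (k + 1) * T - k * T = s₀ + T by ring, hend]
      push_cast
      rw [show s₀ + (k + 1) * T - (k + 1) * T = s₀ by ring]
      rfl
  have hfc : ∀ k : ℤ, Continuous (f.toEquiv ^ k : Equiv.Perm ℂ) := by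
    intro k
    induction k using Int.induction_on with
    | zero => exact continuous_id
    | succ n ih => rw [zpow_add, zpow_one]; exact ih.comp f.continuous
    | pred n ih => rw [sub_eq_add_neg, zpow_add, zpow_neg_one]; exact ih.comp f.symm.continuous
  have hcov : ∀ s : ℝ, s ∈ Icc (s₀ + ⌊(s - s₀) / T⌋ * T) (s₀ + (⌊(s - s₀) / T⌋ + 1) * T) := by
    intro s
    have h1 := Int.floor_le ((s - s₀) / T)
    have h2 := Int.lt_floor_add_one ((s - s₀) / T)
    rw [le_div_iff₀ hT] at h1
    rw [div_lt_iff₀ hT] at h2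
    constructor <;> linarith
  refine ⟨A, ?_, ?_, ?_⟩
  · refine LocallyFinite.continuous (f := fun k : ℤ => Icc (s₀ + k * T) (s₀ + (k + 1) * T))
      ?_ ?_ (fun k => isClosed_Icc) ?_
    · intro x
      refine ⟨Ioo (x - T) (x + T), Ioo_mem_nhds (by linarith) (by linarith), ?_⟩
      refine (finite_Icc (⌊(x - s₀) / T⌋ - 2) (⌊(x - s₀) / T⌋ + 2)).subset ?_
      rintro k ⟨y, hy, hy'⟩
      have hx := hcov x
      simp only [mem_Icc, mem_Ioo] at hy hy' hx ⊢
      constructor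
      · by_contra! h
        have : (k : ℝ) + 3 ≤ ⌊(x - s₀) / T⌋ := by
          exact_mod_cast (by omega : k + 3 ≤ ⌊(x - s₀) / T⌋)
        nlinarith
      · by_contra! h
        have : (⌊(x - s₀) / T⌋ : ℝ) + 3 ≤ k := by
          exact_mod_cast (by omega : ⌊(x - s₀) / T⌋ + 3 ≤ k)
        nlinarith
    · exact eq_univ_of_forall fun s => mem_iUnion.2 ⟨_, hcov s⟩
    · intro k
      refine ContinuousOn.congr ((hfc k).comp_continuousOn (hc.comp (f := fun s => s - k * T)
        (by fun_prop) ?_)) (hAk k)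
      intro s hs
      constructor <;> linarith [hs.1, hs.2]
  · intro s
    have h := hcov s
    rw [hAk (⌊(s - s₀) / T⌋ + 1) (s + T)]
    · rw [add_comm, zpow_add, zpow_one, Equiv.Perm.mul_apply]
      push_cast
      rw [show s + T - (1 + ⌊(s - s₀) / T⌋) * T = s - ⌊(s - s₀) / T⌋ * T by ring]
      rfl
    · push_cast
      constructor <;> linarith [h.1, h.2]
  · intro s hs
    have := hAk 0 s (by simpa using hs)
    simpa using this

theorem HasIdx.exists_line {f : ℂ ≃ₜ ℂ} (hf : HasIdx f) {T s₀ : ℝ} (hT : 0 < T) {c : ℝ → ℂ}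
    (hc : ContinuousOn c (Icc s₀ (s₀ + T))) (hend : c (s₀ + T) = f (c s₀))
    (hinj : InjOn c (Icc s₀ (s₀ + T)))
    (hdisj : ∀ y ∈ Ioo s₀ (s₀ + T), ∀ s ∈ Ioo s₀ (s₀ + T), y ≤ s → c s ≠ f (c y)) :
    ∃ A : ℝ → ℂ, Line f T A ∧ EqOn A c (Icc s₀ (s₀ + T)) := by
  obtain ⟨A, hA, hfA, hAc⟩ := exists_equivar hT hc hend
  refine ⟨A, ⟨hT, hA, hf.injective_of_no_short hT hA hfA ?_, hfA⟩, hAc⟩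
  intro s h h0 h1 hs
  obtain ⟨k, hk⟩ : ∃ k : ℤ, s + k * T ∈ Ico s₀ (s₀ + T) := by
    refine ⟨-⌊(s - s₀) / T⌋, ?_⟩
    have h1 := Int.floor_le ((s - s₀) / T)
    have h2 := Int.lt_floor_add_one ((s - s₀) / T)
    rw [le_div_iff₀ hT] at h1
    rw [div_lt_iff₀ hT] at h2
    push_cast
    constructor <;> linarith
  have hs' : A (s + k * T + h) = A (s + k * T) := by
    rw [add_right_comm, ← hfA.zpow, ← hfA.zpow, hs]
  set r := s + k * T
  rcases le_or_gt (r + h) (s₀ + T) with h2 | h2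
  · have m1 : r + h ∈ Icc s₀ (s₀ + T) := ⟨by linarith [hk.1], h2⟩
    have m2 : r ∈ Icc s₀ (s₀ + T) := ⟨hk.1, hk.2.le⟩
    rw [hAc m1, hAc m2] at hs'
    have := hinj m1 m2 hs'
    linarith
  · have m1 : r + h - T ∈ Ioo s₀ (s₀ + T) := ⟨by linarith, by linarith [hk.2]⟩
    have m2 : r ∈ Ioo s₀ (s₀ + T) := ⟨by linarith, hk.2⟩
    apply hdisj _ m1 _ m2 (by linarith)
    rw [← hAc ⟨m1.1.le, m1.2.le⟩, ← hAc ⟨m2.1.le, m2.2.le⟩, hfA, sub_add_cancel, hs']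

theorem HasIdx.no_crossing {f : ℂ ≃ₜ ℂ} (hf : HasIdx f) {T p q : ℝ} {A e : ℝ → ℂ}
    (hA : Line f T A) (hpq : p + T < q) (he : Continuous e) (he0 : e 0 = A p) (he1 : e 1 = A q)
    (hfe : ∀ x ∈ Icc (0 : ℝ) 1, ∀ y ∈ Icc (0 : ℝ) 1, e x ≠ f (e y))
    (havoid : ∀ t ∈ uIcc (p + T) (q - T), ∀ x ∈ Icc (0 : ℝ) 1, A t ≠ e x) : False := by
  have hT := hA.pos
  have hAc := hA.cont
  obtain ⟨E, hE, hsymm, hexp⟩ := hf.exists_log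
  obtain ⟨Θ, hΘ, hΘexp⟩ := hf.exists_displacement_log
  set ℓ := q - p + 3 * T with hℓ
  obtain ⟨L, hL, hLexp, ⟨c₁, hc₁⟩, c₂, hc₂⟩ :=
    exists_chord_log (ℓ := ℓ) hT hA.cont hA.equi (by linarith)
      (fun s t h _ hst => by have := hA.inj hst; linarith) hE hexp hΘ hΘexp
  set J := uIcc (p + T) (q - T) with hJ
  have hJpq : ∀ t ∈ J, p < t ∧ t < q := by
    intro t ht
    rcases le_total (p + T) (q - T) with h | h
    · rw [hJ, uIcc_of_le h] at ht; constructor <;> linarith [ht.1, ht.2]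
    · rw [hJ, uIcc_of_ge h] at ht; constructor <;> linarith [ht.1, ht.2]
  have hpJ : p + T ∈ J := left_mem_uIcc
  have hqJ : q - T ∈ J := right_mem_uIcc
  have h01 : (0 : ℝ) ∈ Icc (0 : ℝ) 1 := by simp
  have h11 : (1 : ℝ) ∈ Icc (0 : ℝ) 1 := by simp
  obtain ⟨N, hN, hNexp⟩ := exists_log_of_convex ((convex_uIcc (p + T) (q - T)).prod
    (convex_Icc (0 : ℝ) 1)) (F := fun z : ℝ × ℝ => A z.1 - e z.2) (by fun_prop)
    (fun z hz => sub_ne_zero.2 (havoid _ hz.1 _ hz.2))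
  obtain ⟨M, hM, hMexp⟩ := exists_log_of_convex ((convex_Icc (0 : ℝ) 1).prod
    (convex_Icc (0 : ℝ) 1)) (F := fun z : ℝ × ℝ => f (e z.2) - e z.1) (by fun_prop)
    (fun z hz => sub_ne_zero.2 (hfe _ hz.1 _ hz.2).symm)
  have hNt : ∀ t ∈ J, ContinuousOn (fun x => N (t, x)) (Icc (0 : ℝ) 1) := fun t ht =>
    hN.comp (by fun_prop) (fun x hx => ⟨ht, hx⟩)
  have hNx : ∀ x ∈ Icc (0 : ℝ) 1, ContinuousOn (fun t => N (t, x)) J := fun x hx =>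
    hN.comp (by fun_prop) (fun t ht => ⟨ht, hx⟩)
  -- the variation of the argument along `e` seen from a point of the line
  obtain ⟨c, hc0, hc⟩ := log_sub_const_of_neg (convex_uIcc (p + T) (q - T)).isPreconnected
    (L := fun t => N (t, 1) - N (t, 0) + L (p, t)) (M := fun t => L (t, q))
    (((hNx 1 h11).sub (hNx 0 h01)).add (hL.comp (by fun_prop) (fun t ht => by
      have := hJpq t ht
      constructor <;> simp only <;> linarith)))
    (hL.comp (by fun_prop) (fun t ht => by
      have := hJpq t ht
      constructor <;> simp only <;> linarith))
    (fun t ht => by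
      have := hJpq t ht
      have hne : A t - A p ≠ 0 := sub_ne_zero.2 fun h => by have := hA.inj h; linarith
      rw [Complex.exp_add, Complex.exp_sub, hNexp (t, 1) ⟨ht, h11⟩, hNexp (t, 0) ⟨ht, h01⟩,
        hLexp _ _ (by linarith) (by linarith), hLexp _ _ (by linarith) (by linarith)]
      simp only [he0, he1]
      field_simp
      ring)
  have hdiag := log_delta (convex_Icc (0 : ℝ) 1).isPreconnected (k := 1)
    (L := fun x => M (x, x)) (M := fun x => Θ (e x))
    (hM.comp (by fun_prop) (fun x hx => ⟨hx, hx⟩)) (by fun_prop) one_ne_zero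
    (fun x hx => by rw [hMexp (x, x) ⟨hx, hx⟩, hΘexp, one_mul]) h11 h01
  have hbot := log_delta (convex_Icc (0 : ℝ) 1).isPreconnected (k := 1)
    (L := fun x => M (x, 0)) (M := fun x => N (p + T, x))
    (hM.comp (by fun_prop) (fun x hx => ⟨hx, h01⟩)) (hNt _ hpJ) one_ne_zero
    (fun x hx => by
      rw [hMexp (x, 0) ⟨hx, h01⟩, hNexp (p + T, x) ⟨hpJ, hx⟩, one_mul]
      simp only [he0, hA.equi p]) h11 h01
  have hright := log_delta (convex_Icc (0 : ℝ) 1).isPreconnected (k := -1)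
    (L := fun y => M (1, y)) (M := fun y => N (q - T, y) + E (A (q - T), e y))
    (hM.comp (by fun_prop) (fun x hx => ⟨h11, hx⟩)) ((hNt _ hqJ).add
      (hE.comp (by fun_prop) (fun x hx => havoid _ hqJ x hx))) (by norm_num)
    (fun x hx => by
      have hne := havoid _ hqJ x hx
      have hne' := sub_ne_zero.2 hne
      rw [hMexp (1, x) ⟨h11, hx⟩, Complex.exp_add, hNexp (q - T, x) ⟨hqJ, hx⟩, hexp _ _ hne,
        hA.equi, sub_add_cancel]
      simp only [he1]
      field_simp
      ring) h11 h01
  have e1 := hc _ hpJ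
  have e2 := hc _ hqJ
  have e3 := hc₁ (q - T) q (by linarith) (by linarith)
  have e4 := hc₁ p (q - T) (by linarith) (by linarith)
  have e5 := hc₂ p
  have e6 := hc₂ q
  rw [sub_add_cancel] at e3 e4
  rw [hsymm (A p)] at e4
  simp only [he0, he1] at hdiag hright
  apply hc0
  have : 2 * c = 0 := by
    linear_combination hdiag - hbot - hright - e1 - e2 + e3 - e4 + e5 - e6
  simpa using this

/-- `ζ - z` has a continuous logarithm on `U`. -/
def HasLog (U : Set ℂ) (z : ℂ) : Prop :=
  ∃ g : ℂ → ℂ, ContinuousOn g U ∧ ∀ ζ ∈ U, Complex.exp (g ζ) = ζ - z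

/-- `z` can be joined to points of arbitrarily large modulus in the complement of `U`. -/
def Escapes (U : Set ℂ) (z : ℂ) : Prop := ∀ M : ℝ, ∃ q : ℂ, M < ‖q‖ ∧ JoinedIn Uᶜ z q

theorem HasLog.notMem {U : Set ℂ} {z : ℂ} (h : HasLog U z) : z ∉ U := by
  obtain ⟨g, -, hg⟩ := h
  intro hz
  have := hg z hz
  rw [sub_self] at this
  exact Complex.exp_ne_zero _ this

theorem hasLog_of_norm_lt {U : Set ℂ} {z : ℂ} (h : ∀ ζ ∈ U, ‖ζ‖ < ‖z‖) : HasLog U z := by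
  have key : ∀ ζ ∈ U, z ≠ 0 ∧ 1 - ζ / z ∈ Complex.slitPlane := by
    intro ζ hζ
    have h1 := h ζ hζ
    have hz : 0 < ‖z‖ := (norm_nonneg _).trans_lt h1
    refine ⟨norm_pos_iff.1 hz, Or.inl ?_⟩
    have h2 : ‖ζ / z‖ < 1 := by rwa [norm_div, div_lt_one hz]
    have := (Complex.re_le_norm (ζ / z)).trans_lt h2
    simp only [Complex.sub_re, Complex.one_re]
    linarith
  refine ⟨fun ζ => Complex.log (1 - ζ / z) + Complex.log (-z), ?_, ?_⟩
  · exact (ContinuousOn.clog (by fun_prop) fun ζ hζ => (key ζ hζ).2).add continuousOn_const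
  · intro ζ hζ
    obtain ⟨h1, h2⟩ := key ζ hζ
    rw [Complex.exp_add, Complex.exp_log (Complex.slitPlane_ne_zero h2),
      Complex.exp_log (neg_ne_zero.2 h1)]
    field_simp
    ring

theorem exists_ratio_log {U : Set ℂ} {z w : ℂ} (h : JoinedIn Uᶜ z w) :
    ∃ g : ℂ → ℂ, ContinuousOn g U ∧ ∀ ζ ∈ U, Complex.exp (g ζ) = (ζ - w) / (ζ - z) := by
  classical
  obtain ⟨γ, hγ⟩ := h
  have hne : ∀ (t : unitInterval) (ζ : U), (ζ : ℂ) - γ t ≠ 0 := fun t ζ h =>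
    hγ t (by rw [← sub_eq_zero.1 h]; exact ζ.2)
  let H : C(unitInterval × U, {z : ℂ // z ≠ 0}) :=
    ⟨fun q => ⟨((q.2 : ℂ) - γ q.1) / ((q.2 : ℂ) - z), div_ne_zero (hne q.1 q.2) (by
        simpa using hne 0 q.2)⟩, by
      refine Continuous.subtype_mk (Continuous.div (by fun_prop) (by fun_prop) fun q => by
        simpa using hne 0 q.2) _⟩
  have H0 : ∀ a, H (0, a) = (fun z : ℂ ↦ (⟨_, z.exp_ne_zero⟩ : {z : ℂ // z ≠ 0}))
      ((0 : C(U, ℂ)) a) := by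
    intro a
    apply Subtype.ext
    have : (a : ℂ) - z ≠ 0 := by simpa using hne 0 a
    simp [H, this]
  obtain ⟨G, hlift⟩ : ∃ G : C(unitInterval × U, ℂ), ∀ q, Complex.exp (G q) = H q :=
    ⟨Complex.isCoveringMap_exp.liftHomotopy H 0 H0, fun q => congr_arg Subtype.val
        (congr_fun (Complex.isCoveringMap_exp.liftHomotopy_lifts H 0 H0) q)⟩
  refine ⟨fun ζ => if h : ζ ∈ U then G (1, ⟨ζ, h⟩) else 0, ?_, fun ζ hζ => ?_⟩
  · rw [continuousOn_iff_continuous_domRestrict]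
    convert! (map_continuous G).comp
      (by fun_prop : Continuous fun a : U => ((1 : unitInterval), a)) using 1
    ext ζ
    simp only [domRestrict_apply, Function.comp_apply]
    exact dif_pos ζ.2
  · rw [show (fun ζ => if h : ζ ∈ U then G (1, ⟨ζ, h⟩) else 0) ζ = G (1, ⟨ζ, hζ⟩) from dif_pos hζ,
      hlift]
    simp [H]

theorem HasLog.of_joinedIn {U : Set ℂ} {z w : ℂ} (hz : HasLog U z) (h : JoinedIn Uᶜ z w) :
    HasLog U w := by
  obtain ⟨g, hg, hg'⟩ := hz
  obtain ⟨r, hr, hr'⟩ := exists_ratio_log h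
  refine ⟨fun ζ => g ζ + r ζ, hg.add hr, fun ζ hζ => ?_⟩
  have : ζ - z ≠ 0 := by rw [← hg' ζ hζ]; exact Complex.exp_ne_zero _
  rw [Complex.exp_add, hg' ζ hζ, hr' ζ hζ]
  field_simp

theorem HasLog.of_escapes {U : Set ℂ} (hU : Bornology.IsBounded U) {z : ℂ} (hz : Escapes U z) :
    HasLog U z := by
  obtain ⟨R, hR⟩ := hU.exists_norm_le
  obtain ⟨q, hq, hzq⟩ := hz R
  exact (hasLog_of_norm_lt fun ζ hζ => (hR ζ hζ).trans_lt hq).of_joinedIn hzq.symm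

theorem no_log_of_bounded_component {U : Set ℂ} (hU : IsClosed U) {z : ℂ} (hz : z ∉ U)
    (hb : Bornology.IsBounded (pathComponentIn Uᶜ z)) {n : ℕ} (hn : n ≠ 0) {h : ℂ → ℂ}
    (hh : Continuous h) (hne : ∀ ζ ∈ pathComponentIn Uᶜ z ∪ U, h ζ ≠ 0) {g : ℂ → ℂ}
    (hg : ContinuousOn g U) (hexp : ∀ ζ ∈ U, Complex.exp (g ζ) = (ζ - z) ^ n * h ζ) : False := by
  classical
  set C := pathComponentIn Uᶜ z with hC
  have hCo : IsOpen C := hU.isOpen_compl.pathComponentIn z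
  have hzC : z ∈ C := mem_pathComponentIn_self hz
  have hcl : closure C ⊆ C ∪ U := by
    intro w hw
    by_cases hwU : w ∈ U
    · exact Or.inr hwU
    left
    have h1 : pathComponentIn Uᶜ w ∈ 𝓝 w :=
      pathComponentIn_mem_nhds (hU.isOpen_compl.mem_nhds hwU)
    obtain ⟨v, hv, hv'⟩ := mem_closure_iff_nhds.1 hw _ h1
    exact hv'.trans hv.symm
  have hfr : frontier C ⊆ U := by
    intro w hw
    rw [hCo.frontier_eq] at hw
    exact (hcl hw.1).resolve_left hw.2
  obtain ⟨G, hG⟩ := ContinuousMap.exists_restrict_eq hU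
    ⟨U.domRestrict g, continuousOn_iff_continuous_domRestrict.mp hg⟩
  have hG' : ∀ ζ ∈ U, G ζ = g ζ := fun ζ hζ => DFunLike.congr_fun hG ⟨ζ, hζ⟩
  let F : ℂ → ℂ := fun ζ => if ζ ∈ C then Complex.exp (G ζ) / h ζ else (ζ - z) ^ n
  have hF : Continuous F := by
    rw [← continuousOn_univ]
    refine ContinuousOn.if ?_ ?_ ?_
    · rintro a ⟨-, ha⟩
      have ha' := hfr ha
      rw [hG' a ha', hexp a ha', mul_div_cancel_right₀ _ (hne a (Or.inr ha'))]
    · refine ContinuousOn.div (by fun_prop) hh.continuousOn fun ζ hζ => hne ζ (hcl hζ.2)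
    · fun_prop
  have hF0 : ∀ ζ, F ζ ≠ 0 := by
    intro ζ
    by_cases hζ : ζ ∈ C
    · simp only [F, hζ, if_true]
      exact div_ne_zero (Complex.exp_ne_zero _) (hne ζ (Or.inl hζ))
    · simp only [F, hζ, if_false]
      exact pow_ne_zero _ (sub_ne_zero.2 fun h => hζ (h ▸ hzC))
  obtain ⟨Λ, hΛ, hΛexp⟩ := exists_log_of_convex (convex_univ (𝕜 := ℝ) (E := ℂ))
    hF.continuousOn (fun z _ => hF0 z)
  obtain ⟨R, hR⟩ := hb.exists_norm_le
  have hRpos : (0 : ℝ) ≤ R := (norm_nonneg _).trans (hR z hzC)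
  set ρ : ℝ := 2 * R + 1 with hρ
  have hout : ∀ θ : ℝ, z + ρ * Complex.exp (θ * Complex.I) ∉ C := by
    intro θ hθ
    have h1 := hR _ hθ
    have h2 := hR z hzC
    have h3 : ‖(ρ : ℂ) * Complex.exp (θ * Complex.I)‖ = ρ := by
      rw [norm_mul, Complex.norm_exp_ofReal_mul_I, mul_one, Complex.norm_real, Real.norm_eq_abs,
        abs_of_pos (by linarith)]
    have h4 := norm_sub_le (z + ρ * Complex.exp (θ * Complex.I)) z
    rw [add_sub_cancel_left, h3] at h4
    linarith
  have := log_delta (isPreconnected_univ (α := ℝ)) (k := (ρ : ℂ) ^ n)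
    (L := fun θ => Λ (z + ρ * Complex.exp (θ * Complex.I))) (M := fun θ => n * (θ * Complex.I))
    (hΛ.comp (by fun_prop) (fun _ _ => mem_univ _)) (by fun_prop)
    (pow_ne_zero _ (by exact_mod_cast (by linarith : ρ ≠ 0)))
    (fun θ _ => by
      rw [hΛexp _ (mem_univ _)]
      simp only [F, hout, if_false]
      rw [add_sub_cancel_left, mul_pow, ← Complex.exp_nat_mul])
    (mem_univ (2 * Real.pi)) (mem_univ 0)
  simp [Complex.exp_two_pi_mul_I, hn, Real.pi_ne_zero] at this

theorem escapes_or_bounded {U : Set ℂ} (z : ℂ) :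
    Escapes U z ∨ Bornology.IsBounded (pathComponentIn Uᶜ z) := by
  by_cases h : Escapes U z
  · exact Or.inl h
  · right
    simp only [Escapes, not_forall, not_exists, not_and] at h
    obtain ⟨M, hM⟩ := h
    refine isBounded_iff_forall_norm_le.2 ⟨M, fun q hq => ?_⟩
    by_contra hlt
    exact hM q (not_le.1 hlt) hq

theorem HasLog.escapes {U : Set ℂ} (hU : IsClosed U) {z : ℂ} (hz : HasLog U z) :
    Escapes U z := by
  refine (escapes_or_bounded z).resolve_right fun hb => ?_
  obtain ⟨g, hg, hg'⟩ := hz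
  exact no_log_of_bounded_component hU (HasLog.notMem ⟨g, hg, hg'⟩) hb one_ne_zero
    (h := fun _ => 1) continuous_const (by simp) hg (by simpa using hg')

theorem HasLog.of_mul {J : Set ℂ} (hJ : IsCompact J) {z z' : ℂ} {g : ℂ → ℂ}
    (hg : ContinuousOn g J) (hexp : ∀ ζ ∈ J, Complex.exp (g ζ) = (ζ - z) * (ζ - z')) :
    HasLog J z := by
  have hne : ∀ ζ ∈ J, ζ - z ≠ 0 ∧ ζ - z' ≠ 0 := fun ζ hζ => by
    have := Complex.exp_ne_zero (g ζ)
    rw [hexp ζ hζ] at this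
    exact ⟨left_ne_zero_of_mul this, right_ne_zero_of_mul this⟩
  have hz : z ∉ J := fun h => (hne z h).1 (sub_self z)
  have hz' : z' ∉ J := fun h => (hne z' h).2 (sub_self z')
  rcases escapes_or_bounded (U := J) z with h | hb
  · exact HasLog.of_escapes hJ.isBounded h
  exfalso
  by_cases hzz : z' ∈ pathComponentIn Jᶜ z
  · obtain ⟨r, hr, hr'⟩ := exists_ratio_log (JoinedIn.symm hzz)
    refine no_log_of_bounded_component hJ.isClosed hz hb two_ne_zero
      (h := fun _ => 1) continuous_const (by simp) (hg.add hr) (fun ζ hζ => ?_)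
    have := (hne ζ hζ).2
    rw [Pi.add_apply, Complex.exp_add, hexp ζ hζ, hr' ζ hζ]
    field_simp
  · refine no_log_of_bounded_component hJ.isClosed hz hb one_ne_zero (h := fun ζ => ζ - z')
      (by fun_prop) ?_ hg (fun ζ hζ => by rw [hexp ζ hζ, pow_one])
    rintro ζ (hζ | hζ)
    · exact sub_ne_zero.2 fun h => hzz (h ▸ hζ)
    · exact (hne ζ hζ).2

theorem exists_glue {X Y : Type*} [TopologicalSpace X] [TopologicalSpace Y] {K₁ K₂ : Set X}
    (h₁ : IsClosed K₁) (h₂ : IsClosed K₂) {g₁ g₂ : X → Y} (hg₁ : ContinuousOn g₁ K₁)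
    (hg₂ : ContinuousOn g₂ K₂) (h : ∀ x ∈ K₁, x ∈ K₂ → g₁ x = g₂ x) :
    ∃ g : X → Y, ContinuousOn g (K₁ ∪ K₂) ∧ EqOn g g₁ K₁ ∧ EqOn g g₂ K₂ := by
  classical
  have e1 : EqOn (fun x => if x ∈ K₁ then g₁ x else g₂ x) g₁ K₁ := fun x hx => if_pos hx
  have e2 : EqOn (fun x => if x ∈ K₁ then g₁ x else g₂ x) g₂ K₂ := fun x hx => by
    by_cases hx1 : x ∈ K₁
    · exact (if_pos hx1).trans (h x hx1 hx)
    · exact if_neg hx1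
  exact ⟨_, (hg₁.congr e1).union_of_isClosed (hg₂.congr e2) h₁ h₂, e1, e2⟩

theorem exists_descend {K : Set ℝ} (hK : IsCompact K) {A : ℝ → ℂ} (hA : ContinuousOn A K)
    (hinj : InjOn A K) {u : ℝ → ℂ} (hu : ContinuousOn u K) :
    ∃ g : ℂ → ℂ, ContinuousOn g (A '' K) ∧ ∀ t ∈ K, g (A t) = u t := by
  have hinv : ∀ t ∈ K, u (Function.invFunOn A K (A t)) = u t := fun t ht =>
    congrArg u (hinj.leftInvOn_invFunOn ht)
  refine ⟨fun y => u (Function.invFunOn A K y), ?_, hinv⟩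
  rw [continuousOn_iff_isClosed]
  intro t ht
  obtain ⟨v, hv, hv'⟩ := continuousOn_iff_isClosed.1 hu t ht
  refine ⟨A '' (v ∩ K), ((hK.inter_left hv).image_of_continuousOn
    (hA.mono inter_subset_right)).isClosed, ?_⟩
  ext y
  constructor
  · rintro ⟨hy, x, hx, rfl⟩
    have : x ∈ u ⁻¹' t ∩ K := ⟨by simpa [hinv x hx] using hy, hx⟩
    rw [hv'] at this
    exact ⟨⟨x, this, rfl⟩, x, hx, rfl⟩
  · rintro ⟨⟨x, hx, rfl⟩, -⟩
    have hx' := hx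
    rw [← hv'] at hx'
    exact ⟨by simpa [hinv x hx.2] using hx'.1, x, hx.2, rfl⟩

theorem hasLog_arc {A : ℝ → ℂ} {a b : ℝ} (hA : ContinuousOn A (Icc a b))
    (hinj : InjOn A (Icc a b)) {z : ℂ} (hz : ∀ t ∈ Icc a b, A t ≠ z) :
    HasLog (A '' Icc a b) z := by
  obtain ⟨L, hL, hexp⟩ := exists_log_of_convex (convex_Icc a b) (F := fun t => A t - z)
    (hA.sub continuousOn_const) (fun t ht => sub_ne_zero.2 (hz t ht))
  obtain ⟨g, hg, hg'⟩ := exists_descend isCompact_Icc hA hinj hL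
  refine ⟨g, hg, ?_⟩
  rintro _ ⟨t, ht, rfl⟩
  rw [hg' t ht, hexp t ht]

theorem HasLog.mono {U V : Set ℂ} {z : ℂ} (h : HasLog U z) (hVU : V ⊆ U) : HasLog V z := by
  obtain ⟨g, hg, hg'⟩ := h
  exact ⟨g, hg.mono hVU, fun ζ hζ => hg' ζ (hVU hζ)⟩

theorem HasLog.union {K₁ K₂ : Set ℂ} (h₁ : IsClosed K₁) (h₂ : IsClosed K₂) {z w : ℂ}
    (hl₁ : HasLog K₁ z) (hl₂ : HasLog K₂ z) (hw : ∀ ζ ∈ K₁, ζ ∈ K₂ → ζ = w) :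
    HasLog (K₁ ∪ K₂) z := by
  obtain ⟨g₁, hg₁, hg₁'⟩ := hl₁
  obtain ⟨g₂, hg₂, hg₂'⟩ := hl₂
  obtain ⟨m, hm1, hm2⟩ : ∃ m : ℂ, Complex.exp m = 1 ∧ ∀ ζ ∈ K₁, ζ ∈ K₂ → g₁ ζ = g₂ ζ + m := by
    by_cases h : w ∈ K₁ ∧ w ∈ K₂
    · refine ⟨g₁ w - g₂ w, ?_, fun ζ h1 h2 => by rw [hw ζ h1 h2]; ring⟩
      rw [Complex.exp_sub, hg₁' w h.1, hg₂' w h.2, div_self]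
      rw [← hg₁' w h.1]; exact Complex.exp_ne_zero _
    · refine ⟨0, Complex.exp_zero, fun ζ h1 h2 => ?_⟩
      have := hw ζ h1 h2
      subst this
      exact absurd ⟨h1, h2⟩ h
  obtain ⟨g, hg, e1, e2⟩ := exists_glue h₁ h₂ hg₁ (hg₂.add_const m) hm2
  refine ⟨g, hg, ?_⟩
  rintro ζ (hζ | hζ)
  · rw [e1 hζ, hg₁' ζ hζ]
  · rw [e2 hζ, Complex.exp_add, hm1, mul_one, hg₂' ζ hζ]

theorem joinedIn_of_curve {A : ℝ → ℂ} (hA : Continuous A) {U : Set ℂ} {s t : ℝ}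
    (h : ∀ x ∈ uIcc s t, A x ∉ U) : JoinedIn Uᶜ (A s) (A t) := by
  have h1 : IsPathConnected (A '' uIcc s t) :=
    ((convex_uIcc s t).isPathConnected ⟨s, left_mem_uIcc⟩).image hA
  refine (h1.joinedIn _ ⟨s, left_mem_uIcc, rfl⟩ _ ⟨t, right_mem_uIcc, rfl⟩).mono ?_
  rintro _ ⟨x, hx, rfl⟩
  exact h x hx

theorem HasIdx.exists_lune_log {f : ℂ ≃ₜ ℂ} (hf : HasIdx f) {T p q : ℝ} {A e : ℝ → ℂ}
    (hA : Line f T A) (hpq : p < q) (he : Continuous e) (hinj : InjOn e (Icc 0 1))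
    (he0 : e 0 = A p) (he1 : e 1 = A q)
    (hfe : ∀ x ∈ Icc (0 : ℝ) 1, ∀ y ∈ Icc (0 : ℝ) 1, e x ≠ f (e y))
    (havoid : ∀ t ∈ Icc (p - T) (q + T), ∀ x ∈ Ioo (0 : ℝ) 1, e x ≠ A t) :
    ∃ g : ℂ → ℂ, ContinuousOn g (A '' Icc p q ∪ e '' Icc 0 1) ∧
      ∀ ζ ∈ A '' Icc p q ∪ e '' Icc 0 1,
        Complex.exp (g ζ) = (ζ - A (q + T)) * (ζ - A (p - T)) := by
  have hT := hA.pos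
  have hAc := hA.cont
  obtain ⟨E, hE, hsymm, hexp⟩ := hf.exists_log
  obtain ⟨Θ, hΘ, hΘexp⟩ := hf.exists_displacement_log
  obtain ⟨L, hL, hLexp, ⟨c₁, hc₁⟩, c₂, hc₂⟩ :=
    exists_chord_log (ℓ := q - p + 3 * T) hT hA.cont hA.equi (by linarith)
      (fun s t h _ hst => by have := hA.inj hst; linarith) hE hexp hΘ hΘexp
  have h01 : (0 : ℝ) ∈ Icc (0 : ℝ) 1 := by simp
  have h11 : (1 : ℝ) ∈ Icc (0 : ℝ) 1 := by simp
  have hpre := (convex_Icc (0 : ℝ) 1).isPreconnected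
  have hz : ∀ t ∈ Icc (p - T) (q + T), t ≠ p → t ≠ q → ∀ x ∈ Icc (0 : ℝ) 1, e x - A t ≠ 0 := by
    intro t ht htp htq x hx h
    rw [sub_eq_zero] at h
    rcases eq_or_lt_of_le hx.1 with rfl | h0
    · exact htp (hA.inj (he0.symm.trans h)).symm
    rcases eq_or_lt_of_le hx.2 with rfl | h1
    · exact htq (hA.inj (he1.symm.trans h)).symm
    exact havoid t ht x ⟨h0, h1⟩ h
  have mz : q + T ∈ Icc (p - T) (q + T) := ⟨by linarith, le_rfl⟩
  have mz' : p - T ∈ Icc (p - T) (q + T) := ⟨le_rfl, by linarith⟩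
  have hz1 := hz _ mz (by linarith) (by linarith)
  have hz2 := hz _ mz' (by linarith) (by linarith)
  obtain ⟨μ, hμ, hμexp⟩ := exists_log_of_convex (convex_Icc (0 : ℝ) 1)
    (F := fun x => e x - A (q + T)) (by fun_prop) hz1
  obtain ⟨ν, hν, hνexp⟩ := exists_log_of_convex (convex_Icc (0 : ℝ) 1)
    (F := fun x => e x - A (p - T)) (by fun_prop) hz2
  obtain ⟨M, hM, hMexp⟩ := exists_log_of_convex ((convex_Icc (0 : ℝ) 1).prod
    (convex_Icc (0 : ℝ) 1)) (F := fun z : ℝ × ℝ => f (e z.2) - e z.1) (by fun_prop)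
    (fun z hz => sub_ne_zero.2 (hfe _ hz.1 _ hz.2).symm)
  have hdiag := log_delta hpre (k := 1)
    (L := fun x => M (x, x)) (M := fun x => Θ (e x))
    (hM.comp (by fun_prop) (fun x hx => ⟨hx, hx⟩)) (by fun_prop) one_ne_zero
    (fun x hx => by rw [hMexp (x, x) ⟨hx, hx⟩, hΘexp, one_mul]) h11 h01
  have hleft := log_delta hpre (k := 1)
    (L := fun y => M (0, y)) (M := fun y => ν y + E (A (p - T), e y))
    (hM.comp (by fun_prop) (fun x hx => ⟨h01, hx⟩)) (hν.add
      (hE.comp (by fun_prop) (fun x hx => (sub_ne_zero.1 (hz2 x hx)).symm))) one_ne_zero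
    (fun x hx => by
      have hne' := hz2 x hx
      rw [hMexp (0, x) ⟨h01, hx⟩, Complex.exp_add, hνexp x hx, hsymm,
        hexp _ _ (sub_ne_zero.1 hne'), hA.equi, sub_add_cancel]
      simp only [he0]
      field_simp) h11 h01
  have htop := log_delta hpre (k := -1)
    (L := fun x => M (x, 1)) (M := μ)
    (hM.comp (by fun_prop) (fun x hx => ⟨hx, h11⟩)) hμ (by norm_num)
    (fun x hx => by
      rw [hMexp (x, 1) ⟨hx, h11⟩, hμexp x hx]
      simp only [he1, hA.equi q]
      ring) h11 h01
  have e3 := hc₁ (p - T) q (by linarith) (by linarith)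
  have e4 := hc₁ (p - T) p (by linarith) (by linarith)
  have e5 := hc₂ p
  have e6 := hc₂ q
  rw [sub_add_cancel] at e3 e4
  simp only [he0, he1] at hdiag hleft
  have key : μ 1 - μ 0 + (ν 1 - ν 0) =
      L (q, q + T) + L (p - T, q) - (L (p, q + T) + L (p - T, p)) := by
    linear_combination hdiag - hleft - htop + e3 - e4 + e5 - e6
  have hAm : ∀ t ∈ Icc p q, Complex.exp (L (t, q + T) + L (p - T, t) + Real.pi * Complex.I)
      = (A t - A (q + T)) * (A t - A (p - T)) := by
    intro t ht
    rw [Complex.exp_add, Complex.exp_add, Complex.exp_pi_mul_I,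
      hLexp _ _ (by linarith [ht.2]) (by linarith [ht.1]),
      hLexp _ _ (by linarith [ht.1]) (by linarith [ht.2])]
    ring
  obtain ⟨g₁, hg₁, hg₁'⟩ := exists_descend (isCompact_Icc (a := p) (b := q)) hAc.continuousOn
    hA.inj.injOn (u := fun t => L (t, q + T) + L (p - T, t) + Real.pi * Complex.I)
    (((hL.comp (by fun_prop) (fun t ht => ⟨by simp only; linarith [ht.2],
      by simp only; linarith [ht.1]⟩)).add (hL.comp (by fun_prop) (fun t ht =>
      ⟨by simp only; linarith [ht.1], by simp only; linarith [ht.2]⟩))).add continuousOn_const)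
  set k := L (p, q + T) + L (p - T, p) + Real.pi * Complex.I - μ 0 - ν 0 with hk
  have hkexp : Complex.exp k = 1 := by
    have h1 := hμexp 0 h01
    have h2 := hνexp 0 h01
    rw [hk, Complex.exp_sub, Complex.exp_sub, hAm p ⟨le_rfl, hpq.le⟩, h1, h2, ← he0]
    have := hz1 0 h01
    have := hz2 0 h01
    field_simp
  obtain ⟨g₂, hg₂, hg₂'⟩ := exists_descend isCompact_Icc he.continuousOn
    hinj (u := fun t => μ t + ν t + k) ((hμ.add hν).add continuousOn_const)
  obtain ⟨g, hg, hgA, hge⟩ := exists_glue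
    (isCompact_Icc.image_of_continuousOn hAc.continuousOn).isClosed
    (isCompact_Icc.image_of_continuousOn he.continuousOn).isClosed hg₁ hg₂ (by
      rintro _ ⟨t, ht, rfl⟩ ⟨x, hx, hxt⟩
      rw [hg₁' t ht]
      by_cases htp : t = p
      · subst htp
        rw [← he0, hg₂' 0 h01]
        simp only [hk]; ring
      by_cases htq : t = q
      · subst htq
        rw [← he1, hg₂' 1 h11]
        simp only [hk]
        linear_combination -key
      exact absurd hxt (sub_ne_zero.1 (hz t ⟨by linarith [ht.1], by linarith [ht.2]⟩ htp htq x hx)))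
  refine ⟨g, hg, ?_⟩
  rintro _ (⟨t, ht, rfl⟩ | ⟨x, hx, rfl⟩)
  · rw [hgA ⟨t, ht, rfl⟩, hg₁' t ht, hAm t ht]
  · rw [hge ⟨x, hx, rfl⟩, hg₂' x hx, Complex.exp_add, Complex.exp_add, hkexp, mul_one,
      hμexp x hx, hνexp x hx]

theorem HasIdx.lune_escapes {f : ℂ ≃ₜ ℂ} (hf : HasIdx f) {T p q m M p' q' s : ℝ} {A e : ℝ → ℂ}
    (hA : Line f T A) (hpq : p < q) (he : Continuous e) (hinj : InjOn e (Icc 0 1))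
    (he0 : e 0 = A p) (he1 : e 1 = A q)
    (hfe : ∀ x ∈ Icc (0 : ℝ) 1, ∀ y ∈ Icc (0 : ℝ) 1, e x ≠ f (e y))
    (hm : m ≤ p - T) (hM : q + T ≤ M)
    (havoid : ∀ t ∈ Icc m M, ∀ x ∈ Ioo (0 : ℝ) 1, e x ≠ A t)
    (hp' : p' ≤ p) (hmp : m ≤ p') (hq' : q ≤ q') (hqM : q' ≤ M)
    (hs : s ∈ Icc m M) (hs' : s ∉ Icc p' q') :
    Escapes (A '' Icc p' q' ∪ e '' Icc 0 1) (A s) := by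
  have hT := hA.pos
  have hAc := hA.cont
  obtain ⟨g, hg, hgexp⟩ := hf.exists_lune_log hA hpq he hinj he0 he1 hfe
    (fun t ht => havoid t ⟨by linarith [ht.1], by linarith [ht.2]⟩)
  have cA : ∀ a b, IsCompact (A '' Icc a b) := fun a b => isCompact_Icc.image hAc
  have ce : IsCompact (e '' Icc 0 1) := isCompact_Icc.image he
  have hz : ∀ t ∈ Icc m M, ∀ x ∈ Icc (0 : ℝ) 1, e x = A t → t = p ∨ t = q := by
    intro t ht x hx h
    rcases eq_or_lt_of_le hx.1 with rfl | h0
    · exact Or.inl (hA.inj (he0.symm.trans h)).symm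
    rcases eq_or_lt_of_le hx.2 with rfl | h1
    · exact Or.inr (hA.inj (he1.symm.trans h)).symm
    exact absurd h (havoid t ht x ⟨h0, h1⟩)
  have hJ : ∀ t ∈ Icc m M, A t ∈ A '' Icc p q ∪ e '' Icc 0 1 → t ∈ Icc p q := by
    rintro t ht (⟨t', ht', h⟩ | ⟨x, hx, h⟩)
    · exact hA.inj h ▸ ht'
    · rcases hz t ht x hx h with rfl | rfl
      · exact ⟨le_rfl, hpq.le⟩
      · exact ⟨hpq.le, le_rfl⟩
  have hlog : HasLog (A '' Icc p q ∪ e '' Icc 0 1) (A s) := by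
    by_cases hsq : q' < s
    · refine (HasLog.of_mul ((cA _ _).union ce) hg hgexp).of_joinedIn (joinedIn_of_curve hAc ?_)
      intro x hx hxJ
      have hx1 : min (q + T) s ≤ x := hx.1
      have hx2 : x ≤ max (q + T) s := hx.2
      have hxM : x ≤ M := hx2.trans (max_le hM hs.2)
      have hqx : q < x := (lt_min (by linarith) (by linarith)).trans_le hx1
      linarith [(hJ x ⟨by linarith, hxM⟩ hxJ).2]
    · have hsp : s < p' := by
        by_contra! h
        exact hs' ⟨h, not_lt.1 hsq⟩
      refine (HasLog.of_mul (z := A (p - T)) (z' := A (q + T)) ((cA _ _).union ce) hg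
        (fun ζ hζ => by rw [hgexp ζ hζ, mul_comm])).of_joinedIn (joinedIn_of_curve hAc ?_)
      intro x hx hxJ
      have hx1 : min (p - T) s ≤ x := hx.1
      have hx2 : x ≤ max (p - T) s := hx.2
      have hxM : m ≤ x := (le_min hm hs.1).trans hx1
      have hqx : x < p := hx2.trans_lt (max_lt (by linarith) (by linarith))
      linarith [(hJ x ⟨hxM, by linarith⟩ hxJ).1]
  have hl1 : HasLog (A '' Icc p' p) (A s) := hasLog_arc hAc.continuousOn hA.inj.injOn
    fun t ht h => hs' (hA.inj h ▸ ⟨ht.1, by linarith [ht.2]⟩)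
  have hl2 : HasLog (A '' Icc q q') (A s) := hasLog_arc hAc.continuousOn hA.inj.injOn
    fun t ht h => hs' (hA.inj h ▸ ⟨by linarith [ht.1], ht.2⟩)
  have h3 := HasLog.union (cA _ _).isClosed ((cA _ _).union ce).isClosed (w := A p) hl1 hlog (by
    rintro _ ⟨t, ht, rfl⟩ h
    rw [le_antisymm ht.2 (hJ t ⟨by linarith [ht.1], by linarith [ht.2]⟩ h).1])
  have h4 := HasLog.union ((cA _ _).union ((cA _ _).union ce)).isClosed (cA _ _).isClosed
      (w := A q) h3 hl2 (by
    rintro _ h ⟨t, ht, rfl⟩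
    rcases h with ⟨t', ht', h⟩ | h
    · have := hA.inj h
      linarith [ht'.2, ht.1]
    · rw [le_antisymm ht.1 (hJ t ⟨by linarith [ht.1], by linarith [ht.2]⟩ h).2])
  refine (h4.mono ?_).escapes ((cA _ _).union ce).isClosed
  rintro ζ (⟨t, ht, rfl⟩ | h)
  · rcases le_total t p with h1 | h1
    · exact Or.inl (Or.inl ⟨t, ⟨ht.1, h1⟩, rfl⟩)
    rcases le_total t q with h2 | h2
    · exact Or.inl (Or.inr (Or.inl ⟨t, ⟨h1, h2⟩, rfl⟩))
    · exact Or.inr ⟨t, ⟨h2, ht.2⟩, rfl⟩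
  · exact Or.inl (Or.inr (Or.inr h))

theorem exists_local_move {x y : ℂ} {r : ℝ} (hxy : dist y x < r) :
    ∃ h : ℂ ≃ₜ ℂ, h x = y ∧ ∀ z, r ≤ dist z x → h z = z := by
  have hr : 0 < r := dist_nonneg.trans_lt hxy
  set c : NNReal := ⟨dist y x / r, by positivity⟩ with hc
  have hc1 : c < 1 := by
    rw [← NNReal.coe_lt_coe]
    exact (div_lt_one hr).2 hxy
  have happ : ApproximatesLinearOn (fun z : ℂ => z + (max 0 (1 - dist z x / r) : ℝ) • (y - x))
      ((ContinuousLinearEquiv.refl ℝ ℂ : ℂ ≃L[ℝ] ℂ) : ℂ →L[ℝ] ℂ) univ c := by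
    intro z _ w _
    have h1 : z + (max 0 (1 - dist z x / r) : ℝ) • (y - x) -
        (w + (max 0 (1 - dist w x / r) : ℝ) • (y - x)) -
        ((ContinuousLinearEquiv.refl ℝ ℂ : ℂ ≃L[ℝ] ℂ) : ℂ →L[ℝ] ℂ) (z - w) =
        (max 0 (1 - dist z x / r) - max 0 (1 - dist w x / r) : ℝ) • (y - x) := by
      simp only [ContinuousLinearEquiv.coe_coe, ContinuousLinearEquiv.refl_apply, sub_smul]
      ring
    rw [h1, norm_smul, Real.norm_eq_abs]
    have h2 : |max 0 (1 - dist z x / r) - max 0 (1 - dist w x / r)| ≤ dist z w / r := by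
      refine (abs_max_sub_max_le_max _ _ _ _).trans (max_le (by simp; positivity) ?_)
      rw [show 1 - dist z x / r - (1 - dist w x / r) = (dist w x - dist z x) / r by ring,
        abs_div, abs_of_pos hr, dist_comm z w]
      gcongr
      exact abs_dist_sub_le _ _ _
    rw [← dist_eq_norm y x, ← dist_eq_norm z w]
    calc _ ≤ dist z w / r * dist y x := by gcongr
      _ = c * dist z w := by
        rw [show (c : ℝ) = dist y x / r from rfl]; ring
  refine ⟨happ.toHomeomorph _ (Or.inr ?_), ?_, fun z hz => ?_⟩
  · have : ‖((ContinuousLinearEquiv.refl ℝ ℂ).symm : ℂ →L[ℝ] ℂ)‖₊ ≤ 1 :=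
      ContinuousLinearMap.norm_id_le
    refine hc1.trans_le ?_
    refine (one_le_inv₀ ?_).2 this
    have h : ((ContinuousLinearEquiv.refl ℝ ℂ).symm : ℂ →L[ℝ] ℂ) = ContinuousLinearMap.id ℝ ℂ := rfl
    rw [h]
    simp
  · change x + (max 0 (1 - dist x x / r) : ℝ) • (y - x) = y
    simp
  · change z + (max 0 (1 - dist z x / r) : ℝ) • (y - x) = z
    rw [max_eq_left, zero_smul, add_zero]
    rw [sub_nonpos, one_le_div hr]
    exact hz

theorem exists_push {U : Set ℂ} (hU : IsClosed U) {p q : ℂ} (hpq : JoinedIn Uᶜ p q) :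
    ∃ h : ℂ ≃ₜ ℂ, h p = q ∧ (∀ z ∈ U, h z = z) ∧ ∃ R : ℝ, ∀ z, R ≤ ‖z‖ → h z = z := by
  set S : Set ℂ := {w | ∃ h : ℂ ≃ₜ ℂ, h p = w ∧ (∀ z ∈ U, h z = z) ∧ ∃ R : ℝ, ∀ z, R ≤ ‖z‖ → h z = z}
    with hS
  have hpU : p ∉ U := hpq.source_mem
  have hSU : ∀ w ∈ S, w ∉ U := by
    rintro w ⟨h, hp, hU', -⟩ hw
    exact hpU (by rwa [h.injective (hp.trans (hU' w hw).symm)])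
  have hstep : ∀ w ∈ S, ∀ r, Metric.ball w r ⊆ Uᶜ → Metric.ball w r ⊆ S := by
    rintro w ⟨h, hp, hU', R, hR⟩ r hr y hy
    obtain ⟨k, hk, hk'⟩ := exists_local_move (x := w) (y := y) hy
    refine ⟨h.trans k, by simp [hp, hk], fun z hz => ?_, max R (‖w‖ + r), fun z hz => ?_⟩
    · simp only [Homeomorph.trans_apply, hU' z hz]
      refine hk' z ?_
      by_contra! hlt
      exact hr hlt hz
    · simp only [Homeomorph.trans_apply, hR z ((le_max_left _ _).trans hz)]
      refine hk' z ?_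
      have h1 := (le_max_right _ _).trans hz
      have h2 := norm_sub_norm_le z w
      rw [dist_eq_norm]
      linarith
  have hC : IsPreconnected (pathComponentIn Uᶜ p) :=
    (isPathConnected_pathComponentIn hpU).isConnected.isPreconnected
  refine hC.subset_of_closure_inter_subset (u := S) ?_ ⟨p, mem_pathComponentIn_self hpU,
    Homeomorph.refl ℂ, rfl, fun _ _ => rfl, 0, fun _ _ => rfl⟩ ?_ hpq
  · rw [Metric.isOpen_iff]
    intro w hw
    obtain ⟨r, hr, hr'⟩ := Metric.isOpen_iff.1 hU.isOpen_compl w (hSU w hw)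
    exact ⟨r, hr, hstep w hw r hr'⟩
  · rintro w ⟨hw, hwC⟩
    have hwU : w ∈ Uᶜ := hwC.target_mem
    obtain ⟨r, hr, hr'⟩ := Metric.isOpen_iff.1 hU.isOpen_compl w hwU
    obtain ⟨v, hv, hv'⟩ := Metric.mem_closure_iff.1 hw (r / 2) (by linarith)
    refine hstep v hv (r / 2) (fun y hy => hr' ?_) hv'
    rw [Metric.mem_ball] at hy ⊢
    have := dist_triangle y v w
    rw [dist_comm v w] at this
    linarith

/-- `c₁` and `c₂` are homotopic with fixed endpoints, through curves whose points other than the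
starting one are not in `O`. -/
def StartHom (O : Set ℂ) (c₁ c₂ : ℝ → ℂ) : Prop :=
  ∃ H : ℝ × ℝ → ℂ, ContinuousOn H (Icc 0 1 ×ˢ Icc 0 1) ∧
    (∀ s ∈ Icc (0 : ℝ) 1, H (0, s) = c₁ s) ∧ (∀ s ∈ Icc (0 : ℝ) 1, H (1, s) = c₂ s) ∧
    (∀ t ∈ Icc (0 : ℝ) 1, H (t, 0) = c₁ 0) ∧ (∀ t ∈ Icc (0 : ℝ) 1, H (t, 1) = c₁ 1) ∧
    ∀ t ∈ Icc (0 : ℝ) 1, ∀ s ∈ Ioc (0 : ℝ) 1, H (t, s) ∉ O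

theorem StartHom.mono {O O' : Set ℂ} {c₁ c₂ : ℝ → ℂ} (h : StartHom O c₁ c₂) (hO : O' ⊆ O) :
    StartHom O' c₁ c₂ := by
  obtain ⟨H, a, b, c, d, e, g⟩ := h
  exact ⟨H, a, b, c, d, e, fun t ht s hs h => g t ht s hs (hO h)⟩

theorem StartHom.map {O O' : Set ℂ} {c₁ c₂ : ℝ → ℂ} (h : StartHom O c₁ c₂) {φ : ℂ → ℂ}
    (hφ : Continuous φ) (hO : ∀ z, z ∉ O → φ z ∉ O') :
    StartHom O' (fun s => φ (c₁ s)) (fun s => φ (c₂ s)) := by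
  obtain ⟨H, a, b, c, d, e, g⟩ := h
  exact ⟨fun p => φ (H p), hφ.comp_continuousOn a, fun s hs => congrArg φ (b s hs),
    fun s hs => congrArg φ (c s hs), fun t ht => congrArg φ (d t ht),
    fun t ht => congrArg φ (e t ht), fun t ht s hs => hO _ (g t ht s hs)⟩

theorem StartHom.congr {O : Set ℂ} {c₁ c₂ c₁' c₂' : ℝ → ℂ} (h : StartHom O c₁ c₂)
    (h₁ : EqOn c₁' c₁ (Icc 0 1)) (h₂ : EqOn c₂' c₂ (Icc 0 1)) : StartHom O c₁' c₂' := by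
  obtain ⟨H, a, b, c, d, e, g⟩ := h
  refine ⟨H, a, fun s hs => ?_, fun s hs => ?_, fun t ht => ?_, fun t ht => ?_, g⟩
  · rw [b s hs, h₁ hs]
  · rw [c s hs, h₂ hs]
  · rw [d t ht, h₁ (by simp)]
  · rw [e t ht, h₁ (by simp)]

/-- The radial retraction onto a closed disc. -/
theorem exists_radial_retraction {R : ℝ} (hR : 0 < R) :
    ∃ ρ : ℂ → ℂ, Continuous ρ ∧ (∀ z, ‖z‖ ≤ R → ρ z = z) ∧ (∀ z, R ≤ ‖z‖ → ‖ρ z‖ = R) := by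
  have hne : ∀ z : ℂ, max R ‖z‖ ≠ 0 := fun z => (hR.trans_le (le_max_left _ _)).ne'
  refine ⟨fun z => (R / max R ‖z‖ : ℝ) * z, ?_, fun z hz => ?_, fun z hz => ?_⟩
  · exact (Complex.continuous_ofReal.comp (continuous_const.div (by fun_prop) hne)).mul
      continuous_id
  · beta_reduce
    rw [max_eq_left hz, div_self hR.ne']; simp
  · beta_reduce
    rw [max_eq_right hz, norm_mul, Complex.norm_real, Real.norm_eq_abs,
      abs_of_nonneg (by positivity), div_mul_cancel₀ _ (hR.trans_le hz).ne']

theorem StartHom.of_ball {O : Set ℂ} {c₁ c₂ : ℝ → ℂ} {R₀ R₁ : ℝ} (hR₀ : 0 < R₀) (hR : R₀ < R₁)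
    (hfin : (O ∩ Metric.ball 0 R₁).Finite) (h : StartHom (O ∩ Metric.ball 0 R₁) c₁ c₂)
    (h₁ : ∀ s ∈ Icc (0 : ℝ) 1, ‖c₁ s‖ ≤ R₀) (h₂ : ∀ s ∈ Icc (0 : ℝ) 1, ‖c₂ s‖ ≤ R₀) :
    StartHom O c₁ c₂ := by
  obtain ⟨R, hR1, hR2⟩ := (Ioo_infinite hR).exists_notMem_finite (hfin.image norm)
  obtain ⟨ρ, hρ, hρ1, hρ2⟩ := exists_radial_retraction (hR₀.trans hR1.1)
  refine (h.map hρ (O' := O) fun z hz hO => ?_).congr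
    (fun s hs => (hρ1 _ ((h₁ s hs).trans hR1.1.le)).symm)
    (fun s hs => (hρ1 _ ((h₂ s hs).trans hR1.1.le)).symm)
  rcases le_or_gt ‖z‖ R with hz' | hz'
  · rw [hρ1 z hz'] at hO
    exact hz ⟨hO, by simpa using hz'.trans_lt hR1.2⟩
  · refine hR2 ⟨ρ z, ⟨hO, ?_⟩, hρ2 z hz'.le⟩
    simpa [hρ2 z hz'.le] using hR1.2

theorem startHom_point {y₀ : ℂ} {c₁ c₂ : ℝ → ℂ} (hc₁ : ContinuousOn c₁ (Icc 0 1))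
    (hc₂ : ContinuousOn c₂ (Icc 0 1)) (h₁ : c₁ 0 = y₀) (h₂ : c₂ 0 = y₀) (h : c₁ 1 = c₂ 1)
    (hne₁ : ∀ s ∈ Ioc (0 : ℝ) 1, c₁ s ≠ y₀) (hne₂ : ∀ s ∈ Ioc (0 : ℝ) 1, c₂ s ≠ y₀) :
    StartHom {y₀} c₁ c₂ := by
  obtain ⟨g₁, hg₁, hg₁'⟩ := exists_log_of_convex (convex_Ioc (0 : ℝ) 1) (F := fun s => c₁ s - y₀)
    ((hc₁.mono Ioc_subset_Icc_self).sub continuousOn_const) (fun s hs => sub_ne_zero.2 (hne₁ s hs))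
  obtain ⟨g₃, hg₃, hg₃'⟩ := exists_log_of_convex (convex_Ioc (0 : ℝ) 1) (F := fun s => c₂ s - y₀)
    ((hc₂.mono Ioc_subset_Icc_self).sub continuousOn_const) (fun s hs => sub_ne_zero.2 (hne₂ s hs))
  have m1 : (1 : ℝ) ∈ Ioc (0 : ℝ) 1 := by simp
  obtain ⟨g₂, hg₂, hg₂', hg₂1⟩ : ∃ g₂ : ℝ → ℂ, ContinuousOn g₂ (Ioc 0 1) ∧
      (∀ s ∈ Ioc (0 : ℝ) 1, Complex.exp (g₂ s) = c₂ s - y₀) ∧ g₂ 1 = g₁ 1 := by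
    refine ⟨fun s => g₃ s + (g₁ 1 - g₃ 1), hg₃.add_const _, fun s hs => ?_, by simp⟩
    rw [Complex.exp_add, Complex.exp_sub, hg₃' s hs, hg₁' 1 m1, hg₃' 1 m1, h, div_self, mul_one]
    exact sub_ne_zero.2 (hne₂ 1 m1)
  have hpos : ∀ s ∈ Icc (0 : ℝ) 1, ¬ s ≤ 0 → s ∈ Ioc (0 : ℝ) 1 := fun s hs h =>
    ⟨not_le.1 h, hs.2⟩
  have hz : ∀ s ∈ Icc (0 : ℝ) 1, s ≤ 0 → s = 0 := fun s hs h => le_antisymm h hs.1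
  let G : ℝ × ℝ → ℂ := fun p => y₀ + Complex.exp ((1 - p.1) * g₁ p.2 + p.1 * g₂ p.2)
  let H : ℝ × ℝ → ℂ := fun p => if p.2 ≤ 0 then y₀ else G p
  have hbd : ∀ t ∈ Icc (0 : ℝ) 1, ∀ s ∈ Icc (0 : ℝ) 1,
      dist (H (t, s)) y₀ ≤ max ‖c₁ s - y₀‖ ‖c₂ s - y₀‖ := by
    intro t ht s hs
    by_cases h0 : s ≤ 0
    · simp [H, h0]
    · have hs' := hpos s hs h0
      have e1 : ‖c₁ s - y₀‖ = Real.exp (g₁ s).re := by rw [← hg₁' s hs', Complex.norm_exp]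
      have e2 : ‖c₂ s - y₀‖ = Real.exp (g₂ s).re := by rw [← hg₂' s hs', Complex.norm_exp]
      have e3 : (((1 - t) * g₁ s + t * g₂ s : ℂ)).re = (1 - t) * (g₁ s).re + t * (g₂ s).re := by
        simp
      simp only [H, h0, if_false, G]
      rw [dist_eq_norm, add_sub_cancel_left, Complex.norm_exp, e1, e2, e3]
      rcases le_total (g₁ s).re (g₂ s).re with h | h
      · refine le_max_of_le_right (Real.exp_le_exp.2 ?_)
        nlinarith [ht.1, ht.2]
      · refine le_max_of_le_left (Real.exp_le_exp.2 ?_)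
        nlinarith [ht.1, ht.2]
  refine ⟨H, ?_, fun s hs => ?_, fun s hs => ?_, fun t ht => ?_, fun t ht => ?_,
    fun t ht s hs => ?_⟩
  · rintro ⟨t, s⟩ ⟨ht, hs⟩
    rcases le_or_gt s 0 with h0 | h0
    · obtain rfl := hz s hs h0
      have hH0 : H (t, 0) = y₀ := by simp [H]
      rw [ContinuousWithinAt, hH0, tendsto_iff_dist_tendsto_zero]
      have hlim : Tendsto (fun p : ℝ × ℝ => max ‖c₁ p.2 - y₀‖ ‖c₂ p.2 - y₀‖)
          (𝓝[Icc 0 1 ×ˢ Icc 0 1] (t, 0)) (𝓝 0) := by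
        have hcont : ContinuousOn (fun p : ℝ × ℝ => max ‖c₁ p.2 - y₀‖ ‖c₂ p.2 - y₀‖)
            (Icc 0 1 ×ˢ Icc 0 1) := by
          have a1 : ContinuousOn (fun p : ℝ × ℝ => c₁ p.2) (Icc 0 1 ×ˢ Icc 0 1) :=
            hc₁.comp continuousOn_snd fun p hp => hp.2
          have a2 : ContinuousOn (fun p : ℝ × ℝ => c₂ p.2) (Icc 0 1 ×ˢ Icc 0 1) :=
            hc₂.comp continuousOn_snd fun p hp => hp.2
          exact (a1.sub continuousOn_const).norm.sup (a2.sub continuousOn_const).norm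
        have := hcont (t, 0) ⟨ht, hs⟩
        simpa [ContinuousWithinAt, h₁, h₂] using this
      refine squeeze_zero' (Eventually.of_forall fun p => dist_nonneg) ?_ hlim
      filter_upwards [self_mem_nhdsWithin] with p hp
      exact hbd p.1 hp.1 p.2 hp.2
    · have hGc : ContinuousOn G (Icc 0 1 ×ˢ Ioc 0 1) := by
        have a1 : ContinuousOn (fun p : ℝ × ℝ => g₁ p.2) (Icc 0 1 ×ˢ Ioc 0 1) :=
          hg₁.comp continuousOn_snd fun p hp => hp.2
        have a2 : ContinuousOn (fun p : ℝ × ℝ => g₂ p.2) (Icc 0 1 ×ˢ Ioc 0 1) :=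
          hg₂.comp continuousOn_snd fun p hp => hp.2
        have a3 : Continuous fun p : ℝ × ℝ => (p.1 : ℂ) :=
          Complex.continuous_ofReal.comp continuous_fst
        exact continuousOn_const.add (((continuousOn_const.sub a3.continuousOn).mul a1).add
          (a3.continuousOn.mul a2)).cexp
      have hG := hGc (t, s) ⟨ht, h0, hs.2⟩
      have hnear : {p : ℝ × ℝ | 0 < p.2} ∈ 𝓝[Icc 0 1 ×ˢ Icc 0 1] (t, s) :=
        mem_nhdsWithin_of_mem_nhds ((isOpen_lt continuous_const continuous_snd).mem_nhds h0)
      refine (hG.mono_of_mem_nhdsWithin ?_).congr_of_eventuallyEq ?_ ?_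
      · filter_upwards [hnear, self_mem_nhdsWithin] with p hp hp'
        exact ⟨hp'.1, hp, hp'.2.2⟩
      · filter_upwards [hnear] with p hp
        exact if_neg (not_le.2 hp)
      · exact if_neg (not_le.2 h0)
  · by_cases h0 : s ≤ 0
    · rw [hz s hs h0, h₁]; simp [H]
    · simp only [H, h0, if_false, G]
      simp [hg₁' s (hpos s hs h0)]
  · by_cases h0 : s ≤ 0
    · rw [hz s hs h0, h₂]; simp [H]
    · simp only [H, h0, if_false, G]
      simp [hg₂' s (hpos s hs h0)]
  · simp [H, h₁]
  · simp only [H, G, hg₂1, not_le.2 one_pos, if_false]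
    rw [← add_mul, sub_add_cancel, one_mul, hg₁' 1 m1]; ring
  · simp only [H, not_le.2 hs.1, if_false, G, mem_singleton_iff]
    simp [Complex.exp_ne_zero]

theorem startHom_finite {U : Set ℂ} (hU : IsCompact U) {y₀ : ℂ} {c₁ c₂ : ℝ → ℂ}
    (hc₁ : ContinuousOn c₁ (Icc 0 1)) (hc₂ : ContinuousOn c₂ (Icc 0 1))
    (hU₁ : ∀ s ∈ Icc (0 : ℝ) 1, c₁ s ∈ U) (hU₂ : ∀ s ∈ Icc (0 : ℝ) 1, c₂ s ∈ U)
    (h₁ : c₁ 0 = y₀) (h₂ : c₂ 0 = y₀) (h : c₁ 1 = c₂ 1)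
    (hne₁ : ∀ s ∈ Ioc (0 : ℝ) 1, c₁ s ≠ y₀) (hne₂ : ∀ s ∈ Ioc (0 : ℝ) 1, c₂ s ≠ y₀)
    (n : ℕ) : ∀ P : Finset ℂ, P.card = n → (∀ o ∈ P, Escapes U o) →
      StartHom (insert y₀ (P : Set ℂ)) c₁ c₂ := by
  classical
  induction n with
  | zero =>
    intro P hP _
    rw [Finset.card_eq_zero] at hP
    subst hP
    simpa using startHom_point hc₁ hc₂ h₁ h₂ h hne₁ hne₂
  | succ n ih =>
    intro P hP hesc
    obtain ⟨p, P', hp, rfl, hP'⟩ := Finset.card_eq_succ.1 hP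
    obtain ⟨R₀, hR₀, hUR⟩ := hU.isBounded.exists_pos_norm_le
    obtain ⟨q, hq, hpq⟩ := hesc p (Finset.mem_insert_self _ _) R₀
    obtain ⟨k, hk, hkU, R, hR⟩ := exists_push hU.isClosed hpq
    have hy₀ : y₀ ∈ U := h₁ ▸ hU₁ 0 (by simp)
    have hstep := ih (P'.image k) (by rw [Finset.card_image_of_injective _ k.injective, hP']) (by
      intro o ho M
      obtain ⟨o', ho', rfl⟩ := Finset.mem_image.1 ho
      obtain ⟨w, hw, hw'⟩ := hesc o' (Finset.mem_insert_of_mem ho') (max M R)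
      refine ⟨w, (le_max_left _ _).trans_lt hw, ?_⟩
      obtain ⟨γ, hγ⟩ := hw'
      refine ⟨(γ.map k.continuous).cast rfl (hR w ((le_max_right _ _).trans hw.le)).symm,
        fun t hvU => ?_⟩
      have hv := hγ t
      change k (γ t) ∈ U at hvU
      exact hv (by rwa [k.injective (hkU _ hvU)] at hvU))
    have hball := (hstep.mono (O' := insert y₀ ((insert p P').image k : Finset ℂ) ∩
        Metric.ball 0 ‖q‖) ?_).of_ball hR₀ hq ((Finset.finite_toSet _).insert _ |>.inter_of_left _)
        (fun s hs => hUR _ (hU₁ s hs)) (fun s hs => hUR _ (hU₂ s hs))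
    · refine (hball.map k.symm.continuous (O' := insert y₀ ((insert p P' : Finset ℂ) : Set ℂ))
        fun z hz hz' => hz ?_).congr (fun s hs => ?_) (fun s hs => ?_)
      · rw [mem_insert_iff] at hz' ⊢
        refine hz'.imp (fun h => ?_) (fun h => ?_)
        · rw [← hkU y₀ hy₀, ← h, k.apply_symm_apply]
        · exact Finset.mem_coe.2 (Finset.mem_image.2 ⟨_, h, k.apply_symm_apply z⟩)
      · rw [Homeomorph.eq_symm_apply, hkU _ (hU₁ s hs)]
      · rw [Homeomorph.eq_symm_apply, hkU _ (hU₂ s hs)]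
    · rintro z ⟨hz, hzb⟩
      rw [mem_insert_iff] at hz ⊢
      refine hz.imp_right fun hz => ?_
      rw [Finset.image_insert, Finset.coe_insert, mem_insert_iff] at hz
      refine hz.resolve_left ?_
      rintro rfl
      rw [hk] at hzb
      simp at hzb

/-- Two curves with the same endpoints are homotopic rel a locally finite set whose points are not
separated from infinity by the two curves. -/
theorem startHom_of_escapes {U : Set ℂ} (hU : IsCompact U) {O : Set ℂ}
    (hO : ∀ R : ℝ, (O ∩ Metric.closedBall 0 R).Finite) {y₀ : ℂ} {c₁ c₂ : ℝ → ℂ}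
    (hc₁ : ContinuousOn c₁ (Icc 0 1)) (hc₂ : ContinuousOn c₂ (Icc 0 1))
    (hU₁ : ∀ s ∈ Icc (0 : ℝ) 1, c₁ s ∈ U) (hU₂ : ∀ s ∈ Icc (0 : ℝ) 1, c₂ s ∈ U)
    (h₁ : c₁ 0 = y₀) (h₂ : c₂ 0 = y₀) (h : c₁ 1 = c₂ 1)
    (hne₁ : ∀ s ∈ Ioc (0 : ℝ) 1, c₁ s ≠ y₀) (hne₂ : ∀ s ∈ Ioc (0 : ℝ) 1, c₂ s ≠ y₀)
    (hesc : ∀ o ∈ O, o ≠ y₀ → Escapes U o) : StartHom O c₁ c₂ := by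
  classical
  obtain ⟨R₀, hR₀, hUR⟩ := hU.isBounded.exists_pos_norm_le
  have hfin : (O ∩ Metric.ball 0 (R₀ + 1)).Finite :=
    (hO (R₀ + 1)).subset (inter_subset_inter_right _ Metric.ball_subset_closedBall)
  refine StartHom.of_ball hR₀ (lt_add_one R₀) hfin ?_ (fun s hs => hUR _ (hU₁ s hs))
    (fun s hs => hUR _ (hU₂ s hs))
  refine (startHom_finite hU hc₁ hc₂ hU₁ hU₂ h₁ h₂ h hne₁ hne₂ _ (hfin.toFinset.erase y₀) rfl
    fun o ho => ?_).mono fun o ho => ?_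
  · rw [Finset.mem_erase, Finite.mem_toFinset] at ho
    exact hesc o ho.2.1 ho.1
  · by_cases hoy : o = y₀
    · exact Or.inl hoy
    · exact Or.inr (Finset.mem_coe.2 (Finset.mem_erase.2 ⟨hoy, hfin.mem_toFinset.2 ho⟩))

theorem isClosed_of_finite_inter_closedBall {O : Set ℂ}
    (h : ∀ R : ℝ, (O ∩ Metric.closedBall 0 R).Finite) : IsClosed O := by
  refine isClosed_of_closure_subset fun z hz => ?_
  have : z ∈ closure (O ∩ Metric.closedBall 0 (‖z‖ + 1)) := by
    rw [mem_closure_iff_nhds] at hz ⊢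
    intro V hV
    obtain ⟨w, hw⟩ := hz _ (inter_mem hV (Metric.ball_mem_nhds z one_pos))
    refine ⟨w, hw.1.1, hw.2, ?_⟩
    have := norm_le_norm_add_norm_sub' w z
    have h3 := hw.1.2
    rw [Metric.mem_ball, dist_eq_norm] at h3
    simp only [mem_closedBall_zero_iff]
    linarith
  rw [(h _).isClosed.closure_eq] at this
  exact this.1

/-- A line `A` of period `T` and a line `B` of period `ε = ± 1` which agree on `[-a, b]`. -/
structure Overlap (f : ℂ ≃ₜ ℂ) (T ε a b : ℝ) (A B : ℝ → ℂ) (O : Set ℂ) : Prop where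
  idx : HasIdx f
  line : Line f T A
  contB : Continuous B
  injB : Function.Injective B
  equiB : Equivar f ε B
  sign : ε = 1 ∨ ε = -1
  a_pos : 0 < a
  b_pos : 0 < b
  ab_lt : a + b < 1
  ab_lt_period : a + b < T
  agree : ∀ s ∈ Icc (-a) b, A s = B s
  orbit : O = range fun k : ℤ => A (k * T)
  fin : ∀ R : ℝ, (O ∩ Metric.closedBall 0 R).Finite

namespace Overlap

variable {f : ℂ ≃ₜ ℂ} {T ε a b : ℝ} {A B : ℝ → ℂ} {O : Set ℂ}

theorem symm (h : Overlap f T ε a b A B O) :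
    Overlap f.symm T ε b a (fun s => A (-s)) (fun s => B (-s)) O where
  idx := h.idx.symm
  line := ⟨h.line.pos, h.line.cont.comp continuous_neg, h.line.inj.comp neg_injective, fun s => by
    rw [Homeomorph.symm_apply_eq, h.line.equi]; exact congrArg A (by ring)⟩
  contB := h.contB.comp continuous_neg
  injB := h.injB.comp neg_injective
  equiB s := by rw [Homeomorph.symm_apply_eq, h.equiB]; exact congrArg B (by ring)
  sign := h.sign
  a_pos := h.b_pos
  b_pos := h.a_pos
  ab_lt := by linarith [h.ab_lt]
  ab_lt_period := by linarith [h.ab_lt_period]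
  agree s hs := h.agree _ ⟨by linarith [hs.2], by linarith [hs.1]⟩
  orbit := by
    rw [h.orbit]
    ext z
    constructor <;> rintro ⟨k, rfl⟩ <;> exact ⟨-k, by simp⟩
  fin := h.fin

theorem exists_far (h : Overlap f T ε a b A B O) (N₀ R : ℝ) :
    ∃ N, N₀ ≤ N ∧ ∀ k : ℤ, N < |k * T| → R < ‖A (k * T)‖ := by
  have hfin : {k : ℤ | A (k * T) ∈ O ∩ Metric.closedBall 0 R}.Finite := by
    refine (h.fin R).preimage (f := fun k : ℤ => A (k * T)) (Function.Injective.injOn ?_)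
    intro k l hkl
    have := mul_right_cancel₀ h.line.pos.ne' (h.line.inj hkl)
    exact_mod_cast this
  obtain ⟨M, hM⟩ := (hfin.image fun k : ℤ => |k * T|).bddAbove
  refine ⟨max N₀ M, le_max_left _ _, fun k hk => ?_⟩
  by_contra! hle
  have : |k * T| ≤ M := hM ⟨k, ⟨h.orbit ▸ ⟨k, rfl⟩, by simpa using hle⟩, rfl⟩
  exact absurd (hk.trans_le this) (not_lt.2 (le_max_right _ _))

theorem mul_period_notMem (h : Overlap f T ε a b A B O) {k : ℤ} (hk : k ≠ 0) :
    (k * T : ℝ) ≤ -T ∨ T ≤ k * T := by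
  have hT := h.line.pos
  rcases lt_or_gt_of_ne hk with h1 | h1
  · left
    have : (k : ℝ) ≤ -1 := by exact_mod_cast (by omega : k ≤ -1)
    nlinarith
  · right
    have : (1 : ℝ) ≤ k := by exact_mod_cast h1
    nlinarith

theorem zero_agree (h : Overlap f T ε a b A B O) : A 0 = B 0 :=
  h.agree 0 ⟨by linarith [h.a_pos], h.b_pos.le⟩

theorem pos_notMem (h : Overlap f T ε a b A B O) {s u : ℝ} (hsu : A s = B u) (hu : b < u) :
    s ∉ Icc (-a) b := by
  intro hs
  rw [h.agree s hs] at hsu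
  linarith [hs.2, h.injB hsu]

/-- The homotopy between the initial pieces of the two lines, once the orbit is not separated
from infinity. -/
theorem startHom (h : Overlap f T ε a b A B O) {q u : ℝ} (hqu : A q = B u) (hu : b < u)
    {U : Set ℂ} (hU : IsCompact U) (hUA : ∀ s ∈ uIcc 0 q, A s ∈ U) (hUb : ∀ s ∈ Icc 0 b, A s ∈ U)
    (hUB : ∀ s ∈ Icc b u, B s ∈ U)
    (hesc : ∀ k : ℤ, k ≠ 0 → Escapes U (A (k * T))) :
    StartHom O (fun x => A (q * x)) (fun x => B (u * x)) := by
  have hb := h.b_pos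
  have ha := h.a_pos
  have hq : q ≠ 0 := by
    rintro rfl
    exact h.pos_notMem hqu hu ⟨by linarith, hb.le⟩
  have hmem : ∀ x ∈ Icc (0 : ℝ) 1, q * x ∈ uIcc 0 q := by
    intro x hx
    rcases le_total 0 q with h0 | h0
    · rw [uIcc_of_le h0]; constructor <;> nlinarith [hx.1, hx.2]
    · rw [uIcc_of_ge h0]; constructor <;> nlinarith [hx.1, hx.2]
  refine startHom_of_escapes (y₀ := A 0) hU h.fin (h.line.cont.comp (by fun_prop)).continuousOn
    (h.contB.comp (by fun_prop)).continuousOn (fun x hx => hUA _ (hmem x hx)) (fun x hx => ?_)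
    (by simp) (by simp [h.zero_agree]) (by simp [hqu]) (fun x hx hA => ?_) (fun x hx hB => ?_) ?_
  · rcases le_total (u * x) b with h1 | h1
    · have : 0 ≤ u * x := mul_nonneg (by linarith) hx.1
      rw [← h.agree _ ⟨by linarith, h1⟩]
      exact hUb _ ⟨this, h1⟩
    · exact hUB _ ⟨h1, by nlinarith [hx.2]⟩
  · exact mul_ne_zero hq hx.1.ne' (h.line.inj hA)
  · rw [h.zero_agree] at hB
    exact mul_ne_zero (by linarith) hx.1.ne' (h.injB hB)
  · intro o ho ho'
    rw [h.orbit] at ho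
    obtain ⟨k, rfl⟩ := ho
    refine hesc k ?_
    rintro rfl
    simp at ho'

theorem exists_extension_of_accumulation (h : Overlap f T ε a b A B O) {N : ℝ} (hN : T ≤ N)
    (hacc : ∀ η > 0, ∃ u ∈ Ioo b (b + η), ∃ s ∈ Icc (-N) N, A s = B u) :
    ∃ u ∈ Ioo b (1 - a), ∃ q ∈ Ioo b (T - a), A q = B u ∧
      (∀ s ∈ Ioo q (T - a) ∪ Ioo (b - T) (-a), ∀ v ∈ Icc b u, A s ≠ B v) ∧
      StartHom O (fun x => A (q * x)) (fun x => B (u * x)) := by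
  have hT := h.line.pos
  have ha := h.a_pos
  have hb := h.b_pos
  have hAc := h.line.cont
  have hab := h.agree b ⟨by linarith, le_rfl⟩
  have h1 := h.ab_lt
  have h2 := h.ab_lt_period
  have hOc : IsClosed O := isClosed_of_finite_inter_closedBall h.fin
  have hbO : A b ∉ O := by
    rw [h.orbit]
    rintro ⟨k, hk⟩
    have := h.line.inj hk
    rcases eq_or_ne k 0 with rfl | hk0
    · simp at this; linarith
    · rcases h.mul_period_notMem hk0 with h | h <;> linarith
  obtain ⟨r₂, hr₂, hball⟩ := Metric.isOpen_iff.1 hOc.isOpen_compl _ hbO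
  obtain ⟨η₁, hη₁, hη₁'⟩ := Metric.continuousAt_iff.1 (hAc.continuousAt (x := b)) r₂ hr₂
  obtain ⟨η₀, hη₀, hη₀1, hη₀2, hη₀3⟩ : ∃ η₀ > 0, η₀ < η₁ ∧ η₀ < T - a - b ∧ η₀ < b := by
    have h3 : 0 < min η₁ (min (T - a - b) b) := lt_min hη₁ (lt_min (by linarith) hb)
    obtain ⟨η, h4, h5⟩ := exists_between h3
    simp only [lt_min_iff] at h5
    exact ⟨η, h4, h5⟩
  obtain ⟨r, hr, hr'⟩ : ∃ r > 0, ∀ s ∈ Icc (-N) N, dist (A s) (A b) < r → s < b + η₀ ∧ b - η₀ < s := by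
    have hK : IsCompact (Icc (-N) N \ Ioo (b - η₀) (b + η₀)) := isCompact_Icc.diff isOpen_Ioo
    have hKA : A b ∉ A '' (Icc (-N) N \ Ioo (b - η₀) (b + η₀)) := by
      rintro ⟨s, hs, hsb⟩
      rw [h.line.inj hsb] at hs
      exact hs.2 ⟨by linarith, by linarith⟩
    obtain ⟨r, hr, hr'⟩ := Metric.isOpen_iff.1 (hK.image hAc).isClosed.isOpen_compl _ hKA
    refine ⟨r, hr, fun s hs hd => ?_⟩
    by_contra hcon
    exact hr' hd ⟨s, ⟨hs, fun h => hcon ⟨h.2, h.1⟩⟩, rfl⟩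
  obtain ⟨η₂, hη₂, hη₂'⟩ := Metric.continuousAt_iff.1 (h.contB.continuousAt (x := b)) (min r r₂)
    (lt_min hr hr₂)
  obtain ⟨u₁, hu₁, s₁, hs₁, hsu₁⟩ := hacc (min η₂ (1 - a - b)) (lt_min hη₂ (by linarith))
  have hB1 : ∀ v ∈ Icc b u₁, dist (B v) (A b) < r ∧ dist (B v) (A b) < r₂ := by
    intro v hv
    rw [hab, ← lt_min_iff]
    refine hη₂' ?_
    rw [Real.dist_eq, abs_of_nonneg (by linarith [hv.1])]
    linarith [hv.2, hu₁.2, min_le_left η₂ (1 - a - b)]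
  have hu₁a : u₁ < 1 - a := by linarith [hu₁.2, min_le_right η₂ (1 - a - b)]
  have hposn : ∀ s ∈ Icc (-N) N, ∀ v ∈ Icc b u₁, A s = B v → b ≤ s ∧ s < b + η₀ := by
    intro s hs v hv hsv
    have h3 := hr' s hs (hsv ▸ (hB1 v hv).1)
    refine ⟨?_, h3.1⟩
    rcases eq_or_lt_of_le hv.1 with h4 | h4
    · rw [← h4, ← hab] at hsv
      exact (h.line.inj hsv).ge
    · by_contra! h5
      refine h.pos_notMem hsv h4 ⟨?_, h5.le⟩
      linarith [h3.2]
  have hKc : IsCompact (Icc b (b + η₀) ∩ A ⁻¹' (B '' Icc b u₁)) :=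
    isCompact_Icc.inter_right ((isCompact_Icc.image h.contB).isClosed.preimage hAc)
  have hs₁b := hposn s₁ hs₁ u₁ ⟨hu₁.1.le, le_rfl⟩ hsu₁
  obtain ⟨q, ⟨hq1, u, hu, hBu⟩, hqmax⟩ := hKc.exists_isMaxOn
    ⟨s₁, ⟨hs₁b.1, hs₁b.2.le⟩, u₁, ⟨hu₁.1.le, le_rfl⟩, hsu₁.symm⟩ continuousOn_id
  have hqmax' : ∀ s ∈ Icc b (b + η₀), ∀ v ∈ Icc b u₁, A s = B v → s ≤ q := fun s hs v hv h =>
    isMaxOn_iff.1 hqmax s ⟨hs, v, hv, h.symm⟩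
  have hbq : b < q := by
    refine lt_of_lt_of_le (lt_of_le_of_ne hs₁b.1 ?_)
      (hqmax' s₁ ⟨hs₁b.1, hs₁b.2.le⟩ u₁ ⟨hu₁.1.le, le_rfl⟩ hsu₁)
    rintro rfl
    rw [hab] at hsu₁
    exact absurd (h.injB hsu₁) hu₁.1.ne
  have hbu : b < u := by
    refine lt_of_le_of_ne hu.1 ?_
    rintro rfl
    rw [← hab] at hBu
    exact absurd (h.line.inj hBu) hbq.ne
  refine ⟨u, ⟨hbu, hu.2.trans_lt hu₁a⟩, q, ⟨hbq, by linarith [hq1.2]⟩, hBu.symm, ?_, ?_⟩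
  · rintro s hs v hv hsv
    have hsN : s ∈ Icc (-N) N := by
      rcases hs with hs | hs <;> constructor <;> linarith [hs.1, hs.2]
    have h3 := hposn s hsN v ⟨hv.1, hv.2.trans hu.2⟩ hsv
    rcases hs with hs | hs
    · linarith [hqmax' s ⟨h3.1, h3.2.le⟩ v ⟨hv.1, hv.2.trans hu.2⟩ hsv, hs.1]
    · linarith [hs.2, h3.1]
  have cA : ∀ s t, IsCompact (A '' Icc s t) := fun _ _ => isCompact_Icc.image hAc
  have cB : ∀ s t, IsCompact (B '' Icc s t) := fun _ _ => isCompact_Icc.image h.contB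
  have hUc := (cA 0 b).union ((cA b q).union (cB b u))
  refine h.startHom hBu.symm hbu hUc (fun s hs => ?_) (fun s hs => Or.inl ⟨s, hs, rfl⟩)
    (fun s hs => Or.inr (Or.inr ⟨s, hs, rfl⟩)) fun k hk => ?_
  · rw [uIcc_of_le (by linarith)] at hs
    rcases le_total s b with h3 | h3
    · exact Or.inl ⟨s, ⟨hs.1, h3⟩, rfl⟩
    · exact Or.inr (Or.inl ⟨s, ⟨h3, hs.2⟩, rfl⟩)
  have hko : A (k * T) ∉ Metric.ball (A b) r₂ := fun h3 => hball h3 (h.orbit ▸ ⟨k, rfl⟩)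
  have hin : A '' Icc b q ∪ B '' Icc b u ⊆ Metric.ball (A b) r₂ := by
    rintro _ (⟨s, hs, rfl⟩ | ⟨s, hs, rfl⟩)
    · refine hη₁' ?_
      rw [Real.dist_eq, abs_of_nonneg (by linarith [hs.1])]
      linarith [hs.2, hq1.2]
    · exact (hB1 s ⟨hs.1, hs.2.trans hu.2⟩).2
  obtain ⟨g, hg, hg'⟩ := exists_log_of_convex (convex_ball (A b) r₂)
    (F := fun ζ => ζ - A (k * T)) (by fun_prop)
    (fun ζ hζ => sub_ne_zero.2 fun h3 => hko (h3 ▸ hζ))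
  have hl₂ : HasLog (A '' Icc b q ∪ B '' Icc b u) (A (k * T)) :=
    HasLog.mono ⟨g, hg, hg'⟩ hin
  have hl₁ : HasLog (A '' Icc 0 b) (A (k * T)) := hasLog_arc hAc.continuousOn h.line.inj.injOn
    fun t ht h3 => by
      have := h.line.inj h3
      rcases h.mul_period_notMem hk with h | h <;> linarith [ht.1, ht.2]
  refine (HasLog.union (cA 0 b).isClosed ((cA b q).union (cB b u)).isClosed (w := A b) hl₁ hl₂
    ?_).escapes hUc.isClosed
  rintro _ ⟨s, hs, rfl⟩ (⟨t, ht, h3⟩ | ⟨t, ht, h3⟩)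
  · have := h.line.inj h3
    rw [le_antisymm hs.2 (this ▸ ht.1)]
  · rw [h.agree s ⟨by linarith [hs.1], hs.2⟩] at h3
    have := h.injB h3
    rw [le_antisymm hs.2 (this ▸ ht.1)]

end Overlap

namespace Overlap

variable {f : ℂ ≃ₜ ℂ} {T ε a b : ℝ} {A B : ℝ → ℂ} {O : Set ℂ}

theorem segment_disjoint (h : Overlap f T ε a b A B O) {v w : ℝ} (hvw : |v - w| < 1) :
    B v ≠ f (B w) := by
  intro hB
  rw [h.equiB] at hB
  have := h.injB hB
  rw [this] at hvw
  rcases h.sign with rfl | rfl <;> norm_num at hvw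

theorem position_of_first_hit (h : Overlap f T ε a b A B O) {N q u : ℝ} (hbu : b < u)
    (hua : u ≤ 1 - a) (hqN : q ∈ Icc (-N) N) (hqu : A q = B u) (hN : 4 * T ≤ N)
    (hno : ∀ v ∈ Ioo b u, ∀ s ∈ Icc (-N) N, A s ≠ B v) :
    q ∈ Ioo b (b + T) ∨ q ∈ Ioo (b - T) (-a) := by
  have hT := h.line.pos
  have ha := h.a_pos
  have hb := h.b_pos
  have h1 := h.ab_lt
  have h2 := h.ab_lt_period
  have hab := h.agree b ⟨by linarith, le_rfl⟩
  have hq := h.pos_notMem hqu hbu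
  have havoid : ∀ s ∈ Icc (-N) N, s ≠ b → s ≠ q → ∀ v ∈ Icc b u, A s ≠ B v := by
    intro s hs hsb hsq v hv hsv
    rcases eq_or_lt_of_le hv.1 with rfl | h3
    · exact hsb (h.line.inj (hsv.trans hab.symm))
    rcases eq_or_lt_of_le hv.2 with rfl | h4
    · exact hsq (h.line.inj (hsv.trans hqu.symm))
    exact hno v ⟨h3, h4⟩ s hs hsv
  have hmem : ∀ x ∈ Icc (0 : ℝ) 1, b + x * (u - b) ∈ Icc b u := fun x hx => by
    constructor <;> nlinarith [hx.1, hx.2]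
  have hmem' : ∀ x ∈ Icc (0 : ℝ) 1, u + x * (b - u) ∈ Icc b u := fun x hx => by
    constructor <;> nlinarith [hx.1, hx.2]
  have hdisj : ∀ v ∈ Icc b u, ∀ w ∈ Icc b u, B v ≠ f (B w) := fun v hv w hw =>
    h.segment_disjoint (abs_lt.2 ⟨by linarith [hv.1, hw.2], by linarith [hv.2, hw.1]⟩)
  rcases lt_or_ge b q with h3 | h3
  · left
    refine ⟨h3, lt_of_le_of_ne ?_ ?_⟩
    · by_contra! hlt
      refine h.idx.no_crossing h.line hlt (e := fun x => B (b + x * (u - b)))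
        (h.contB.comp (by fun_prop)) (by simp [hab]) (by simp [hqu])
        (fun x hx y hy => hdisj _ (hmem x hx) _ (hmem y hy)) (fun t ht x hx => ?_)
      have h5 : min (b + T) (q - T) ≤ t := ht.1
      have h6 : t ≤ max (b + T) (q - T) := ht.2
      have h7 : b < t := (lt_min (by linarith) (by linarith)).trans_le h5
      have h8 : t < q := h6.trans_lt (max_lt hlt (by linarith))
      exact havoid t ⟨by linarith, by linarith [hqN.2]⟩ h7.ne' h8.ne _ (hmem x hx)
    · intro hqb
      rw [hqb, ← h.line.equi, hab] at hqu
      exact h.segment_disjoint (abs_lt.2 ⟨by linarith, by linarith⟩) hqu.symm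
  · right
    have h4 : q < -a := by
      by_contra! h4
      exact hq ⟨h4, h3⟩
    refine ⟨lt_of_le_of_ne ?_ ?_, h4⟩
    · by_contra! hlt
      refine h.idx.no_crossing h.line (p := q) (q := b) (by linarith)
        (e := fun x => B (u + x * (b - u)))
        (h.contB.comp (by fun_prop)) (by simp [hqu]) (by simp [hab])
        (fun x hx y hy => hdisj _ (hmem' x hx) _ (hmem' y hy)) (fun t ht x hx => ?_)
      have h5 : min (q + T) (b - T) ≤ t := ht.1
      have h6 : t ≤ max (q + T) (b - T) := ht.2
      have h7 : q < t := (lt_min (by linarith) (by linarith)).trans_le h5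
      have h8 : t < b := h6.trans_lt (max_lt (by linarith) (by linarith))
      exact havoid t ⟨by linarith [hqN.1], by linarith⟩ h8.ne h7.ne' _ (hmem' x hx)
    · intro hqb
      have hqT : A b = f (A q) := by rw [h.line.equi, ← hqb, sub_add_cancel]
      rw [hab, hqu] at hqT
      exact h.segment_disjoint (abs_lt.2 ⟨by linarith, by linarith⟩) hqT

theorem startHom_of_first_hit (h : Overlap f T ε a b A B O) {N R q u : ℝ} (hbu : b < u)
    (hua : u ≤ 1 - a) (hqN : q ∈ Ioo b T ∨ q ∈ Ioo (b - T) (-a)) (hqu : A q = B u)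
    (hN : 4 * T ≤ N) (hno : ∀ v ∈ Ioo b u, ∀ s ∈ Icc (-N) N, A s ≠ B v)
    (hfar : ∀ k : ℤ, N < |k * T| → R < ‖A (k * T)‖)
    (hR : ∀ ζ ∈ A '' Icc (-T) T ∪ B '' Icc 0 1, ‖ζ‖ ≤ R) :
    StartHom O (fun x => A (q * x)) (fun x => B (u * x)) := by
  have hT := h.line.pos
  have ha := h.a_pos
  have hb := h.b_pos
  have h1 := h.ab_lt
  have h2 := h.ab_lt_period
  have hab := h.agree b ⟨by linarith, le_rfl⟩
  have hmem : ∀ x ∈ Icc (0 : ℝ) 1, b + x * (u - b) ∈ Icc b u := fun x hx => by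
    constructor <;> nlinarith [hx.1, hx.2]
  have hmem' : ∀ x ∈ Icc (0 : ℝ) 1, u + x * (b - u) ∈ Icc b u := fun x hx => by
    constructor <;> nlinarith [hx.1, hx.2]
  have hdisj : ∀ v ∈ Icc b u, ∀ w ∈ Icc b u, B v ≠ f (B w) := fun v hv w hw =>
    h.segment_disjoint (abs_lt.2 ⟨by linarith [hv.1, hw.2], by linarith [hv.2, hw.1]⟩)
  have hescfar : ∀ U : Set ℂ, IsCompact U → U ⊆ A '' Icc (-T) T ∪ B '' Icc 0 1 →
      ∀ k : ℤ, N < |k * T| → Escapes U (A (k * T)) := fun U hU hUR k hk =>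
    (hasLog_of_norm_lt fun ζ hζ => (hR ζ (hUR hζ)).trans_lt (hfar k hk)).escapes hU.isClosed
  rcases hqN with hq | hq
  · have hqb := hq.1
    have hqT := hq.2
    set e : ℝ → ℂ := fun x => B (b + x * (u - b)) with he
    have hec : Continuous e := h.contB.comp (by fun_prop)
    have hUc : IsCompact (A '' Icc 0 q ∪ e '' Icc 0 1) :=
      (isCompact_Icc.image h.line.cont).union (isCompact_Icc.image hec)
    refine h.startHom hqu hbu hUc (fun s hs => ?_) (fun s hs => Or.inl ⟨s, ⟨hs.1, by
      linarith [hs.2]⟩, rfl⟩) (fun s hs => Or.inr ⟨(s - b) / (u - b), ⟨?_, ?_⟩, ?_⟩) fun k hk => ?_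
    · rw [uIcc_of_le (by linarith)] at hs
      exact Or.inl ⟨s, hs, rfl⟩
    · exact div_nonneg (by linarith [hs.1]) (by linarith)
    · exact (div_le_one (by linarith)).2 (by linarith [hs.2])
    · have : u - b ≠ 0 := by linarith
      simp only [he]
      congr 1
      field_simp
      ring
    · rcases lt_or_ge N |k * T| with hkN | hkN
      · refine hescfar _ hUc ?_ k hkN
        rintro _ (⟨s, hs, rfl⟩ | ⟨s, hs, rfl⟩)
        · exact Or.inl ⟨s, ⟨by linarith [hs.1], by linarith [hs.2]⟩, rfl⟩
        · have := hmem s hs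
          exact Or.inr ⟨_, ⟨by linarith [this.1], by linarith [this.2]⟩, rfl⟩
      · refine h.idx.lune_escapes h.line hqb hec (fun x _ y _ hxy => ?_) (by simp [he, hab])
          (by simp [he, hqu]) (fun x hx y hy => hdisj _ (hmem x hx) _ (hmem y hy))
          (m := -N) (M := N) (by linarith) (by linarith) (fun t ht x hx => ?_) hb.le (by linarith)
          le_rfl (by linarith) (abs_le.1 hkN) ?_
        · have := h.injB hxy
          have h5 : u - b ≠ 0 := by linarith
          exact mul_right_cancel₀ h5 (by linarith)
        · exact (hno _ ⟨by nlinarith [hx.1], by nlinarith [hx.2]⟩ t ht).symm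
        · rintro ⟨h3, h4⟩
          rcases h.mul_period_notMem hk with h | h <;> linarith
  · have hqb := hq.1
    have hqa := hq.2
    set e : ℝ → ℂ := fun x => B (u + x * (b - u)) with he
    have hec : Continuous e := h.contB.comp (by fun_prop)
    have hUc : IsCompact (A '' Icc q b ∪ e '' Icc 0 1) :=
      (isCompact_Icc.image h.line.cont).union (isCompact_Icc.image hec)
    refine h.startHom hqu hbu hUc (fun s hs => ?_) (fun s hs => Or.inl ⟨s, ⟨by
      linarith [hs.1], hs.2⟩, rfl⟩) (fun s hs => Or.inr ⟨(s - u) / (b - u), ⟨?_, ?_⟩, ?_⟩)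
      fun k hk => ?_
    · rw [uIcc_of_ge (by linarith)] at hs
      exact Or.inl ⟨s, ⟨hs.1, by linarith [hs.2]⟩, rfl⟩
    · exact div_nonneg_of_nonpos (by linarith [hs.2]) (by linarith)
    · exact (div_le_one_of_neg (by linarith)).2 (by linarith [hs.1])
    · have : b - u ≠ 0 := by linarith
      simp only [he]
      congr 1
      field_simp
      ring
    · rcases lt_or_ge N |k * T| with hkN | hkN
      · refine hescfar _ hUc ?_ k hkN
        rintro _ (⟨s, hs, rfl⟩ | ⟨s, hs, rfl⟩)
        · exact Or.inl ⟨s, ⟨by linarith [hs.1], by linarith [hs.2]⟩, rfl⟩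
        · have := hmem' s hs
          exact Or.inr ⟨_, ⟨by linarith [this.1], by linarith [this.2]⟩, rfl⟩
      · refine h.idx.lune_escapes h.line (p := q) (q := b) (by linarith) hec
          (fun x _ y _ hxy => ?_) (by simp [he, hqu])
          (by simp [he, hab]) (fun x hx y hy => hdisj _ (hmem' x hx) _ (hmem' y hy))
          (m := -N) (M := N) (by linarith) (by linarith) (fun t ht x hx => ?_) le_rfl (by linarith)
          le_rfl (by linarith) (abs_le.1 hkN) ?_
        · have := h.injB hxy
          have h5 : b - u ≠ 0 := by linarith
          exact mul_right_cancel₀ h5 (by linarith)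
        · exact (hno _ ⟨by nlinarith [hx.2], by nlinarith [hx.1]⟩ t ht).symm
        · rintro ⟨h3, h4⟩
          rcases h.mul_period_notMem hk with h | h <;> linarith

theorem exists_forward (h : Overlap f T ε a b A B O) :
    ∃ u ∈ Ioc b (1 - a), ∃ q, A q = B u ∧ StartHom O (fun x => A (q * x)) (fun x => B (u * x)) ∧
      ((u < 1 - a ∧ q ∈ Ioo b (T - a) ∧
          ∀ s ∈ Ioo q (T - a) ∪ Ioo (b - T) (-a), ∀ v ∈ Icc b u, A s ≠ B v) ∨
        (ε = 1 ∧ q = T - a ∧ u = 1 - a) ∨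
        (u < 1 - a ∧ q ∈ Ioo (b - T) (-a) ∧
          ∀ s ∈ Icc (-(4 * T)) (4 * T), ∀ v ∈ Ioo b u, A s ≠ B v)) := by
  have hT := h.line.pos
  have ha := h.a_pos
  have hb := h.b_pos
  have h1 := h.ab_lt
  have h2 := h.ab_lt_period
  have hab := h.agree b ⟨by linarith, le_rfl⟩
  obtain ⟨R, hR⟩ := ((isCompact_Icc.image h.line.cont).union
    (isCompact_Icc.image h.contB) : IsCompact (A '' Icc (-T) T ∪ B '' Icc 0 1)).isBounded.exists_norm_le
  obtain ⟨N, hN, hfar⟩ := h.exists_far (4 * T) R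
  by_cases hacc : ∀ η > 0, ∃ u ∈ Ioo b (b + η), ∃ s ∈ Icc (-N) N, A s = B u
  · obtain ⟨u, hu, q, hq, hqu, hav, hhom⟩ :=
      h.exists_extension_of_accumulation (by linarith) hacc
    exact ⟨u, ⟨hu.1, hu.2.le⟩, q, hqu, hhom, Or.inl ⟨hu.2, hq, hav⟩⟩
  push Not at hacc
  obtain ⟨η, hη, hη'⟩ := hacc
  have hend : A (ε * T - a) = B (1 - a) := by
    have hBa := h.agree (-a) ⟨le_rfl, by linarith⟩
    rcases h.sign with hε | hε
    · rw [hε, show 1 * T - a = -a + T by ring, ← h.line.equi, hBa, h.equiB, hε]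
      congr 1; ring
    · apply f.injective
      rw [h.line.equi, h.equiB, hε, show -1 * T - a + T = -a by ring, hBa]
      congr 1; ring
  have hKc : IsCompact (Icc (b + η) (1 - a) ∩ B ⁻¹' (A '' Icc (-N) N)) :=
    isCompact_Icc.inter_right ((isCompact_Icc.image h.line.cont).isClosed.preimage h.contB)
  have hendN : ε * T - a ∈ Icc (-N) N := by
    rcases h.sign with hε | hε <;> rw [hε] <;> constructor <;> linarith
  obtain ⟨u, ⟨hu1, q, hqN, hqu⟩, humin⟩ := hKc.exists_isMinOn
    ⟨1 - a, ⟨by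
      by_contra! hlt
      exact hη' (1 - a) ⟨by linarith, hlt⟩ _ hendN hend, le_rfl⟩, _, hendN, hend⟩ continuousOn_id
  have hno : ∀ v ∈ Ioo b u, ∀ s ∈ Icc (-N) N, A s ≠ B v := by
    intro v hv s hs hsv
    rcases lt_or_ge v (b + η) with h3 | h3
    · exact hη' v ⟨hv.1, h3⟩ s hs hsv
    · have := isMinOn_iff.1 humin v ⟨⟨h3, by linarith [hv.2, hu1.2]⟩, s, hs, hsv⟩
      simp only [id] at this
      linarith [hv.2]
  have hbu : b < u := by linarith [hu1.1]
  have hq := h.position_of_first_hit hbu hu1.2 hqN hqu hN hno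
  have hulast : u = 1 - a → q = ε * T - a := by
    rintro rfl
    exact h.line.inj (hqu.trans hend.symm)
  refine ⟨u, ⟨hbu, hu1.2⟩, q, hqu, ?_⟩
  rcases hq with hq | hq
  · have hqT : q ≤ T - a := by
      by_contra! hlt
      have h3 : f (A (q - T)) = A q := by rw [h.line.equi, sub_add_cancel]
      rw [h.agree _ ⟨by linarith, by linarith [hq.2]⟩, h.equiB, hqu] at h3
      have := h.injB h3
      rcases h.sign with hε | hε <;> rw [hε] at this <;> linarith [hu1.2, hq.2]
    refine ⟨h.startHom_of_first_hit hbu hu1.2 (Or.inl ⟨hq.1, by linarith⟩) hqu hN hno hfar hR, ?_⟩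
    rcases hqT.lt_or_eq with h3 | h3
    · left
      refine ⟨lt_of_le_of_ne hu1.2 fun h4 => ?_, ⟨hq.1, h3⟩, fun s hs v hv hsv => ?_⟩
      · have := hulast h4
        rcases h.sign with hε | hε <;> rw [hε] at this <;> linarith [hq.1]
      · have hsN : s ∈ Icc (-N) N := by
          rcases hs with hs | hs <;> constructor <;> linarith [hs.1, hs.2, hq.1]
        rcases eq_or_lt_of_le hv.1 with rfl | h4
        · have := h.line.inj (hsv.trans hab.symm)
          rcases hs with hs | hs <;> linarith [hs.1, hs.2, hq.1]
        rcases eq_or_lt_of_le hv.2 with rfl | h5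
        · have := h.line.inj (hsv.trans hqu.symm)
          rcases hs with hs | hs <;> linarith [hs.1, hs.2, hq.1]
        exact hno v ⟨h4, h5⟩ s hsN hsv
    · right; left
      have h4 : f (A (-a)) = A q := by rw [h.line.equi, h3]; congr 1; ring
      rw [h.agree _ ⟨le_rfl, by linarith⟩, h.equiB, hqu] at h4
      have := h.injB h4
      rcases h.sign with hε | hε <;> rw [hε] at this
      · exact ⟨hε, h3, by linarith⟩
      · linarith
  · refine ⟨h.startHom_of_first_hit hbu hu1.2 (Or.inr hq) hqu hN hno hfar hR, ?_⟩
    right; right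
    refine ⟨lt_of_le_of_ne hu1.2 fun h4 => ?_, hq, fun s hs v hv => ?_⟩
    · have := hulast h4
      rcases h.sign with hε | hε <;> rw [hε] at this <;> linarith [hq.1, hq.2]
    · exact hno v hv s ⟨by linarith [hs.1], by linarith [hs.2]⟩

end Overlap

theorem exists_continuous_extension_square {H : ℝ × ℝ → ℂ}
    (hH : ContinuousOn H (Icc 0 1 ×ˢ Icc 0 1)) :
    ∃ G : ℝ × ℝ → ℂ, Continuous G ∧ EqOn G H (Icc 0 1 ×ˢ Icc 0 1) := by
  refine ⟨fun p => H (max 0 (min 1 p.1), max 0 (min 1 p.2)), ?_, fun p hp => ?_⟩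
  · refine hH.comp_continuous (by fun_prop) fun p => ?_
    simp
  · beta_reduce
    rw [min_eq_right hp.1.2, min_eq_right hp.2.2, max_eq_right hp.1.1, max_eq_right hp.2.1]

/-- Homotopy with fixed end-points of paths defined on `[0, 1]`, whose interior avoids `O`. -/
def PathHom (O : Set ℂ) (P Q : ℝ → ℂ) : Prop :=
  ∃ H : ℝ × ℝ → ℂ, Continuous H ∧
    (∀ s ∈ Icc (0 : ℝ) 1, H (0, s) = P s) ∧ (∀ s ∈ Icc (0 : ℝ) 1, H (1, s) = Q s) ∧
    (∀ t ∈ Icc (0 : ℝ) 1, H (t, 0) = P 0) ∧ (∀ t ∈ Icc (0 : ℝ) 1, H (t, 1) = P 1) ∧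
    ∀ t ∈ Icc (0 : ℝ) 1, ∀ s ∈ Ioo (0 : ℝ) 1, H (t, s) ∉ O

namespace PathHom

variable {O : Set ℂ} {P Q R P' Q' : ℝ → ℂ}

theorem symm (h : PathHom O P Q) : PathHom O Q P := by
  obtain ⟨H, hc, h0, h1, h2, h3, h4⟩ := h
  refine ⟨fun p => H (1 - p.1, p.2), by fun_prop, fun s hs => ?_, fun s hs => ?_, fun t ht => ?_,
    fun t ht => ?_, fun t ht s hs => h4 _ ⟨by linarith [ht.2], by linarith [ht.1]⟩ s hs⟩
  · simpa using h1 s hs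
  · simpa using h0 s hs
  · have : (1 - t) ∈ Icc (0 : ℝ) 1 := ⟨by linarith [ht.2], by linarith [ht.1]⟩
    exact (h2 _ this).trans ((h2 1 (by simp)).symm.trans (h1 0 (by simp)))
  · have : (1 - t) ∈ Icc (0 : ℝ) 1 := ⟨by linarith [ht.2], by linarith [ht.1]⟩
    exact (h3 _ this).trans ((h3 1 (by simp)).symm.trans (h1 1 (by simp)))

theorem congr (h : PathHom O P Q) (hP : EqOn P' P (Icc 0 1)) (hQ : EqOn Q' Q (Icc 0 1)) :
    PathHom O P' Q' := by
  obtain ⟨H, hc, h0, h1, h2, h3, h4⟩ := h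
  refine ⟨H, hc, fun s hs => ?_, fun s hs => ?_, fun t ht => ?_, fun t ht => ?_, h4⟩
  · rw [h0 s hs, hP hs]
  · rw [h1 s hs, hQ hs]
  · rw [h2 t ht, hP (by simp)]
  · rw [h3 t ht, hP (by simp)]

theorem trans (h : PathHom O P Q) (h' : PathHom O Q R) : PathHom O P R := by
  obtain ⟨H, hc, h0, h1, h2, h3, h4⟩ := h
  obtain ⟨H', hc', h0', h1', h2', h3', h4'⟩ := h'
  have hQ0 : Q 0 = P 0 := (h1 0 (by simp)).symm.trans (h2 1 (by simp))
  have hQ1 : Q 1 = P 1 := (h1 1 (by simp)).symm.trans (h3 1 (by simp))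
  obtain ⟨G, hG, hG'⟩ := exists_continuous_extension_square
    (H := fun p => if p.1 ≤ 1 / 2 then H (2 * p.1, max 0 (min 1 p.2))
      else H' (2 * p.1 - 1, max 0 (min 1 p.2))) (by
    refine (Continuous.if_le (by fun_prop) (by fun_prop) (by fun_prop) (by fun_prop)
      fun p hp => ?_).continuousOn
    have hm : max 0 (min 1 p.2) ∈ Icc (0 : ℝ) 1 := by simp
    rw [hp]
    norm_num
    rw [h1 _ hm, h0' _ hm])
  have hclamp : ∀ s ∈ Icc (0 : ℝ) 1, max 0 (min 1 s) = s := fun s hs => by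
    rw [min_eq_right hs.2, max_eq_right hs.1]
  have hlow : ∀ t ∈ Icc (0 : ℝ) 1, ∀ s ∈ Icc (0 : ℝ) 1, t ≤ 1 / 2 → G (t, s) = H (2 * t, s) :=
    fun t ht s hs h => by
      rw [hG' ⟨ht, hs⟩]
      beta_reduce
      rw [if_pos h, hclamp s hs]
  have hhigh : ∀ t ∈ Icc (0 : ℝ) 1, ∀ s ∈ Icc (0 : ℝ) 1, 1 / 2 < t →
      G (t, s) = H' (2 * t - 1, s) := fun t ht s hs h => by
    rw [hG' ⟨ht, hs⟩]
    beta_reduce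
    rw [if_neg (not_le.2 h), hclamp s hs]
  refine ⟨G, hG, fun s hs => ?_, fun s hs => ?_, fun t ht => ?_, fun t ht => ?_,
    fun t ht s hs => ?_⟩
  · rw [hlow 0 (by simp) s hs (by norm_num), mul_zero, h0 s hs]
  · rw [hhigh 1 (by simp) s hs (by norm_num)]
    norm_num
    exact h1' s hs
  · rcases le_or_gt t (1 / 2) with h5 | h5
    · rw [hlow t ht 0 (by simp) h5, h2 _ ⟨by linarith [ht.1], by linarith⟩]
    · rw [hhigh t ht 0 (by simp) h5, h2' _ ⟨by linarith, by linarith [ht.2]⟩, hQ0]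
  · rcases le_or_gt t (1 / 2) with h5 | h5
    · rw [hlow t ht 1 (by simp) h5, h3 _ ⟨by linarith [ht.1], by linarith⟩]
    · rw [hhigh t ht 1 (by simp) h5, h3' _ ⟨by linarith, by linarith [ht.2]⟩, hQ1]
  · rcases le_or_gt t (1 / 2) with h5 | h5
    · rw [hlow t ht s ⟨hs.1.le, hs.2.le⟩ h5]
      exact h4 _ ⟨by linarith [ht.1], by linarith⟩ s hs
    · rw [hhigh t ht s ⟨hs.1.le, hs.2.le⟩ h5]
      exact h4' _ ⟨by linarith, by linarith [ht.2]⟩ s hs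

theorem of_segment (hP : Continuous P) (hQ : Continuous Q) (h0 : P 0 = Q 0) (h1 : P 1 = Q 1)
    (h : ∀ t ∈ Icc (0 : ℝ) 1, ∀ s ∈ Ioo (0 : ℝ) 1, (1 - t : ℂ) * P s + t * Q s ∉ O) :
    PathHom O P Q := by
  refine ⟨fun p => (1 - p.1 : ℂ) * P p.2 + p.1 * Q p.2, by fun_prop, fun s _ => by simp,
    fun s _ => by simp, fun t _ => ?_, fun t _ => ?_, h⟩
  · beta_reduce
    rw [← h0]; ring
  · beta_reduce
    rw [← h1]; ring

theorem homotopicRelSet {γ γ' : C(unitInterval, ℂ)} (h : PathHom O P Q) (hP : ∀ s : unitInterval, P s = γ s)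
    (hQ : ∀ s : unitInterval, Q s = γ' s) : HomotopicRelSet O γ γ' := by
  obtain ⟨H, hc, h0, h1, h2, h3, h4⟩ := h
  have e0 : P 0 = γ 0 := by simpa using hP 0
  have e1 : P 1 = γ 1 := by simpa using hP 1
  refine ⟨?_, ?_, ⟨fun p => H (p.1, p.2), by fun_prop⟩, fun s => ?_, fun s => ?_, fun t => ?_,
    fun t => ?_, fun t s hs hs' => ?_⟩
  · rw [← hP, ← hQ]
    simpa using (h2 1 (by simp)).symm.trans (h1 0 (by simp))
  · rw [← hP, ← hQ]
    simpa using (h3 1 (by simp)).symm.trans (h1 1 (by simp))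
  · rw [← hP, ← h0 s s.2]; rfl
  · rw [← hQ, ← h1 s s.2]; rfl
  · rw [← e0, ← h2 t t.2]; rfl
  · rw [← e1, ← h3 t t.2]; rfl
  · exact h4 t t.2 s ⟨lt_of_le_of_ne s.2.1 fun h => hs (Subtype.ext h.symm),
      lt_of_le_of_ne s.2.2 fun h => hs' (Subtype.ext h)⟩

end PathHom

/-- The path which follows `c`, then `m`, then the image under `f` of the reverse of `d`. -/
noncomputable def buildPath (f : ℂ → ℂ) (c m d : ℝ → ℂ) (s : ℝ) : ℂ :=
  if s ≤ 1 / 3 then c (3 * s) else if s ≤ 2 / 3 then m (3 * s - 1) else f (d (3 - 3 * s))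

theorem continuous_buildPath {X : Type*} [TopologicalSpace X] {f : ℂ → ℂ} (hf : Continuous f)
    {c m d : X → ℝ → ℂ} (hc : Continuous fun p : X × ℝ => c p.1 p.2)
    (hm : Continuous fun p : X × ℝ => m p.1 p.2) (hd : Continuous fun p : X × ℝ => d p.1 p.2)
    (h₁ : ∀ x, c x 1 = m x 0) (h₂ : ∀ x, m x 1 = f (d x 1)) :
    Continuous fun p : X × ℝ => buildPath f (c p.1) (m p.1) (d p.1) p.2 := by
  unfold buildPath
  have hc' : Continuous fun p : X × ℝ => c p.1 (3 * p.2) :=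
    hc.comp (f := fun p : X × ℝ => (p.1, 3 * p.2)) (by fun_prop)
  have hm' : Continuous fun p : X × ℝ => m p.1 (3 * p.2 - 1) :=
    hm.comp (f := fun p : X × ℝ => (p.1, 3 * p.2 - 1)) (by fun_prop)
  have hd' : Continuous fun p : X × ℝ => f (d p.1 (3 - 3 * p.2)) :=
    hf.comp (hd.comp (f := fun p : X × ℝ => (p.1, 3 - 3 * p.2)) (by fun_prop))
  refine Continuous.if_le hc' (Continuous.if_le hm' hd' (by fun_prop) (by fun_prop)
    fun p hp => ?_) (by fun_prop) (by fun_prop) fun p hp => ?_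
  · rw [hp]; norm_num; exact h₂ p.1
  · rw [hp]; norm_num; exact h₁ p.1

theorem buildPath_congr {f : ℂ → ℂ} {c m d c' m' d' : ℝ → ℂ} (hc : EqOn c c' (Icc 0 1))
    (hm : EqOn m m' (Icc 0 1)) (hd : EqOn d d' (Icc 0 1)) :
    EqOn (buildPath f c m d) (buildPath f c' m' d') (Icc 0 1) := by
  intro s hs
  unfold buildPath
  split_ifs with h1 h2
  · exact hc ⟨by linarith [hs.1], by linarith⟩
  · exact hm ⟨by linarith, by linarith⟩
  · exact congrArg f (hd ⟨by linarith [hs.2], by linarith⟩)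

theorem buildPath_notMem {f : ℂ → ℂ} {c m d : ℝ → ℂ} {O : Set ℂ} (hO : ∀ z, z ∉ O → f z ∉ O)
    (hc : ∀ s ∈ Ioc (0 : ℝ) 1, c s ∉ O) (hm : ∀ s ∈ Icc (0 : ℝ) 1, m s ∉ O)
    (hd : ∀ s ∈ Ioc (0 : ℝ) 1, d s ∉ O) {s : ℝ} (hs : s ∈ Ioo (0 : ℝ) 1) :
    buildPath f c m d s ∉ O := by
  unfold buildPath
  split_ifs with h1 h2
  · exact hc _ ⟨by linarith [hs.1], by linarith⟩
  · exact hm _ ⟨by linarith, by linarith⟩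
  · exact hO _ (hd _ ⟨by linarith [hs.2], by linarith⟩)

theorem buildPath_zero (f : ℂ → ℂ) (c m d : ℝ → ℂ) : buildPath f c m d 0 = c 0 := by
  unfold buildPath
  norm_num

theorem buildPath_one (f : ℂ → ℂ) (c m d : ℝ → ℂ) : buildPath f c m d 1 = f (d 0) := by
  unfold buildPath
  norm_num

theorem PathHom.buildPath {f : ℂ → ℂ} (hf : Continuous f) {O : Set ℂ} (hO : ∀ z, z ∉ O → f z ∉ O)
    {C M D : ℝ → ℝ → ℂ} (hC : Continuous fun p : ℝ × ℝ => C p.1 p.2)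
    (hM : Continuous fun p : ℝ × ℝ => M p.1 p.2) (hD : Continuous fun p : ℝ × ℝ => D p.1 p.2)
    (h₁ : ∀ t, C t 1 = M t 0) (h₂ : ∀ t, M t 1 = f (D t 1))
    (hC0 : ∀ t ∈ Icc (0 : ℝ) 1, C t 0 = C 0 0) (hD0 : ∀ t ∈ Icc (0 : ℝ) 1, D t 0 = D 0 0)
    (hCO : ∀ t ∈ Icc (0 : ℝ) 1, ∀ s ∈ Ioc (0 : ℝ) 1, C t s ∉ O)
    (hMO : ∀ t ∈ Icc (0 : ℝ) 1, ∀ s ∈ Icc (0 : ℝ) 1, M t s ∉ O)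
    (hDO : ∀ t ∈ Icc (0 : ℝ) 1, ∀ s ∈ Ioc (0 : ℝ) 1, D t s ∉ O) :
    PathHom O (buildPath f (C 0) (M 0) (D 0)) (buildPath f (C 1) (M 1) (D 1)) :=
  ⟨fun p => _root_.buildPath f (C p.1) (M p.1) (D p.1) p.2,
    continuous_buildPath hf hC hM hD h₁ h₂, fun _ _ => rfl, fun _ _ => rfl,
    fun t ht => by simp only [buildPath_zero, hC0 t ht],
    fun t ht => by simp only [buildPath_one, hD0 t ht],
    fun t ht _ hs => buildPath_notMem hO (hCO t ht) (hMO t ht) (hDO t ht) hs⟩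

theorem PathHom.of_startHom {f : ℂ → ℂ} (hf : Continuous f) {O : Set ℂ}
    (hO : ∀ z, z ∉ O → f z ∉ O) {c m d c' d' : ℝ → ℂ} (hc : StartHom O c c') (hd : StartHom O d d')
    (hm : Continuous m) (h₁ : c 1 = m 0) (h₂ : m 1 = f (d 1))
    (hmO : ∀ s ∈ Icc (0 : ℝ) 1, m s ∉ O) :
    PathHom O (_root_.buildPath f c m d) (_root_.buildPath f c' m d') := by
  obtain ⟨C, hC, hC0, hC1, hC2, hC3, hC4⟩ := hc
  obtain ⟨D, hD, hD0, hD1, hD2, hD3, hD4⟩ := hd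
  have hcl : ∀ t : ℝ, max 0 (min 1 t) ∈ Icc (0 : ℝ) 1 := fun t => by simp
  have h0 : (0 : ℝ) ∈ Icc (0 : ℝ) 1 := by simp
  have h1 : (1 : ℝ) ∈ Icc (0 : ℝ) 1 := by simp
  have hclamp : ∀ s ∈ Icc (0 : ℝ) 1, max 0 (min 1 s) = s := fun s hs => by
    rw [min_eq_right hs.2, max_eq_right hs.1]
  have hcont : ∀ {H : ℝ × ℝ → ℂ}, ContinuousOn H (Icc 0 1 ×ˢ Icc 0 1) →
      Continuous fun p : ℝ × ℝ => H (max 0 (min 1 p.1), max 0 (min 1 p.2)) := fun hH =>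
    hH.comp_continuous (by fun_prop) fun p => ⟨hcl _, hcl _⟩
  refine (PathHom.buildPath (C := fun t s => C (max 0 (min 1 t), max 0 (min 1 s)))
    (M := fun _ s => m s) (D := fun t s => D (max 0 (min 1 t), max 0 (min 1 s))) hf hO
    (hcont hC) (by fun_prop) (hcont hD) (fun t => ?_) (fun t => ?_) (fun t ht => ?_)
    (fun t ht => ?_) (fun t ht s hs => ?_) (fun t ht s hs => hmO s hs) (fun t ht s hs => ?_)).congr
    (buildPath_congr (fun s hs => ?_) (fun _ _ => rfl) fun s hs => ?_)
    (buildPath_congr (fun s hs => ?_) (fun _ _ => rfl) fun s hs => ?_)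
  · rw [hclamp 1 h1, hC3 _ (hcl t), h₁]
  · rw [hclamp 1 h1, hD3 _ (hcl t), h₂]
  · rw [hclamp 0 h0, hC2 _ (hcl t), hC2 _ h0]
  · rw [hclamp 0 h0, hD2 _ (hcl t), hD2 _ h0]
  · rw [hclamp t ht, hclamp s ⟨hs.1.le, hs.2⟩]
    exact hC4 t ht s hs
  · rw [hclamp t ht, hclamp s ⟨hs.1.le, hs.2⟩]
    exact hD4 t ht s hs
  · rw [hclamp 0 h0, hclamp s hs, hC0 s hs]
  · rw [hclamp 0 h0, hclamp s hs, hD0 s hs]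
  · rw [hclamp 1 h1, hclamp s hs, hC1 s hs]
  · rw [hclamp 1 h1, hclamp s hs, hD1 s hs]

theorem Line.notMem {f : ℂ ≃ₜ ℂ} {T : ℝ} {A : ℝ → ℂ} (h : Line f T A) {s : ℝ}
    (hs : s ∈ Ioo 0 T ∪ Ioo (-T) 0) : A s ∉ range fun k : ℤ => A (k * T) := by
  rintro ⟨k, hk⟩
  have h1 := h.inj hk
  have hT := h.pos
  have h2 : -1 < (k : ℝ) := by rcases hs with hs | hs <;> nlinarith [hs.1, hs.2]
  have h3 : (k : ℝ) < 1 := by rcases hs with hs | hs <;> nlinarith [hs.1, hs.2]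
  have : k = 0 := by
    have h2' : -1 < k := by exact_mod_cast h2
    have h3' : k < 1 := by exact_mod_cast h3
    omega
  rw [this] at h1
  rcases hs with hs | hs <;> simp at h1 <;> linarith [hs.1, hs.2]

theorem Line.map_notMem {f : ℂ ≃ₜ ℂ} {T : ℝ} {A : ℝ → ℂ} (h : Line f T A) {z : ℂ}
    (hz : z ∉ range fun k : ℤ => A (k * T)) : f z ∉ range fun k : ℤ => A (k * T) := by
  rintro ⟨k, hk⟩
  refine hz ⟨k - 1, f.injective ?_⟩
  beta_reduce at hk ⊢
  rw [h.equi, ← hk]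
  push_cast
  congr 1
  ring

theorem convexComb_mem {S : Set ℝ} (hS : Convex ℝ S) {x y t : ℝ} (hx : x ∈ S) (hy : y ∈ S)
    (ht : t ∈ Icc (0 : ℝ) 1) : (1 - t) * x + t * y ∈ S :=
  hS hx hy (by linarith [ht.2]) ht.1 (by ring)

theorem Line.pathHom_buildPath {f : ℂ ≃ₜ ℂ} {T : ℝ} {A : ℝ → ℂ} (h : Line f T A)
    {c m d c' m' d' : ℝ → ℝ} (hc : Continuous c) (hm : Continuous m) (hd : Continuous d)
    (hc' : Continuous c') (hm' : Continuous m') (hd' : Continuous d')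
    (h₁ : c 1 = m 0) (h₂ : m 1 = T + d 1) (h₁' : c' 1 = m' 0) (h₂' : m' 1 = T + d' 1)
    (hc0 : c 0 = 0) (hc0' : c' 0 = 0) (hd0 : d 0 = 0) (hd0' : d' 0 = 0)
    (hcT : ∀ s ∈ Ioc (0 : ℝ) 1, c s ∈ Ioo 0 T) (hcT' : ∀ s ∈ Ioc (0 : ℝ) 1, c' s ∈ Ioo 0 T)
    (hmT : ∀ s ∈ Icc (0 : ℝ) 1, m s ∈ Ioo 0 T) (hmT' : ∀ s ∈ Icc (0 : ℝ) 1, m' s ∈ Ioo 0 T)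
    (hdT : ∀ s ∈ Ioc (0 : ℝ) 1, d s ∈ Ioo (-T) 0)
    (hdT' : ∀ s ∈ Ioc (0 : ℝ) 1, d' s ∈ Ioo (-T) 0) :
    PathHom (range fun k : ℤ => A (k * T))
      (buildPath f (fun s => A (c s)) (fun s => A (m s)) (fun s => A (d s)))
      (buildPath f (fun s => A (c' s)) (fun s => A (m' s)) (fun s => A (d' s))) := by
  have hA := h.cont
  refine (PathHom.buildPath (C := fun t s => A ((1 - t) * c s + t * c' s))
    (M := fun t s => A ((1 - t) * m s + t * m' s)) (D := fun t s => A ((1 - t) * d s + t * d' s))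
    f.continuous (fun _ => h.map_notMem) (by fun_prop) (by fun_prop) (by fun_prop) (fun t => ?_)
    (fun t => ?_) (fun t _ => by simp [hc0, hc0']) (fun t _ => by simp [hd0, hd0'])
    (fun t ht s hs => ?_) (fun t ht s hs => ?_) (fun t ht s hs => ?_)).congr
    (buildPath_congr ?_ ?_ ?_) (buildPath_congr ?_ ?_ ?_)
  · rw [h₁, h₁']
  · rw [h.equi, h₂, h₂']; congr 1; ring
  · exact h.notMem (Or.inl (convexComb_mem (convex_Ioo _ _) (hcT s hs) (hcT' s hs) ht))
  · exact h.notMem (Or.inl (convexComb_mem (convex_Ioo _ _) (hmT s hs) (hmT' s hs) ht))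
  · exact h.notMem (Or.inr (convexComb_mem (convex_Ioo _ _) (hdT s hs) (hdT' s hs) ht))
  all_goals exact fun s _ => by simp

theorem Line.buildPath_thirds {f : ℂ ≃ₜ ℂ} {T : ℝ} {A : ℝ → ℂ} (h : Line f T A) :
    buildPath f (fun s => A (T / 3 * s)) (fun s => A (T / 3 * (1 + s))) (fun s => A (-(T / 3) * s)) =
      fun s => A (T * s) := by
  funext s
  unfold buildPath
  split_ifs
  · exact congrArg A (by ring)
  · exact congrArg A (by ring)
  · rw [h.equi]; exact congrArg A (by ring)

/-- A three-piece path along a line is homotopic to a fundamental piece of the line. -/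
theorem Line.pathHom_buildPath_line {f : ℂ ≃ₜ ℂ} {T : ℝ} {A : ℝ → ℂ} (h : Line f T A)
    {c m d : ℝ → ℝ} (hc : Continuous c) (hm : Continuous m) (hd : Continuous d)
    (h₁ : c 1 = m 0) (h₂ : m 1 = T + d 1) (hc0 : c 0 = 0) (hd0 : d 0 = 0)
    (hcT : ∀ s ∈ Ioc (0 : ℝ) 1, c s ∈ Ioo 0 T) (hmT : ∀ s ∈ Icc (0 : ℝ) 1, m s ∈ Ioo 0 T)
    (hdT : ∀ s ∈ Ioc (0 : ℝ) 1, d s ∈ Ioo (-T) 0) :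
    PathHom (range fun k : ℤ => A (k * T))
      (buildPath f (fun s => A (c s)) (fun s => A (m s)) (fun s => A (d s)))
      (fun s => A (T * s)) := by
  have hT := h.pos
  rw [← h.buildPath_thirds]
  refine h.pathHom_buildPath hc hm hd (by fun_prop) (by fun_prop) (by fun_prop) h₁ h₂ (by ring)
    (by ring) hc0 (by ring) hd0 (by ring) hcT (fun s hs => ?_) hmT (fun s hs => ?_) hdT
    (fun s hs => ?_) <;> constructor <;> nlinarith [hs.1, hs.2]

theorem Line.range_eq {f : ℂ ≃ₜ ℂ} {T : ℝ} {A : ℝ → ℂ} (h : Line f T A) :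
    (range fun k : ℤ => A (k * T)) = orbitZ f (A 0) := by
  unfold orbitZ
  congr 1
  funext k
  rw [h.equi.zpow, zero_add]

theorem Line.startHom {f : ℂ ≃ₜ ℂ} {T : ℝ} {A : ℝ → ℂ} (h : Line f T A) {c c' : ℝ → ℝ}
    (hc : Continuous c) (hc' : Continuous c') (h0 : c 0 = 0) (h0' : c' 0 = 0) (h1 : c 1 = c' 1)
    (hT : (∀ s ∈ Ioc (0 : ℝ) 1, c s ∈ Ioo 0 T ∧ c' s ∈ Ioo 0 T) ∨
      ∀ s ∈ Ioc (0 : ℝ) 1, c s ∈ Ioo (-T) 0 ∧ c' s ∈ Ioo (-T) 0) :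
    StartHom (orbitZ f (A 0)) (fun s => A (c s)) (fun s => A (c' s)) := by
  have hA := h.cont
  rw [← h.range_eq]
  refine ⟨fun p => A ((1 - p.1) * c p.2 + p.1 * c' p.2), by fun_prop, fun s _ => by simp,
    fun s _ => by simp, fun t _ => by simp [h0, h0'], fun t _ => ?_, fun t ht s hs => h.notMem ?_⟩
  · simp only [h1]; congr 1; ring
  · rcases hT with hT | hT
    · exact Or.inl (convexComb_mem (convex_Ioo _ _) (hT s hs).1 (hT s hs).2 ht)
    · exact Or.inr (convexComb_mem (convex_Ioo _ _) (hT s hs).1 (hT s hs).2 ht)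

/-- The projection of `τ` to the interval `[-x, x]`. -/
def clampTo (τ x : ℝ) : ℝ := max (-x) (min τ x)

theorem continuous_clampTo : Continuous fun p : ℝ × ℝ => clampTo p.1 p.2 := by
  unfold clampTo
  fun_prop

theorem clampTo_of_nonneg {τ x : ℝ} (hτ : 0 ≤ τ) (hx : 0 ≤ x) : clampTo τ x = min τ x :=
  max_eq_right ((neg_nonpos.2 hx).trans (le_min hτ hx))

theorem clampTo_neg {τ x : ℝ} (hx : 0 ≤ x) : clampTo (-τ) x = -clampTo τ x := by
  unfold clampTo
  rcases le_total τ x with h1 | h1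
  · rcases le_total (-x) τ with h2 | h2
    · rw [min_eq_left h1, max_eq_right h2, min_eq_left (by linarith), max_eq_right (by linarith)]
    · rw [min_eq_left h1, max_eq_left h2, min_eq_right (by linarith), max_eq_right (by linarith),
        neg_neg]
  · rw [min_eq_right h1, max_eq_right (show -x ≤ x by linarith),
      min_eq_left (show -τ ≤ x by linarith), max_eq_left (show -τ ≤ -x by linarith)]

theorem clampTo_zero (τ : ℝ) : clampTo τ 0 = 0 := by
  simp [clampTo]

theorem clampTo_sign_mul {ε τ x : ℝ} (hε : ε = 1 ∨ ε = -1) (hx : 0 ≤ x) :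
    clampTo (ε * τ) x = ε * clampTo τ x := by
  rcases hε with rfl | rfl
  · simp
  · rw [neg_one_mul, clampTo_neg hx, neg_one_mul]

theorem clampTo_one {τ : ℝ} (h : |τ| ≤ 1) : clampTo τ 1 = τ := by
  rw [abs_le] at h
  rw [clampTo, min_eq_left h.2, max_eq_right h.1]

theorem clampTo_mem {τ x : ℝ} (hτ : 0 < τ) (hx : 0 < x) : 0 < clampTo τ x ∧ clampTo τ x ≤ τ := by
  rw [clampTo_of_nonneg hτ.le hx.le]
  exact ⟨lt_min hτ hx, min_le_left _ _⟩

theorem clampTo_mem_of_neg {τ x : ℝ} (hτ : τ < 0) (hx : 0 < x) :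
    τ ≤ clampTo τ x ∧ clampTo τ x < 0 := by
  have := clampTo_mem (neg_pos.2 hτ) hx
  rw [clampTo_neg hx.le] at this
  constructor <;> linarith

theorem clampTo_congr {δ τ τ' x : ℝ} (hτ : δ ≤ |τ|) (hτ' : δ ≤ |τ'|) (h : |τ' - τ| < δ)
    (hx : 0 ≤ x) (hxδ : x ≤ δ) : clampTo τ' x = clampTo τ x := by
  have key : ∀ τ τ' : ℝ, 0 < τ → δ ≤ |τ| → δ ≤ |τ'| → |τ' - τ| < δ →
      clampTo τ' x = clampTo τ x := by
    intro τ τ' h0 h1 h2 h3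
    rw [abs_of_pos h0] at h1
    rw [abs_lt] at h3
    have h4 : 0 < τ' := by linarith
    rw [abs_of_pos h4] at h2
    rw [clampTo_of_nonneg h0.le hx, clampTo_of_nonneg h4.le hx, min_eq_right (by linarith),
      min_eq_right (by linarith)]
  rcases lt_trichotomy τ 0 with h0 | rfl | h0
  · have := key (-τ) (-τ') (by linarith) (by rwa [abs_neg]) (by rwa [abs_neg]) (by
      rw [show -τ' - -τ = -(τ' - τ) by ring, abs_neg]; exact h)
    rw [clampTo_neg hx, clampTo_neg hx] at this
    exact neg_injective this
  · rw [abs_zero] at hτ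
    linarith [abs_nonneg (τ' - 0)]
  · exact key τ τ' h0 hτ hτ' h

/-- Two lines of period one with the same germ at zero. -/
structure LinePair (f : ℂ ≃ₜ ℂ) (δ : ℝ) (A B : ℝ → ℂ) (O : Set ℂ) : Prop where
  idx : HasIdx f
  lineA : Line f 1 A
  lineB : Line f 1 B
  pos : 0 < δ
  lt_half : δ < 1 / 2
  agree : ∀ s ∈ Icc (-δ) δ, A s = B s
  orbit : O = orbitZ f (A 0)
  fin : ∀ R : ℝ, (O ∩ Metric.closedBall 0 R).Finite

/-- The piece of `A` between the parameters `d` and `c` closes up, together with a piece of `B`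
between `σ` and `τ`, to a fundamental piece of a third line. -/
structure IsState (δ : ℝ) (A B : ℝ → ℂ) (d c τ σ : ℝ) : Prop where
  d_mem : d ∈ Icc δ (1 - δ)
  c_mem : c ∈ Icc δ (1 - δ)
  le_abs_τ : δ ≤ |τ|
  le_abs_σ : δ ≤ |σ|
  opposite : τ * σ ≤ 0
  abs_sub_le : |τ - σ| ≤ 1
  eq_d : A d = B τ
  eq_c : A c = B (σ + 1)
  avoid : ∀ r v, (r - d) * (r - c) < 0 → (v - τ) * (v - σ) < 0 → A r ≠ B v ∧ A r ≠ B (v + 1)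

/-- The path associated to a state. -/
noncomputable def statePath (f : ℂ → ℂ) (A B : ℝ → ℂ) (d c τ σ : ℝ) : ℝ → ℂ :=
  buildPath f (fun x => B (clampTo τ x)) (fun x => A (d + (c - d) * x)) (fun x => B (clampTo σ x))

theorem mem_Ioo_of_mul_neg {a b x : ℝ} (hab : a ≤ b) (h : (x - a) * (x - b) < 0) :
    x ∈ Ioo a b := by
  constructor <;> nlinarith

namespace LinePair

variable {f : ℂ ≃ₜ ℂ} {δ : ℝ} {A B : ℝ → ℂ} {O : Set ℂ} {d c τ σ : ℝ}

theorem zero_agree (h : LinePair f δ A B O) : A 0 = B 0 :=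
  h.agree 0 ⟨by linarith [h.pos], h.pos.le⟩

theorem orbit_B (h : LinePair f δ A B O) : O = orbitZ f (B 0) := by
  rw [h.orbit, h.zero_agree]

theorem exists_sign (h : LinePair f δ A B O) (hs : IsState δ A B d c τ σ) :
    ∃ ε a b : ℝ, (ε = 1 ∨ ε = -1) ∧ δ ≤ a ∧ δ ≤ b ∧ τ = ε * b ∧ σ = ε * -a ∧
      |τ - σ| = a + b := by
  have hδ := h.pos
  have h1 := hs.le_abs_τ
  have h2 := hs.le_abs_σ
  have h3 := hs.opposite
  rcases le_or_gt τ 0 with h0 | h0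
  · rw [abs_of_nonpos h0] at h1
    have h4 : 0 ≤ σ := by nlinarith
    rw [abs_of_nonneg h4] at h2
    refine ⟨-1, σ, -τ, Or.inr rfl, h2, h1, by ring, by ring, ?_⟩
    rw [abs_of_nonpos (by linarith)]; ring
  · rw [abs_of_pos h0] at h1
    have h4 : σ ≤ 0 := by nlinarith
    rw [abs_of_nonpos h4] at h2
    refine ⟨1, -σ, τ, Or.inl rfl, h2, h1, by ring, by ring, ?_⟩
    rw [abs_of_nonneg (by linarith)]; ring

theorem exists_overlap (h : LinePair f δ A B O) (hs : IsState δ A B d c τ σ) (hlt : |τ - σ| < 1) :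
    ∃ (ε a b η T : ℝ) (C : ℝ → ℂ), (η = 1 ∨ η = -1) ∧ δ ≤ a ∧ δ ≤ b ∧ τ = ε * b ∧ σ = ε * -a ∧
      |τ - σ| = a + b ∧ c = d + η * (T - a - b) ∧
      Overlap f T ε a b C (fun s => B (ε * s)) O ∧ ∀ s ∈ Icc b (T - a), C s = A (d + η * (s - b)) := by
  obtain ⟨ε, a, b, hε, ha, hb, hτ, hσ, hab⟩ := h.exists_sign hs
  have hδ := h.pos
  rw [hab] at hlt
  have hcd : c ≠ d := by
    rintro rfl
    have h1 := h.lineB.inj (hs.eq_d.symm.trans hs.eq_c)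
    rcases hε with rfl | rfl <;> linarith
  obtain ⟨η, ℓ, hη, hℓ, hc⟩ : ∃ η ℓ : ℝ, (η = 1 ∨ η = -1) ∧ 0 < ℓ ∧ c = d + η * ℓ := by
    rcases lt_or_gt_of_ne hcd with h1 | h1
    · exact ⟨-1, d - c, Or.inr rfl, by linarith, by ring⟩
    · exact ⟨1, c - d, Or.inl rfl, by linarith, by ring⟩
  have hηη : η * η = 1 := by rcases hη with rfl | rfl <;> norm_num
  have hη0 : η ≠ 0 := fun h0 => by rw [h0] at hηη; norm_num at hηη
  have hεε : ε * ε = 1 := by rcases hε with rfl | rfl <;> norm_num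
  have hε0 : ε ≠ 0 := fun h0 => by rw [h0] at hεε; norm_num at hεε
  have hBc := h.lineB.cont
  have hAc := h.lineA.cont
  have hBinj : ∀ {s t : ℝ}, B (ε * s) = B (ε * t) → s = t := fun h1 =>
    mul_left_cancel₀ hε0 (h.lineB.inj h1)
  have hbetween : ∀ s ∈ Ioo b (b + ℓ), (d + η * (s - b) - d) * (d + η * (s - b) - c) < 0 := by
    intro s hs'
    rw [hc, show (d + η * (s - b) - d) * (d + η * (s - b) - (d + η * ℓ)) =
      (η * η) * ((s - b) * (s - b - ℓ)) by ring, hηη, one_mul]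
    exact mul_neg_of_pos_of_neg (by linarith [hs'.1]) (by linarith [hs'.2])
  have hvbetween : ∀ v ∈ Ioo (-a) b, (ε * v - τ) * (ε * v - σ) < 0 := by
    intro v hv
    rw [hτ, hσ, show (ε * v - ε * b) * (ε * v - ε * -a) = (ε * ε) * ((v - b) * (v + a)) by ring,
      hεε, one_mul]
    exact mul_neg_of_neg_of_pos (by linarith [hv.2]) (by linarith [hv.1])
  set g : ℝ → ℂ := fun s => if s ≤ b then B (ε * s) else A (d + η * (s - b)) with hg
  have hglow : ∀ s, s ≤ b → g s = B (ε * s) := fun s h1 => if_pos h1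
  have hghigh : ∀ s, b ≤ s → g s = A (d + η * (s - b)) := by
    intro s h1
    rcases h1.eq_or_lt with rfl | h1
    · rw [hglow _ le_rfl, sub_self, mul_zero, add_zero, hs.eq_d, hτ]
    · exact if_neg (not_le.2 h1)
  have hgc : Continuous g := Continuous.if_le (by fun_prop) (by fun_prop) (by fun_prop)
    (by fun_prop) fun s h1 => by rw [h1, sub_self, mul_zero, add_zero, hs.eq_d, hτ]
  have hend : g (-a + (a + b + ℓ)) = f (g (-a)) := by
    rw [hghigh _ (by linarith), hglow _ (by linarith), h.lineB.equi, ← hσ, ← hs.eq_c, hc]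
    congr 1; ring
  have hmix : ∀ v ∈ Icc (-a) b, ∀ s ∈ Ioc b (b + ℓ), B (ε * v) ≠ A (d + η * (s - b)) := by
    intro v hv s hs' heq
    rcases eq_or_lt_of_le hs'.2 with h3 | h3
    · rw [h3, show d + η * (b + ℓ - b) = c by rw [hc]; ring, hs.eq_c] at heq
      have := h.lineB.inj heq
      rw [hσ] at this
      rcases hε with rfl | rfl <;> linarith [hv.1, hv.2]
    rcases eq_or_lt_of_le hv.2 with rfl | h1
    · rw [← hτ, ← hs.eq_d] at heq
      have := h.lineA.inj heq
      have : η * (s - v) ≠ 0 := mul_ne_zero hη0 (by linarith [hs'.1])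
      apply this
      linarith
    rcases eq_or_lt_of_le hv.1 with rfl | h2
    · have h4 := congrArg f heq
      rw [h.lineB.equi, h.lineA.equi, ← hσ, ← hs.eq_c] at h4
      have h5 := h.lineA.inj h4
      have h6 := hs.c_mem
      have h7 := hs.d_mem
      rcases hη with rfl | rfl <;> linarith [hs'.1, hs'.2, h6.1, h6.2, h7.1, h7.2]
    · exact (hs.avoid _ _ (hbetween s ⟨hs'.1, h3⟩) (hvbetween v ⟨h2, h1⟩)).1 heq.symm
  have hinj : InjOn g (Icc (-a) (-a + (a + b + ℓ))) := by
    have key : ∀ s ∈ Icc (-a) (b + ℓ), ∀ t ∈ Icc (-a) (b + ℓ), s ≤ t → g s = g t → s = t := by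
      intro s hs' t ht hst heq
      rcases le_or_gt t b with h1 | h1
      · rw [hglow _ h1, hglow _ (hst.trans h1)] at heq
        exact hBinj heq
      rcases le_or_gt s b with h2 | h2
      · rw [hglow _ h2, hghigh _ h1.le] at heq
        exact absurd heq (hmix s ⟨hs'.1, h2⟩ t ⟨h1, ht.2⟩)
      · rw [hghigh _ h2.le, hghigh _ h1.le] at heq
        have := mul_left_cancel₀ hη0 (add_left_cancel (h.lineA.inj heq))
        linarith
    have e : -a + (a + b + ℓ) = b + ℓ := by ring
    rw [e]
    intro s hs' t ht heq
    rcases le_total s t with h1 | h1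
    · exact key s hs' t ht h1 heq
    · exact (key t ht s hs' h1 heq.symm).symm
  obtain ⟨C, hC, hCg⟩ := h.idx.exists_line (T := a + b + ℓ) (s₀ := -a) (by linarith)
    hgc.continuousOn hend hinj (by
      intro y hy s hs' hys heq
      rcases le_or_gt s b with h1 | h1
      · rw [hglow _ h1, hglow _ (hys.trans h1), h.lineB.equi] at heq
        have := h.lineB.inj heq
        rcases hε with rfl | rfl <;> linarith [hy.1, hy.2, hs'.1, hs'.2]
      rcases lt_or_ge y b with h2 | h2
      · rw [hghigh _ h1.le, hglow _ h2.le, h.lineB.equi] at heq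
        exact (hs.avoid _ _ (hbetween s ⟨h1, by linarith [hs'.2]⟩)
          (hvbetween y ⟨hy.1, h2⟩)).2 heq
      · rw [hghigh _ h1.le, hghigh _ h2, h.lineA.equi] at heq
        have h5 := h.lineA.inj heq
        have h6 := hs.c_mem
        have h7 := hs.d_mem
        rcases hη with rfl | rfl <;>
          linarith [hs'.1, hs'.2, hy.1, hy.2, h6.1, h6.2, h7.1, h7.2])
  have hC0 : ∀ s ∈ Icc (-a) b, C s = B (ε * s) := fun s hs' => by
    rw [hCg ⟨hs'.1, by linarith [hs'.2]⟩, hglow _ hs'.2]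
  refine ⟨ε, a, b, η, a + b + ℓ, C, hη, ha, hb, hτ, hσ, hab, by rw [hc]; ring, ⟨h.idx, hC,
    by fun_prop, fun s t hst => hBinj hst, fun s => ?_, hε, by linarith, by linarith, by linarith,
    by linarith, hC0, ?_, h.fin⟩, fun s hs' => ?_⟩
  · rw [h.lineB.equi, mul_add, hεε]
  · rw [hC.range_eq, hC0 0 ⟨by linarith, by linarith⟩, mul_zero, h.orbit_B]
  · rw [hCg ⟨by linarith [hs'.1], by linarith [hs'.2]⟩, hghigh _ hs'.1]

end LinePair

namespace LinePair

variable {f : ℂ ≃ₜ ℂ} {δ : ℝ} {A B : ℝ → ℂ} {O : Set ℂ} {d c τ σ : ℝ}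

theorem abs_lt_one (hδ : 0 < δ) (hτ : δ ≤ |τ|) (hσ : δ ≤ |σ|) (h : τ * σ ≤ 0) (hle : |τ - σ| ≤ 1) :
    |τ| < 1 ∧ |σ| < 1 := by
  have h1 := abs_pos.1 (hδ.trans_le hτ)
  have h2 := abs_pos.1 (hδ.trans_le hσ)
  rw [abs_le] at hle
  rw [abs_lt, abs_lt]
  rcases lt_or_gt_of_ne h1 with h3 | h3 <;> rcases lt_or_gt_of_ne h2 with h4 | h4
  · nlinarith
  · refine ⟨⟨?_, ?_⟩, ?_, ?_⟩ <;> linarith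
  · refine ⟨⟨?_, ?_⟩, ?_, ?_⟩ <;> linarith
  · nlinarith

theorem startHom_clampTo (h : LinePair f δ A B O) (hτ : τ ≠ 0) (hτ1 : |τ| < 1) :
    StartHom O (fun x => B (τ * x)) (fun x => B (clampTo τ x)) := by
  rw [h.orbit_B]
  have hcl : Continuous fun x => clampTo τ x :=
    continuous_clampTo.comp (f := fun x : ℝ => (τ, x)) (by fun_prop)
  refine h.lineB.startHom (by fun_prop) hcl (by simp) (clampTo_zero τ)
    (by rw [clampTo_one hτ1.le, mul_one]) ?_
  rw [abs_lt] at hτ1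
  rcases lt_or_gt_of_ne hτ with h0 | h0
  · right
    intro s hs
    have := clampTo_mem_of_neg h0 hs.1
    refine ⟨⟨?_, ?_⟩, ?_, ?_⟩ <;> nlinarith [hs.1, hs.2]
  · left
    intro s hs
    have := clampTo_mem h0 hs.1
    refine ⟨⟨?_, ?_⟩, ?_, ?_⟩ <;> nlinarith [hs.1, hs.2]

theorem extend (h : LinePair f δ A B O) (hs : IsState δ A B d c τ σ) {ε a b η T : ℝ} {C : ℝ → ℂ}
    (hη : η = 1 ∨ η = -1) (hτ : τ = ε * b) (hσ : σ = ε * -a) (hcd : c = d + η * (T - a - b))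
    (ho : Overlap f T ε a b C (fun s => B (ε * s)) O)
    (hC : ∀ s ∈ Icc b (T - a), C s = A (d + η * (s - b))) {q₁ q₂ u₁ u₂ : ℝ}
    (hq₁ : q₁ ∈ Icc b (T - a)) (hq₂ : q₂ + T ∈ Icc b (T - a)) (e₁ : C q₁ = B (ε * u₁))
    (e₂ : C q₂ = B (ε * u₂)) (hom₁ : StartHom O (fun x => C (q₁ * x)) (fun x => B (ε * (u₁ * x))))
    (hom₂ : StartHom O (fun x => C (q₂ * x)) (fun x => B (ε * (u₂ * x))))
    (hu₁ : δ ≤ |u₁|) (hu₂ : δ ≤ |u₂|) (hu : u₁ * u₂ ≤ 0) (hle : |u₁ - u₂| ≤ 1)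
    (havoid : ∀ s v, (s - q₁) * (s - (q₂ + T)) < 0 → (v - u₁) * (v - u₂) < 0 →
      C s ≠ B (ε * v) ∧ C (s - T) ≠ B (ε * v)) :
    IsState δ A B (d + η * (q₁ - b)) (d + η * (q₂ + T - b)) (ε * u₁) (ε * u₂) ∧
      PathHom O (statePath f A B d c τ σ)
        (statePath f A B (d + η * (q₁ - b)) (d + η * (q₂ + T - b)) (ε * u₁) (ε * u₂)) := by
  have hδ := h.pos
  have ha := ho.a_pos
  have hb := ho.b_pos
  have habT := ho.ab_lt_period
  have hab := ho.ab_lt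
  have hT := ho.line.pos
  have hηη : η * η = 1 := by rcases hη with rfl | rfl <;> norm_num
  have hεε : ε * ε = 1 := by rcases ho.sign with h | h <;> rw [h] <;> norm_num
  have hε1 : |ε| = 1 := by rcases ho.sign with h | h <;> rw [h] <;> simp
  have hε0 : ε ≠ 0 := fun h0 => by rw [h0] at hεε; norm_num at hεε
  have hmem : ∀ s ∈ Icc b (T - a), d + η * (s - b) ∈ Icc δ (1 - δ) := by
    intro s hs'
    have h6 := hs.c_mem
    have h7 := hs.d_mem
    rw [hcd] at h6
    rcases hη with rfl | rfl <;> constructor <;> linarith [hs'.1, hs'.2, h6.1, h6.2, h7.1, h7.2]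
  have habs : ∀ u : ℝ, |ε * u| = |u| := fun u => by rw [abs_mul, hε1, one_mul]
  have hstate : IsState δ A B (d + η * (q₁ - b)) (d + η * (q₂ + T - b)) (ε * u₁) (ε * u₂) := by
    refine ⟨hmem _ hq₁, hmem _ hq₂, by rwa [habs], by rwa [habs], ?_, ?_, ?_, ?_, ?_⟩
    · rw [show ε * u₁ * (ε * u₂) = (ε * ε) * (u₁ * u₂) by ring, hεε, one_mul]
      exact hu
    · rw [← mul_sub, habs]; exact hle
    · rw [← hC _ hq₁, e₁]
    · rw [← hC _ hq₂, ← ho.line.equi, e₂, h.lineB.equi]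
    · intro r v hr hv
      obtain ⟨s, rfl⟩ : ∃ s, r = d + η * (s - b) := ⟨b + η * (r - d), by
        rw [show d + η * (b + η * (r - d) - b) = d + (η * η) * (r - d) by ring, hηη]; ring⟩
      obtain ⟨w, rfl⟩ : ∃ w, v = ε * w := ⟨ε * v, by rw [← mul_assoc, hεε, one_mul]⟩
      have hs1 : (s - q₁) * (s - (q₂ + T)) < 0 := by
        rw [show (d + η * (s - b) - (d + η * (q₁ - b))) * (d + η * (s - b) -
          (d + η * (q₂ + T - b))) = (η * η) * ((s - q₁) * (s - (q₂ + T))) by ring, hηη,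
          one_mul] at hr
        exact hr
      have hv1 : (w - u₁) * (w - u₂) < 0 := by
        rw [show (ε * w - ε * u₁) * (ε * w - ε * u₂) = (ε * ε) * ((w - u₁) * (w - u₂)) by ring,
          hεε, one_mul] at hv
        exact hv
      have hs2 : s ∈ Icc b (T - a) := by
        rcases le_total q₁ (q₂ + T) with h1 | h1
        · have := mem_Ioo_of_mul_neg h1 hs1
          exact ⟨by linarith [this.1, hq₁.1], by linarith [this.2, hq₂.2]⟩
        · rw [mul_comm] at hs1
          have := mem_Ioo_of_mul_neg h1 hs1
          exact ⟨by linarith [this.1, hq₂.1], by linarith [this.2, hq₁.2]⟩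
      obtain ⟨h1, h2⟩ := havoid s w hs1 hv1
      rw [← hC s hs2]
      refine ⟨h1, fun h3 => h2 (f.injective ?_)⟩
      rw [ho.line.equi, sub_add_cancel, h3, h.lineB.equi]
  refine ⟨hstate, ?_⟩
  have hcl : ∀ τ, Continuous fun x => clampTo τ x := fun τ =>
    continuous_clampTo.comp (f := fun x : ℝ => (τ, x)) (by fun_prop)
  have hOC : O = range fun k : ℤ => C (k * T) := ho.orbit
  have hfO : ∀ z, z ∉ O → f z ∉ O := fun z hz => by
    rw [hOC] at hz ⊢
    exact ho.line.map_notMem hz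
  have hCc := ho.line.cont
  have h0 : (0 : ℝ) ∈ Icc (0 : ℝ) 1 := by simp
  have hmid : ∀ s ∈ Icc (0 : ℝ) 1, q₁ + (q₂ + T - q₁) * s ∈ Icc b (T - a) := fun s hs' => by
    rw [show q₁ + (q₂ + T - q₁) * s = (1 - s) * q₁ + s * (q₂ + T) by ring]
    exact convexComb_mem (convex_Icc _ _) hq₁ hq₂ hs'
  have hmid₀ : ∀ s ∈ Icc (0 : ℝ) 1, b + (T - a - b) * s ∈ Icc b (T - a) := fun s hs' => by
    constructor <;> nlinarith [hs'.1, hs'.2]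
  have stepA : PathHom O (statePath f A B d c τ σ) (buildPath f (fun s => C (q₁ * s))
      (fun s => C (q₁ + (q₂ + T - q₁) * s)) (fun s => C (q₂ * s))) := by
    have key := ho.line.pathHom_buildPath (c := fun s => clampTo b s)
      (m := fun s => b + (T - a - b) * s) (d := fun s => clampTo (-a) s) (c' := fun s => q₁ * s)
      (m' := fun s => q₁ + (q₂ + T - q₁) * s) (d' := fun s => q₂ * s) (hcl b) (by fun_prop)
      (hcl (-a)) (by fun_prop) (by fun_prop) (by fun_prop)
      (by rw [clampTo_one (by rw [abs_of_pos hb]; linarith)]; ring)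
      (by rw [clampTo_one (by rw [abs_neg, abs_of_pos ha]; linarith)]; ring)
      (by ring) (by ring) (clampTo_zero b) (by simp) (clampTo_zero (-a)) (by simp)
      (fun s hs' => ?_) (fun s hs' => ?_) (fun s hs' => ?_) (fun s hs' => ?_) (fun s hs' => ?_)
      (fun s hs' => ?_)
    · rw [← hOC] at key
      refine key.congr (buildPath_congr (fun s hs' => ?_) (fun s hs' => ?_) fun s hs' => ?_)
        fun _ _ => rfl
      · rcases hs'.1.eq_or_lt with rfl | h1
        · simp only [clampTo_zero, ho.zero_agree, mul_zero]
        · have := clampTo_mem hb h1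
          rw [ho.agree _ ⟨by linarith, this.2⟩, hτ, clampTo_sign_mul ho.sign hs'.1]
      · rw [hC _ (hmid₀ s hs'), hcd]
        congr 1; ring
      · rcases hs'.1.eq_or_lt with rfl | h1
        · simp only [clampTo_zero, ho.zero_agree, mul_zero]
        · have := clampTo_mem_of_neg (neg_lt_zero.2 ha) h1
          rw [ho.agree _ ⟨this.1, by linarith⟩, hσ, clampTo_sign_mul ho.sign hs'.1]
    · have := clampTo_mem hb hs'.1
      exact ⟨this.1, by linarith⟩
    · constructor <;> nlinarith [hs'.1, hs'.2, hq₁.1, hq₁.2]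
    · have := hmid₀ s hs'
      exact ⟨by linarith [this.1], by linarith [this.2]⟩
    · have := hmid s hs'
      exact ⟨by linarith [this.1], by linarith [this.2]⟩
    · have := clampTo_mem_of_neg (neg_lt_zero.2 ha) hs'.1
      exact ⟨by linarith, this.2⟩
    · constructor <;> nlinarith [hs'.1, hs'.2, hq₂.1, hq₂.2]
  have hmO : ∀ s ∈ Icc (0 : ℝ) 1, C (q₁ + (q₂ + T - q₁) * s) ∉ O := fun s hs' => by
    have := hmid s hs'
    rw [hOC]
    exact ho.line.notMem (Or.inl ⟨by linarith [this.1], by linarith [this.2]⟩)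
  have hmc : Continuous fun s => C (q₁ + (q₂ + T - q₁) * s) := by fun_prop
  have hfe₂ : C (q₂ + T) = f (B (ε * u₂)) := by rw [← ho.line.equi, e₂]
  have stepB := PathHom.of_startHom f.continuous hfO hom₁ hom₂ hmc (by simp) (by
    rw [mul_one, mul_one, add_sub_cancel, ho.line.equi]) hmO
  obtain ⟨hl₁, hl₂⟩ := abs_lt_one hδ hu₁ hu₂ hu hle
  have hn : ∀ u : ℝ, δ ≤ |u| → ε * u ≠ 0 := fun u h1 =>
    mul_ne_zero hε0 (abs_pos.1 (hδ.trans_le h1))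
  have stepC := PathHom.of_startHom f.continuous hfO
    (h.startHom_clampTo (hn u₁ hu₁) (by rwa [habs])) (h.startHom_clampTo (hn u₂ hu₂) (by rwa [habs]))
    hmc (by simp [e₁]) (by rw [mul_one, mul_one, add_sub_cancel, hfe₂]) hmO
  refine stepA.trans (stepB.trans (stepC.congr (buildPath_congr (fun s _ => ?_) (fun _ _ => rfl)
    fun s _ => ?_) (buildPath_congr (fun _ _ => rfl) (fun s hs' => ?_) fun _ _ => rfl)))
  · rw [mul_assoc]
  · rw [mul_assoc]
  · rw [hC _ (hmid s hs')]
    congr 1; ring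

end LinePair

/-- The line `A` meets `B` at the ends of a segment of `B` that contains the common part, and the
complementary piece of `A` avoids that segment. -/
structure IsExtension (T a b : ℝ) (A B : ℝ → ℂ) (O : Set ℂ) (q₁ q₂ u₁ u₂ : ℝ) : Prop where
  left_mem : q₁ ∈ Icc b (T - a)
  right_mem : q₂ + T ∈ Icc b (T - a)
  eq_left : A q₁ = B u₁
  eq_right : A q₂ = B u₂
  hom_left : StartHom O (fun x => A (q₁ * x)) (fun x => B (u₁ * x))
  hom_right : StartHom O (fun x => A (q₂ * x)) (fun x => B (u₂ * x))
  le_left : (b ≤ u₁ ∧ u₂ ≤ -a) ∨ (u₁ ≤ -a ∧ b ≤ u₂)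
  lt_abs : a + b < |u₁ - u₂|
  abs_le : |u₁ - u₂| ≤ 1
  avoid : ∀ s v, (s - q₁) * (s - (q₂ + T)) < 0 → (v - u₁) * (v - u₂) < 0 →
    A s ≠ B v ∧ A (s - T) ≠ B v

theorem IsExtension.symm {T a b : ℝ} {A B : ℝ → ℂ} {O : Set ℂ} {q₁ q₂ u₁ u₂ : ℝ}
    (h : IsExtension T b a (fun s => A (-s)) (fun s => B (-s)) O q₁ q₂ u₁ u₂) :
    IsExtension T a b A B O (-q₂) (-q₁) (-u₂) (-u₁) where
  left_mem := ⟨by linarith [h.right_mem.2], by linarith [h.right_mem.1]⟩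
  right_mem := ⟨by linarith [h.left_mem.2], by linarith [h.left_mem.1]⟩
  eq_left := h.eq_right
  eq_right := h.eq_left
  hom_left := by simpa only [neg_mul] using h.hom_right
  hom_right := by simpa only [neg_mul] using h.hom_left
  le_left := by
    rcases h.le_left with h | h
    · exact Or.inl ⟨by linarith, by linarith⟩
    · exact Or.inr ⟨by linarith, by linarith⟩
  lt_abs := by
    rw [show -u₂ - -u₁ = u₁ - u₂ by ring]; linarith [h.lt_abs]
  abs_le := by
    rw [show -u₂ - -u₁ = u₁ - u₂ by ring]; exact h.abs_le
  avoid s v hs hv := by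
    have := h.avoid (T - s) (-v) (by nlinarith) (by nlinarith)
    simp only [neg_neg, neg_sub] at this
    rw [show T - (T - s) = s by ring] at this
    exact ⟨this.2, this.1⟩

namespace Overlap

variable {f : ℂ ≃ₜ ℂ} {T ε a b : ℝ} {A B : ℝ → ℂ} {O : Set ℂ}

theorem startHom_neg (h : Overlap f T ε a b A B O) :
    StartHom O (fun x => A (-a * x)) (fun x => B (-a * x)) := by
  have ha := h.a_pos
  have hb := h.b_pos
  have hT := h.ab_lt_period
  have key := h.line.startHom (c := fun x => -a * x) (c' := fun x => -a * x) (by fun_prop)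
    (by fun_prop) (by simp) (by simp) rfl (Or.inr fun s hs => by
      have : -a * s ∈ Ioo (-T) 0 := by constructor <;> nlinarith [hs.1, hs.2]
      exact ⟨this, this⟩)
  rw [← h.line.range_eq, ← h.orbit] at key
  exact key.congr (fun _ _ => rfl) fun s hs =>
    (h.agree _ ⟨by nlinarith [hs.1, hs.2], by nlinarith [hs.1, hs.2]⟩).symm

theorem ne_of_mem (h : Overlap f T ε a b A B O) {s v : ℝ} (hv : v ∈ Icc (-a) b)
    (hs : s ∉ Icc (-a) b) : A s ≠ B v := by
  rw [← h.agree v hv]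
  intro h1
  rw [h.line.inj h1] at hs
  exact hs hv

theorem isExtension_of_forward (h : Overlap f T ε a b A B O) {u q : ℝ} (hu : u ∈ Ioc b (1 - a))
    (hq : A q = B u) (hom : StartHom O (fun x => A (q * x)) (fun x => B (u * x)))
    (hE : (q ∈ Ioo b (T - a) ∧
      ∀ s ∈ Ioo q (T - a) ∪ Ioo (b - T) (-a), ∀ v ∈ Icc b u, A s ≠ B v) ∨ q = T - a) :
    IsExtension T a b A B O q (-a) u (-a) := by
  have ha := h.a_pos
  have hb := h.b_pos
  have hT := h.ab_lt_period
  have hqT : b < q ∧ q ≤ T - a := by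
    rcases hE with hE | rfl
    · exact ⟨hE.1.1, hE.1.2.le⟩
    · exact ⟨by linarith, le_rfl⟩
  refine ⟨⟨hqT.1.le, hqT.2⟩, ⟨by linarith, by linarith⟩, hq,
    h.agree _ ⟨le_rfl, by linarith⟩, hom, h.startHom_neg, Or.inl ⟨hu.1.le, le_rfl⟩, ?_, ?_, ?_⟩
  · rw [abs_of_pos (by linarith [hu.1])]; linarith [hu.1]
  · rw [abs_of_pos (by linarith [hu.1])]; linarith [hu.2]
  · intro s v hs hv
    have hs' := mem_Ioo_of_mul_neg (by linarith) hs
    rw [mul_comm] at hv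
    have hv' := mem_Ioo_of_mul_neg (by linarith [hu.1]) hv
    rcases hE with ⟨-, hE⟩ | rfl
    · rcases le_or_gt v b with h1 | h1
      · exact ⟨h.ne_of_mem ⟨hv'.1.le, h1⟩ fun h2 => by linarith [h2.2, hs'.1],
          h.ne_of_mem ⟨hv'.1.le, h1⟩ fun h2 => by linarith [h2.1, hs'.2]⟩
      · exact ⟨hE _ (Or.inl ⟨hs'.1, by linarith [hs'.2]⟩) _ ⟨h1.le, hv'.2.le⟩,
          hE _ (Or.inr ⟨by linarith [hs'.1], by linarith [hs'.2]⟩) _ ⟨h1.le, hv'.2.le⟩⟩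
    · linarith [hs'.1, hs'.2]

theorem exists_isExtension (h : Overlap f T ε a b A B O) :
    ∃ q₁ q₂ u₁ u₂, IsExtension T a b A B O q₁ q₂ u₁ u₂ := by
  have ha := h.a_pos
  have hb := h.b_pos
  have hT := h.ab_lt_period
  obtain ⟨u, hu, q, hq, hom, hE | hF | hW⟩ := h.exists_forward
  · exact ⟨_, _, _, _, h.isExtension_of_forward hu hq hom (Or.inl hE.2)⟩
  · exact ⟨_, _, _, _, h.isExtension_of_forward hu hq hom (Or.inr hF.2.1)⟩
  obtain ⟨u', hu', q', hq', hom', hE' | hF' | hW'⟩ := h.symm.exists_forward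
  · exact ⟨_, _, _, _, (h.symm.isExtension_of_forward hu' hq' hom' (Or.inl hE'.2)).symm⟩
  · exact ⟨_, _, _, _, (h.symm.isExtension_of_forward hu' hq' hom' (Or.inr hF'.2.1)).symm⟩
  obtain ⟨hu1, hqm, hWa⟩ := hW
  obtain ⟨hu1', hqm', hWa'⟩ := hW'
  have hle : u + u' ≤ 1 := by
    by_contra! hlt
    have hmem : 1 - u' ∈ Ioo b u := ⟨by linarith, by linarith⟩
    rcases h.sign with rfl | rfl
    · refine hWa (-q' + T) ⟨by linarith [hqm'.2], by linarith [hqm'.1]⟩ _ hmem ?_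
      rw [← h.line.equi, hq', h.equiB]
      congr 1; ring
    · refine hWa (-q' - T) ⟨by linarith [hqm'.2], by linarith [hqm'.1]⟩ _ hmem (f.injective ?_)
      rw [h.line.equi, h.equiB, sub_add_cancel, hq']
      congr 1; ring
  refine ⟨-q', q, -u', u, ⟨by linarith [hqm'.2], by linarith [hqm'.1]⟩,
    ⟨by linarith [hqm.1], by linarith [hqm.2]⟩, hq', hq, by simpa only [neg_mul] using hom', hom,
    Or.inr ⟨by linarith [hu'.1], hu.1.le⟩, ?_, ?_, ?_⟩
  · rw [abs_of_neg (by linarith [hu.1, hu'.1])]; linarith [hu.1, hu'.1]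
  · rw [abs_of_neg (by linarith [hu.1, hu'.1])]; linarith [hu.1, hu'.1]
  intro s v hs hv
  have hv' := mem_Ioo_of_mul_neg (by linarith [hu.1, hu'.1]) hv
  have hs' : s ∈ Ioo b (T - a) := by
    rcases le_total (-q') (q + T) with h1 | h1
    · have := mem_Ioo_of_mul_neg h1 hs
      exact ⟨by linarith [this.1, hqm'.2], by linarith [this.2, hqm.2]⟩
    · rw [mul_comm] at hs
      have := mem_Ioo_of_mul_neg h1 hs
      exact ⟨by linarith [this.1, hqm.1], by linarith [this.2, hqm'.1]⟩
  have hA1 : s ∉ Icc (-a) b := fun h2 => by linarith [h2.2, hs'.1]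
  have hA2 : s - T ∉ Icc (-a) b := fun h2 => by linarith [h2.1, hs'.2]
  have hw1 : s ∈ Icc (-(4 * T)) (4 * T) := ⟨by linarith [hs'.1], by linarith [hs'.2]⟩
  have hw2 : s - T ∈ Icc (-(4 * T)) (4 * T) := ⟨by linarith [hs'.1], by linarith [hs'.2]⟩
  have hneg : ∀ s, s ∈ Icc (-(4 * T)) (4 * T) → v < -a → A s ≠ B v := fun s hs2 hva => by
    have := hWa' (-s) ⟨by linarith [hs2.2], by linarith [hs2.1]⟩ (-v)
      ⟨by linarith, by linarith [hv'.1]⟩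
    simpa only [neg_neg] using this
  rcases le_or_gt v b with h1 | h1
  · rcases lt_or_ge v (-a) with h2 | h2
    · exact ⟨hneg s hw1 h2, hneg _ hw2 h2⟩
    · exact ⟨h.ne_of_mem ⟨h2, h1⟩ hA1, h.ne_of_mem ⟨h2, h1⟩ hA2⟩
  · exact ⟨hWa s hw1 v ⟨h1, hv'.2⟩, hWa _ hw2 v ⟨h1, hv'.2⟩⟩

end Overlap

theorem LinePair.exists_longer {f : ℂ ≃ₜ ℂ} {δ : ℝ} {A B : ℝ → ℂ} {O : Set ℂ} {d c τ σ : ℝ}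
    (h : LinePair f δ A B O) (hs : IsState δ A B d c τ σ) (hlt : |τ - σ| < 1) :
    ∃ d' c' τ' σ', IsState δ A B d' c' τ' σ' ∧ |τ - σ| < |τ' - σ'| ∧
      PathHom O (statePath f A B d c τ σ) (statePath f A B d' c' τ' σ') := by
  obtain ⟨ε, a, b, η, T, C, hη, ha, hb, hτ, hσ, hab, hcd, ho, hC⟩ := h.exists_overlap hs hlt
  obtain ⟨q₁, q₂, u₁, u₂, hx⟩ := ho.exists_isExtension
  have hδ := h.pos
  have hu : δ ≤ |u₁| ∧ δ ≤ |u₂| ∧ u₁ * u₂ ≤ 0 := by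
    rcases hx.le_left with h1 | h1
    · rw [abs_of_pos (by linarith), abs_of_neg (by linarith)]
      exact ⟨by linarith, by linarith, by nlinarith⟩
    · rw [abs_of_neg (by linarith), abs_of_pos (by linarith)]
      exact ⟨by linarith, by linarith, by nlinarith⟩
  obtain ⟨h1, h2⟩ := h.extend hs hη hτ hσ hcd ho hC hx.left_mem hx.right_mem hx.eq_left hx.eq_right
    hx.hom_left hx.hom_right hu.1 hu.2.1 hu.2.2 hx.abs_le hx.avoid
  refine ⟨_, _, _, _, h1, ?_, h2⟩
  have hε1 : |ε| = 1 := by rcases ho.sign with h | h <;> rw [h] <;> simp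
  rw [hab, ← mul_sub, abs_mul, hε1, one_mul]
  exact hx.lt_abs

namespace LinePair

variable {f : ℂ ≃ₜ ℂ} {δ : ℝ} {A B : ℝ → ℂ} {O : Set ℂ} {d c τ σ : ℝ}

theorem isCompact_states (h : LinePair f δ A B O) :
    IsCompact {p : ℝ × ℝ × ℝ × ℝ | IsState δ A B p.1 p.2.1 p.2.2.1 p.2.2.2} := by
  have hA := h.lineA.cont
  have hB := h.lineB.cont
  have hcomp : IsCompact (Icc (0 : ℝ) 1 ×ˢ Icc (0 : ℝ) 1 ×ˢ Icc (-1 : ℝ) 1 ×ˢ Icc (-1 : ℝ) 1) :=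
    isCompact_Icc.prod (isCompact_Icc.prod (isCompact_Icc.prod isCompact_Icc))
  refine hcomp.of_isClosed_subset ?_ fun p hp => ?_
  · have e : {p : ℝ × ℝ × ℝ × ℝ | IsState δ A B p.1 p.2.1 p.2.2.1 p.2.2.2} =
        {p : ℝ × ℝ × ℝ × ℝ | ((δ ≤ p.1 ∧ p.1 ≤ 1 - δ) ∧ (δ ≤ p.2.1 ∧ p.2.1 ≤ 1 - δ)) ∧
          ((δ ≤ |p.2.2.1| ∧ δ ≤ |p.2.2.2|) ∧ (p.2.2.1 * p.2.2.2 ≤ 0 ∧ |p.2.2.1 - p.2.2.2| ≤ 1)) ∧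
          (A p.1 = B p.2.2.1 ∧ A p.2.1 = B (p.2.2.2 + 1)) ∧
          ∀ r v, (r - p.1) * (r - p.2.1) < 0 → (v - p.2.2.1) * (v - p.2.2.2) < 0 →
            A r ≠ B v ∧ A r ≠ B (v + 1)} := by
      ext p
      exact ⟨fun h => ⟨⟨h.1, h.2⟩, ⟨⟨h.3, h.4⟩, h.5, h.6⟩, ⟨h.7, h.8⟩, h.9⟩,
        fun h => ⟨h.1.1, h.1.2, h.2.1.1.1, h.2.1.1.2, h.2.1.2.1, h.2.1.2.2, h.2.2.1.1, h.2.2.1.2,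
          h.2.2.2⟩⟩
    rw [e]
    simp only [ofPred_and]
    have hle : ∀ {u v : ℝ × ℝ × ℝ × ℝ → ℝ}, Continuous u → Continuous v →
        IsClosed {p | u p ≤ v p} := fun hu hv => isClosed_le hu hv
    have heq : ∀ {u v : ℝ × ℝ × ℝ × ℝ → ℂ}, Continuous u → Continuous v →
        IsClosed {p | u p = v p} := fun hu hv => isClosed_eq hu hv
    refine IsClosed.inter (IsClosed.inter (IsClosed.inter ?_ ?_) (IsClosed.inter ?_ ?_))
      (IsClosed.inter (IsClosed.inter (IsClosed.inter ?_ ?_) (IsClosed.inter ?_ ?_))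
      (IsClosed.inter (IsClosed.inter ?_ ?_) ?_))
    iterate 8 exact hle (by fun_prop) (by fun_prop)
    iterate 2 exact heq (by fun_prop) (by fun_prop)
    simp only [ofPred_forall]
    refine isClosed_iInter fun r => isClosed_iInter fun v => ?_
    exact isClosed_imp (isOpen_lt (by fun_prop) (by fun_prop))
      (isClosed_imp (isOpen_lt (by fun_prop) (by fun_prop)) isClosed_const)
  · have hp' : IsState δ A B p.1 p.2.1 p.2.2.1 p.2.2.2 := hp
    obtain ⟨h1, h2⟩ := abs_lt_one h.pos hp'.le_abs_τ hp'.le_abs_σ hp'.opposite hp'.abs_sub_le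
    have hδ := h.pos
    have h3 := hp'.d_mem
    have h4 := hp'.c_mem
    rw [abs_lt] at h1 h2
    exact ⟨⟨by linarith [h3.1], by linarith [h3.2]⟩, ⟨by linarith [h4.1], by linarith [h4.2]⟩,
      ⟨h1.1.le, h1.2.le⟩, h2.1.le, h2.2.le⟩

theorem map_notMem (h : LinePair f δ A B O) {z : ℂ} (hz : z ∉ O) : f z ∉ O := by
  rw [h.orbit, ← h.lineA.range_eq] at hz ⊢
  exact h.lineA.map_notMem hz

theorem clampTo_notMem (h : LinePair f δ A B O) (hτ : δ ≤ |τ|) (hτ1 : |τ| < 1) {s : ℝ}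
    (hs : s ∈ Ioc (0 : ℝ) 1) : B (clampTo τ s) ∉ O := by
  rw [h.orbit_B, ← h.lineB.range_eq]
  apply h.lineB.notMem
  rw [abs_lt] at hτ1
  rcases lt_or_gt_of_ne (abs_pos.1 (h.pos.trans_le hτ)) with h0 | h0
  · have := clampTo_mem_of_neg h0 hs.1
    exact Or.inr ⟨by linarith, this.2⟩
  · have := clampTo_mem h0 hs.1
    exact Or.inl ⟨this.1, by linarith⟩

theorem statePath_notMem (h : LinePair f δ A B O) (hs : IsState δ A B d c τ σ) {s : ℝ}
    (hs' : s ∈ Ioo (0 : ℝ) 1) : statePath f A B d c τ σ s ∉ O := by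
  obtain ⟨h1, h2⟩ := abs_lt_one h.pos hs.le_abs_τ hs.le_abs_σ hs.opposite hs.abs_sub_le
  refine buildPath_notMem (fun z => h.map_notMem) (fun x hx => h.clampTo_notMem hs.le_abs_τ h1 hx)
    (fun x hx => ?_) (fun x hx => h.clampTo_notMem hs.le_abs_σ h2 hx) hs'
  rw [h.orbit, ← h.lineA.range_eq]
  apply h.lineA.notMem
  have hδ := h.pos
  have := convexComb_mem (convex_Icc _ _) hs.d_mem hs.c_mem hx
  rw [show d + (c - d) * x = (1 - x) * d + x * c by ring]
  exact Or.inl ⟨by linarith [this.1], by linarith [this.2]⟩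

theorem continuous_statePath (h : LinePair f δ A B O) :
    Continuous fun p : {p : ℝ × ℝ × ℝ × ℝ | IsState δ A B p.1 p.2.1 p.2.2.1 p.2.2.2} × ℝ =>
      statePath f A B p.1.1.1 p.1.1.2.1 p.1.1.2.2.1 p.1.1.2.2.2 p.2 := by
  have hA := h.lineA.cont
  have hB := h.lineB.cont
  have habs : ∀ p : {p : ℝ × ℝ × ℝ × ℝ | IsState δ A B p.1 p.2.1 p.2.2.1 p.2.2.2},
      |p.1.2.2.1| < 1 ∧ |p.1.2.2.2| < 1 := fun p =>
    abs_lt_one h.pos p.2.le_abs_τ p.2.le_abs_σ p.2.opposite p.2.abs_sub_le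
  refine continuous_buildPath (f := f)
    (c := fun p : {p : ℝ × ℝ × ℝ × ℝ | IsState δ A B p.1 p.2.1 p.2.2.1 p.2.2.2} =>
      fun x => B (clampTo p.1.2.2.1 x))
    (m := fun p x => A (p.1.1 + (p.1.2.1 - p.1.1) * x))
    (d := fun p x => B (clampTo p.1.2.2.2 x)) f.continuous ?_ (by fun_prop) ?_ ?_ ?_
  · exact hB.comp (continuous_clampTo.comp (by fun_prop : Continuous fun p :
      {p : ℝ × ℝ × ℝ × ℝ | IsState δ A B p.1 p.2.1 p.2.2.1 p.2.2.2} × ℝ => (p.1.1.2.2.1, p.2)))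
  · exact hB.comp (continuous_clampTo.comp (by fun_prop : Continuous fun p :
      {p : ℝ × ℝ × ℝ × ℝ | IsState δ A B p.1 p.2.1 p.2.2.1 p.2.2.2} × ℝ => (p.1.1.2.2.2, p.2)))
  · intro p
    simp only [clampTo_one (habs p).1.le, mul_zero, add_zero]
    exact p.2.eq_d.symm
  · intro p
    simp only [clampTo_one (habs p).2.le, mul_one, add_sub_cancel]
    rw [h.lineB.equi]
    exact p.2.eq_c

theorem eventually_pathHom (h : LinePair f δ A B O)
    (p : {p : ℝ × ℝ × ℝ × ℝ | IsState δ A B p.1 p.2.1 p.2.2.1 p.2.2.2}) :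
    ∀ᶠ q in 𝓝 p, PathHom O (statePath f A B p.1.1 p.1.2.1 p.1.2.2.1 p.1.2.2.2)
      (statePath f A B q.1.1 q.1.2.1 q.1.2.2.1 q.1.2.2.2) := by
  have hδ := h.pos
  have hδ2 := h.lt_half
  set F : {p : ℝ × ℝ × ℝ × ℝ | IsState δ A B p.1 p.2.1 p.2.2.1 p.2.2.2} → ℝ → ℂ := fun q =>
    statePath f A B q.1.1 q.1.2.1 q.1.2.2.1 q.1.2.2.2 with hF
  have hFc : Continuous fun z : {p : ℝ × ℝ × ℝ × ℝ | IsState δ A B p.1 p.2.1 p.2.2.1 p.2.2.2} × ℝ =>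
    F z.1 z.2 := h.continuous_statePath
  have hFc' : ∀ q, Continuous (F q) := fun q => hFc.comp (by fun_prop : Continuous fun s => (q, s))
  have hO : IsClosed O := isClosed_of_finite_inter_closedBall h.fin
  have hmid := (isCompact_Icc (a := (0 : ℝ)) (b := 1)).prod
    (isCompact_Icc (a := δ / 3) (b := 1 - δ / 3)) |>.eventually_forall_of_forall_eventually
    (x₀ := p) (P := fun q z => (1 - z.1 : ℂ) * F p z.2 + z.1 * F q z.2 ∉ O) (by
      rintro ⟨t, s⟩ ⟨-, hs⟩
      have hc1 : Continuous fun z : {p : ℝ × ℝ × ℝ × ℝ | IsState δ A B p.1 p.2.1 p.2.2.1 p.2.2.2} ×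
          ℝ × ℝ => F z.1 z.2.2 := hFc.comp (by fun_prop : Continuous fun z :
            {p : ℝ × ℝ × ℝ × ℝ | IsState δ A B p.1 p.2.1 p.2.2.1 p.2.2.2} × ℝ × ℝ => (z.1, z.2.2))
      have hc : Continuous fun z : {p : ℝ × ℝ × ℝ × ℝ | IsState δ A B p.1 p.2.1 p.2.2.1 p.2.2.2} ×
          ℝ × ℝ => (1 - z.2.1 : ℂ) * F p z.2.2 + z.2.1 * F z.1 z.2.2 := by
        have := hFc' p
        fun_prop
      refine hc.continuousAt.eventually_mem (hO.isOpen_compl.mem_nhds ?_)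
      simp only [mem_compl_iff]
      rw [show (1 - t : ℂ) * F p s + t * F p s = F p s by ring]
      exact h.statePath_notMem p.2 ⟨by linarith [hs.1], by linarith [hs.2]⟩)
  have h1 : ∀ᶠ q : {p : ℝ × ℝ × ℝ × ℝ | IsState δ A B p.1 p.2.1 p.2.2.1 p.2.2.2} in 𝓝 p,
      |q.1.2.2.1 - p.1.2.2.1| < δ :=
    (by fun_prop : Continuous fun q : {p : ℝ × ℝ × ℝ × ℝ | IsState δ A B p.1 p.2.1 p.2.2.1 p.2.2.2} =>
      |q.1.2.2.1 - p.1.2.2.1|).continuousAt.eventually_lt continuousAt_const (by simpa using hδ)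
  have h2 : ∀ᶠ q : {p : ℝ × ℝ × ℝ × ℝ | IsState δ A B p.1 p.2.1 p.2.2.1 p.2.2.2} in 𝓝 p,
      |q.1.2.2.2 - p.1.2.2.2| < δ :=
    (by fun_prop : Continuous fun q : {p : ℝ × ℝ × ℝ × ℝ | IsState δ A B p.1 p.2.1 p.2.2.1 p.2.2.2} =>
      |q.1.2.2.2 - p.1.2.2.2|).continuousAt.eventually_lt continuousAt_const (by simpa using hδ)
  filter_upwards [hmid, h1, h2] with q hq hq1 hq2
  have hlow : ∀ s ∈ Icc (0 : ℝ) (δ / 3), F q s = F p s := fun s hs => by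
    have e : s ≤ 1 / 3 := by linarith [hs.2]
    simp only [hF, statePath, buildPath, if_pos e]
    rw [clampTo_congr p.2.le_abs_τ q.2.le_abs_τ hq1 (by linarith [hs.1]) (by linarith [hs.2])]
  have hhigh : ∀ s ∈ Icc (1 - δ / 3) 1, F q s = F p s := fun s hs => by
    have e : ¬ s ≤ 1 / 3 := by linarith [hs.1]
    have e' : ¬ s ≤ 2 / 3 := by linarith [hs.1]
    simp only [hF, statePath, buildPath, if_neg e, if_neg e']
    rw [clampTo_congr p.2.le_abs_σ q.2.le_abs_σ hq2 (by linarith [hs.2]) (by linarith [hs.1])]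
  refine PathHom.of_segment (hFc' p) (hFc' q) (hlow 0 ⟨le_rfl, by linarith⟩).symm
    (hhigh 1 ⟨by linarith, le_rfl⟩).symm fun t ht s hs => ?_
  have hsame : F q s = F p s → (1 - t : ℂ) * F p s + t * F q s ∉ O := fun e => by
    rw [e, show (1 - t : ℂ) * F p s + t * F p s = F p s by ring]
    exact h.statePath_notMem p.2 hs
  rcases le_or_gt s (δ / 3) with h3 | h3
  · exact hsame (hlow s ⟨hs.1.le, h3⟩)
  rcases le_or_gt (1 - δ / 3) s with h4 | h4
  · exact hsame (hhigh s ⟨h4, hs.2.le⟩)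
  · exact hq (t, s) ⟨ht, h3.le, h4.le⟩

theorem isState_initial (h : LinePair f δ A B O) : IsState δ A B δ (1 - δ) δ (-δ) := by
  have hδ := h.pos
  have hδ2 := h.lt_half
  have hB1 : ∀ v ∈ Icc (-δ) δ, B (v + 1) = A (v + 1) := fun v hv => by
    rw [← h.lineB.equi, ← h.agree v hv, h.lineA.equi]
  refine ⟨⟨le_rfl, by linarith⟩, ⟨by linarith, le_rfl⟩, le_abs_self δ, by rw [abs_neg]; exact le_abs_self δ,
    by nlinarith, by rw [abs_of_pos (by linarith)]; linarith, h.agree _ ⟨by linarith, le_rfl⟩, ?_, ?_⟩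
  · rw [hB1 _ ⟨le_rfl, by linarith⟩]
    congr 1; ring
  · intro r v hr hv
    have hr' := mem_Ioo_of_mul_neg (by linarith) hr
    rw [mul_comm] at hv
    have hv' := mem_Ioo_of_mul_neg (by linarith) hv
    rw [hB1 _ ⟨hv'.1.le, hv'.2.le⟩, ← h.agree _ ⟨hv'.1.le, hv'.2.le⟩]
    refine ⟨fun e => ?_, fun e => ?_⟩ <;> have := h.lineA.inj e <;>
      linarith [hr'.1, hr'.2, hv'.1, hv'.2]

theorem pathHom_initial (h : LinePair f δ A B O) :
    PathHom O (fun s => A (1 * s)) (statePath f A B δ (1 - δ) δ (-δ)) := by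
  have hδ := h.pos
  have hδ2 := h.lt_half
  have hcl : ∀ τ, Continuous fun x => clampTo τ x := fun τ =>
    continuous_clampTo.comp (f := fun x : ℝ => (τ, x)) (by fun_prop)
  have hδ1 : |δ| ≤ 1 := by rw [abs_of_pos hδ]; linarith
  have key := h.lineA.pathHom_buildPath_line (c := fun s => clampTo δ s)
    (m := fun s => δ + (1 - δ - δ) * s) (d := fun s => clampTo (-δ) s) (hcl δ) (by fun_prop)
    (hcl (-δ)) (by rw [clampTo_one hδ1]; ring)
    (by rw [clampTo_one (by rwa [abs_neg])]; ring) (clampTo_zero _) (clampTo_zero _)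
    (fun s hs => by
      have := clampTo_mem hδ hs.1
      exact ⟨this.1, by linarith⟩)
    (fun s hs => by constructor <;> nlinarith [hs.1, hs.2])
    (fun s hs => by
      have := clampTo_mem_of_neg (neg_lt_zero.2 hδ) hs.1
      exact ⟨by linarith, this.2⟩)
  rw [h.lineA.range_eq, ← h.orbit] at key
  refine key.symm.congr (fun _ _ => rfl) (buildPath_congr (fun s hs => ?_) (fun s _ => rfl)
    fun s hs => ?_)
  · rcases hs.1.eq_or_lt with rfl | h1
    · simp only [clampTo_zero]; exact h.zero_agree.symm
    · have := clampTo_mem hδ h1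
      exact (h.agree _ ⟨by linarith, this.2⟩).symm
  · rcases hs.1.eq_or_lt with rfl | h1
    · simp only [clampTo_zero]; exact h.zero_agree.symm
    · have := clampTo_mem_of_neg (neg_lt_zero.2 hδ) h1
      exact (h.agree _ ⟨this.1, by linarith⟩).symm

theorem pathHom_final (h : LinePair f δ A B O) (hs : IsState δ A B d c τ σ) (he : |τ - σ| = 1) :
    PathHom O (statePath f A B d c τ σ) (fun s => B (1 * s)) := by
  have hδ := h.pos
  have hτσ : τ - σ = 1 := by
    rcases eq_or_eq_neg_of_abs_eq he with h1 | h1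
    · exact h1
    · exfalso
      have h2 : A c = A (d + 1 + 1) := by
        rw [hs.eq_c, ← h.lineA.equi, ← h.lineA.equi, hs.eq_d, h.lineB.equi, h.lineB.equi]
        congr 1; linarith
      have := h.lineA.inj h2
      linarith [hs.d_mem.1, hs.c_mem.2]
  have hcd : c = d := h.lineA.inj (by rw [hs.eq_c, hs.eq_d]; congr 1; linarith)
  obtain ⟨h1, h2⟩ := abs_lt_one hδ hs.le_abs_τ hs.le_abs_σ hs.opposite hs.abs_sub_le
  have hτ0 := abs_pos.1 (hδ.trans_le hs.le_abs_τ)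
  have hσ0 := abs_pos.1 (hδ.trans_le hs.le_abs_σ)
  rw [abs_lt] at h1 h2
  have hτ : 0 < τ := by
    rcases lt_or_gt_of_ne hτ0 with h3 | h3
    · linarith [h2.1]
    · exact h3
  have hσ : σ < 0 := by linarith [h1.2]
  have hcl : ∀ τ, Continuous fun x => clampTo τ x := fun τ =>
    continuous_clampTo.comp (f := fun x : ℝ => (τ, x)) (by fun_prop)
  have key := h.lineB.pathHom_buildPath_line (c := fun s => clampTo τ s)
    (m := fun _ => τ) (d := fun s => clampTo σ s) (hcl τ) (by fun_prop)
    (hcl σ) (clampTo_one (abs_lt.2 h1).le)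
    (by rw [clampTo_one (abs_lt.2 h2).le]; linarith) (clampTo_zero _) (clampTo_zero _)
    (fun s hs => by
      have := clampTo_mem hτ hs.1
      exact ⟨this.1, by linarith⟩)
    (fun s hs => ⟨hτ, h1.2⟩)
    (fun s hs => by
      have := clampTo_mem_of_neg hσ hs.1
      exact ⟨by linarith, this.2⟩)
  rw [h.lineB.range_eq, ← h.orbit_B] at key
  refine key.congr (buildPath_congr (fun s _ => rfl) (fun s _ => ?_) fun s _ => rfl)
    fun s _ => rfl
  simp only [hcd, sub_self, zero_mul, add_zero]
  exact hs.eq_d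

/-- Lines with the same germ at `0` have homotopic fundamental pieces. -/
theorem pathHom (h : LinePair f δ A B O) : PathHom O (fun s => A (1 * s)) (fun s => B (1 * s)) := by
  let K := {p : ℝ × ℝ × ℝ × ℝ | IsState δ A B p.1 p.2.1 p.2.2.1 p.2.2.2}
  have : CompactSpace K := isCompact_iff_compactSpace.1 h.isCompact_states
  let S : Set K := {q | PathHom O (fun s => A (1 * s))
    (statePath f A B q.1.1 q.1.2.1 q.1.2.2.1 q.1.2.2.2)}
  have hS : IsClosed S := by
    rw [← isOpen_compl_iff, isOpen_iff_mem_nhds]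
    intro p hp
    filter_upwards [h.eventually_pathHom p] with q hq hqS
    exact hp (hqS.trans hq.symm)
  obtain ⟨p, hpS, hmax⟩ := hS.isCompact.exists_isMaxOn
    (f := fun q : K => |q.1.2.2.1 - q.1.2.2.2|)
    ⟨⟨(δ, 1 - δ, δ, -δ), h.isState_initial⟩, h.pathHom_initial⟩ (by fun_prop)
  refine PathHom.trans hpS (h.pathHom_final p.2 ?_)
  by_contra hne
  obtain ⟨d', c', τ', σ', hs', hlt, hom⟩ := h.exists_longer p.2 (lt_of_le_of_ne p.2.abs_sub_le hne)
  exact absurd hlt (not_lt.2 (hmax (a := ⟨(d', c', τ', σ'), hs'⟩) (PathHom.trans hpS hom)))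

end LinePair

theorem startHom_of_norm_sub_le {O : Set ℂ} {x₀ : ℂ} {R₀ R₁ : ℝ} {c₁ c₂ : ℝ → ℂ} (hR₀ : 0 < R₀)
    (hR : R₀ < R₁) (hO : ∀ z ∈ O, ‖z - x₀‖ < R₁ → z = x₀) (hc₁ : Continuous c₁)
    (hc₂ : Continuous c₂) (h₁ : c₁ 0 = x₀) (h₂ : c₂ 0 = x₀) (h : c₁ 1 = c₂ 1)
    (hne₁ : ∀ s ∈ Ioc (0 : ℝ) 1, c₁ s ≠ x₀) (hne₂ : ∀ s ∈ Ioc (0 : ℝ) 1, c₂ s ≠ x₀)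
    (hle₁ : ∀ s ∈ Icc (0 : ℝ) 1, ‖c₁ s - x₀‖ ≤ R₀) (hle₂ : ∀ s ∈ Icc (0 : ℝ) 1, ‖c₂ s - x₀‖ ≤ R₀) :
    StartHom O c₁ c₂ := by
  have key : StartHom {(0 : ℂ)} (fun s => c₁ s - x₀) (fun s => c₂ s - x₀) :=
    startHom_point (by fun_prop) (by fun_prop) (by simp [h₁]) (by simp [h₂]) (by simp [h])
      (fun s hs => sub_ne_zero.2 (hne₁ s hs)) (fun s hs => sub_ne_zero.2 (hne₂ s hs))
  have hsub : {z | z + x₀ ∈ O} ∩ Metric.ball 0 R₁ ⊆ {(0 : ℂ)} := by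
    rintro z ⟨hz, hz'⟩
    have := hO _ hz (by simpa using hz')
    simpa using this
  have := (StartHom.of_ball hR₀ hR ((finite_singleton _).subset hsub) (key.mono hsub) hle₁ hle₂).map
    (φ := fun z => z + x₀) (by fun_prop) (O' := O) fun z hz => hz
  simpa using this

theorem exists_last_time {φ : ℝ → ℝ} {κ r : ℝ} (hφ : Continuous φ) (hκ : 0 ≤ κ) (h0 : φ 0 < r)
    (hκr : r < φ κ) : ∃ t ∈ Ioo 0 κ, φ t = r ∧ ∀ s ∈ Ioc t κ, r < φ s := by
  have hcomp : IsCompact (Icc 0 κ ∩ {s | φ s ≤ r}) :=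
    isCompact_Icc.inter_right (isClosed_le hφ continuous_const)
  obtain ⟨t, ⟨ht, htr⟩, hmax⟩ := hcomp.exists_isGreatest ⟨0, ⟨le_rfl, hκ⟩, h0.le⟩
  have hlast : ∀ s ∈ Ioc t κ, r < φ s := fun s hs => by
    by_contra! hle
    exact absurd hs.1 (not_lt.2 (hmax ⟨⟨ht.1.trans hs.1.le, hs.2⟩, hle⟩))
  have htκ : t < κ := lt_of_le_of_ne ht.2 fun h => by
    subst h
    exact absurd hκr (not_lt.2 htr)
  have htr' : φ t = r := by
    obtain ⟨s, hs, hsr⟩ := intermediate_value_Icc htκ.le hφ.continuousOn ⟨htr, hκr.le⟩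
    rcases hs.1.eq_or_lt with rfl | h1
    · exact hsr
    · exact absurd hsr (hlast s ⟨h1, hs.2⟩).ne'
  refine ⟨t, ⟨lt_of_le_of_ne ht.1 fun h => ?_, htκ⟩, htr', hlast⟩
  rw [← h] at htr'
  exact h0.ne htr'

/-- The part of the line `A` outside the segment from `t` to `t'` stays, for a while, outside the
closed disc of radius `r` centred at `x₀`. -/
structure IsExit (A : ℝ → ℂ) (x₀ : ℂ) (R₀ r t t' : ℝ) : Prop where
  neg_mem : t ∈ Ioo (-(1 / 2)) 0
  pos_mem : t' ∈ Ioo 0 (1 / 2)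
  norm_neg : ‖A t - x₀‖ = r
  norm_pos : ‖A t' - x₀‖ = r
  norm_le : ∀ s ∈ Icc t t', ‖A s - x₀‖ ≤ R₀
  far_pos : ∀ s ∈ Ioo t' (1 + t), r < ‖A s - x₀‖
  far_neg : ∀ s ∈ Ioo (t' - 1) t, r < ‖A s - x₀‖

theorem exists_isExit {A : ℝ → ℂ} {x₀ : ℂ} {R₀ : ℝ} (hA : Continuous A)
    (hinj : Function.Injective A) (h0 : A 0 = x₀) (hR₀ : 0 < R₀) :
    ∃ r₁ > 0, ∀ r ∈ Ioc 0 r₁, ∃ t t', IsExit A x₀ R₀ r t t' := by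
  have hφ : Continuous fun s => ‖A s - x₀‖ := by fun_prop
  have hev : ∀ᶠ s in 𝓝 (0 : ℝ), ‖A s - x₀‖ < R₀ :=
    hφ.continuousAt.eventually_lt continuousAt_const (by simpa [h0] using hR₀)
  obtain ⟨κ₀, hκ₀, hball⟩ := Metric.eventually_nhds_iff.1 hev
  set κ := min (κ₀ / 2) (1 / 4) with hκ
  have hκ0 : 0 < κ := lt_min (by linarith) (by norm_num)
  have hκ1 : κ ≤ 1 / 4 := min_le_right _ _
  have hκ2 : κ ≤ κ₀ / 2 := min_le_left _ _
  have hnear : ∀ s ∈ Icc (-κ) κ, ‖A s - x₀‖ ≤ R₀ := fun s hs =>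
    (hball (by rw [dist_zero_right, Real.norm_eq_abs, abs_lt]; constructor <;> linarith [hs.1, hs.2])).le
  have hcomp : IsCompact (Icc (-1) (-κ) ∪ Icc κ 1) := isCompact_Icc.union isCompact_Icc
  obtain ⟨s₀, hs₀, hmin⟩ := hcomp.exists_isMinOn ⟨κ, Or.inr ⟨le_rfl, by linarith⟩⟩ hφ.continuousOn
  have hm : 0 < ‖A s₀ - x₀‖ := by
    rw [norm_pos_iff, sub_ne_zero, ← h0]
    intro h1
    rw [hinj h1] at hs₀
    rcases hs₀ with h2 | h2 <;> linarith [h2.1, h2.2]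
  refine ⟨‖A s₀ - x₀‖ / 2, by positivity, fun r hr => ?_⟩
  have hfar : ∀ s ∈ Icc (-1) (-κ) ∪ Icc κ 1, r < ‖A s - x₀‖ := fun s hs => by
    have : ‖A s₀ - x₀‖ ≤ ‖A s - x₀‖ := hmin hs
    linarith [hr.2]
  obtain ⟨t', ht', htr', hlast'⟩ := exists_last_time hφ hκ0.le (by simpa [h0] using hr.1)
    (hfar κ (Or.inr ⟨le_rfl, by linarith⟩))
  obtain ⟨t, ht, htr, hlast⟩ := exists_last_time (φ := fun s => ‖A (-s) - x₀‖) (by fun_prop)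
    hκ0.le (by simpa [h0] using hr.1) (hfar (-κ) (Or.inl ⟨by linarith, le_rfl⟩))
  refine ⟨-t, t', ⟨by linarith [ht.2], by linarith [ht.1]⟩, ⟨ht'.1, by linarith [ht'.2]⟩, htr, htr',
    fun s hs => hnear s ⟨by linarith [hs.1, ht.2], by linarith [hs.2, ht'.2]⟩, fun s hs => ?_,
    fun s hs => ?_⟩
  · rcases le_or_gt s κ with h1 | h1
    · exact hlast' s ⟨hs.1, h1⟩
    · exact hfar s (Or.inr ⟨h1.le, by linarith [hs.2, ht.1]⟩)
  · rcases le_or_gt (-κ) s with h1 | h1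
    · simpa using hlast (-s) ⟨by linarith [hs.2], by linarith⟩
    · exact hfar s (Or.inl ⟨by linarith [hs.1, ht'.1], h1.le⟩)

/-- Replace the germ of a line inside a small disc by an arbitrary radial germ. -/
theorem Line.exists_replace {f : ℂ ≃ₜ ℂ} (hf : HasIdx f) {A G : ℝ → ℂ} {x₀ : ℂ} {R₀ R₁ r t t' : ℝ}
    (hA : Line f 1 A) (hA0 : A 0 = x₀) (hR₀ : 0 < R₀) (hR : R₀ < R₁)
    (hO : ∀ z ∈ orbitZ f x₀, ‖z - x₀‖ < R₁ → z = x₀) (hx : IsExit A x₀ R₀ r t t') (hr : 0 < r)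
    (hr2 : r < 1 / 2) (hrR : r ≤ R₀) (hdisc : ∀ z, ‖z - x₀‖ ≤ r → r < ‖f z - x₀‖)
    (hG : Continuous G) (hGn : ∀ s, ‖G s - x₀‖ = |s|) (hGinj : Function.Injective G)
    (hGneg : G (-r) = A t) (hGpos : G r = A t') :
    ∃ A₀, Line f 1 A₀ ∧ EqOn A₀ G (Icc (-r) r) ∧
      PathHom (orbitZ f x₀) (fun s => A₀ (1 * s)) (fun s => A (1 * s)) := by
  have hAc := hA.cont
  have ht := hx.neg_mem
  have ht' := hx.pos_mem
  have hden : 0 < 1 - 2 * r := by linarith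
  have hw : 0 < 1 + t - t' := by linarith [ht.1, ht'.2]
  set μ := (1 + t - t') / (1 - 2 * r) with hμ
  have hμ0 : 0 < μ := div_pos hw hden
  have hμe : μ * (1 - 2 * r) = 1 + t - t' := div_mul_cancel₀ _ hden.ne'
  set m : ℝ → ℝ := fun s => t' + μ * (s - r) with hm
  have hmr : m r = t' := by simp [hm]
  have hm1 : m (1 - r) = 1 + t := by
    simp only [hm]
    linear_combination hμe
  have hmlt : ∀ {s s'}, s < s' → m s < m s' := fun h => by
    simp only [hm]
    nlinarith
  have hmc : Continuous m := by fun_prop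
  set c : ℝ → ℂ := fun s => if s ≤ r then G s else A (m s) with hc
  have hclow : ∀ s, s ≤ r → c s = G s := fun s h => if_pos h
  have hchigh : ∀ s, r ≤ s → c s = A (m s) := fun s h => by
    rcases h.eq_or_lt with rfl | h
    · rw [hclow _ le_rfl, hmr, hGpos]
    · exact if_neg (not_le.2 h)
  have hcc : Continuous c := Continuous.if_le hG (by fun_prop) continuous_id continuous_const
    fun s h => by rw [h, hmr, hGpos]
  have hmI : ∀ s ∈ Ioo r (1 - r), m s ∈ Ioo t' (1 + t) := fun s hs => by
    rw [← hmr, ← hm1]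
    exact ⟨hmlt hs.1, hmlt hs.2⟩
  have hGle : ∀ s ∈ Icc (-r) r, ‖G s - x₀‖ ≤ r := fun s hs => by
    rw [hGn, abs_le]; exact hs
  have hmix : ∀ y ∈ Icc (-r) r, ∀ s ∈ Ioc r (1 - r), G y ≠ A (m s) := by
    intro y hy s hs heq
    have h1 := hGle y hy
    rw [heq] at h1
    rcases hs.2.eq_or_lt with rfl | h2
    · rw [hm1, add_comm, ← hA.equi] at h1
      exact absurd (hdisc _ hx.norm_neg.le) (not_lt.2 h1)
    · exact absurd (hx.far_pos _ (hmI s ⟨hs.1, h2⟩)) (not_lt.2 h1)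
  have hinj : InjOn c (Icc (-r) (1 - r)) := by
    have key : ∀ s ∈ Icc (-r) (1 - r), ∀ y ∈ Icc (-r) (1 - r), s < y → c s ≠ c y := by
      intro s hs y hy hsy heq
      rcases le_or_gt y r with h1 | h1
      · rw [hclow _ h1, hclow _ (hsy.le.trans h1)] at heq
        exact hsy.ne (hGinj heq)
      rcases le_or_gt s r with h2 | h2
      · rw [hclow _ h2, hchigh _ h1.le] at heq
        exact hmix s ⟨hs.1, h2⟩ y ⟨h1, hy.2⟩ heq
      · rw [hchigh _ h2.le, hchigh _ h1.le] at heq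
        exact (hmlt hsy).ne (hA.inj heq)
    intro s hs y hy heq
    rcases lt_trichotomy s y with h | h | h
    · exact absurd heq (key s hs y hy h)
    · exact h
    · exact absurd heq.symm (key y hy s hs h)
  have e1 : -r + 1 = 1 - r := by ring
  obtain ⟨A₀, hA₀, hA₀c⟩ := hf.exists_line (T := 1) (s₀ := -r) one_pos hcc.continuousOn
    (by rw [e1, hchigh _ (by linarith), hm1, hclow _ (by linarith), hGneg, hA.equi, add_comm])
    (by rwa [e1]) (by
      rw [e1]
      intro y hy s hs hys heq
      rcases le_or_gt s r with h1 | h1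
      · rw [hclow _ h1, hclow _ (hys.trans h1)] at heq
        have h3 := hdisc _ (hGle y ⟨hy.1.le, hys.trans h1⟩)
        rw [← heq] at h3
        exact absurd (hGle s ⟨hs.1.le, h1⟩) (not_le.2 h3)
      have h4 := hmI s ⟨h1, hs.2⟩
      rw [hchigh _ h1.le] at heq
      rcases le_or_gt y r with h2 | h2
      · rw [hclow _ h2, ← sub_add_cancel (m s) 1, ← hA.equi] at heq
        have h3 := hGle y ⟨hy.1.le, h2⟩
        rw [← f.injective heq] at h3
        exact absurd (hx.far_neg _ ⟨by linarith [h4.1], by linarith [h4.2]⟩) (not_lt.2 h3)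
      · have h5 := hmI y ⟨h2, hy.2⟩
        rw [hchigh _ h2.le, hA.equi] at heq
        linarith [hA.inj heq, h4.1, h4.2, h5.1, h5.2, ht.2, ht'.1])
  rw [e1] at hA₀c
  have hA₀G : EqOn A₀ G (Icc (-r) r) := fun s hs => by
    rw [hA₀c ⟨hs.1, by linarith [hs.2]⟩, hclow _ hs.2]
  have hG0 : G 0 = x₀ := by
    have := hGn 0
    rwa [abs_zero, norm_eq_zero, sub_eq_zero] at this
  have hA₀0 : A₀ 0 = x₀ := by rw [hA₀G ⟨by linarith, hr.le⟩, hG0]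
  refine ⟨A₀, hA₀, hA₀G, ?_⟩
  have k₁ := hA₀.pathHom_buildPath_line (c := fun x => r * x) (m := fun x => r + (1 - 2 * r) * x)
    (d := fun x => -r * x) (by fun_prop) (by fun_prop) (by fun_prop) (by ring) (by ring) (by simp)
    (by simp) (fun x hx => by constructor <;> nlinarith [hx.1, hx.2])
    (fun x hx => by constructor <;> nlinarith [hx.1, hx.2])
    (fun x hx => by constructor <;> nlinarith [hx.1, hx.2])
  have k₂ := hA.pathHom_buildPath_line (c := fun x => t' * x) (m := fun x => t' + (1 + t - t') * x)
    (d := fun x => t * x) (by fun_prop) (by fun_prop) (by fun_prop) (by ring) (by ring) (by simp)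
    (by simp) (fun x hx => by constructor <;> nlinarith [hx.1, hx.2, ht'.1, ht'.2])
    (fun x hx => by constructor <;> nlinarith [hx.1, hx.2, ht'.1, ht'.2, ht.1, ht.2])
    (fun x hx => by constructor <;> nlinarith [hx.1, hx.2, ht.1, ht.2])
  rw [hA₀.range_eq, hA₀0] at k₁
  rw [hA.range_eq, hA0] at k₂
  have hfO : ∀ z, z ∉ orbitZ f x₀ → f z ∉ orbitZ f x₀ := fun z hz => by
    rw [← hA0, ← hA.range_eq] at hz ⊢
    exact hA.map_notMem hz
  have hAne : ∀ s, s ≠ 0 → A s ≠ x₀ := fun s hs h => hs (hA.inj (h.trans hA0.symm))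
  have hGne : ∀ s, s ≠ 0 → G s ≠ x₀ := fun s hs h => hs (hGinj (h.trans hG0.symm))
  have hom₁ : StartHom (orbitZ f x₀) (fun x => G (r * x)) (fun x => A (t' * x)) := by
    refine startHom_of_norm_sub_le hR₀ hR hO (by fun_prop) (by fun_prop) (by simp [hG0])
      (by simp [hA0]) (by simp [hGpos]) (fun x hx => hGne _ (mul_pos hr hx.1).ne')
      (fun x hx => hAne _ (mul_pos ht'.1 hx.1).ne') (fun x hx => ?_) (fun x hx' => ?_)
    · refine (hGle _ ?_).trans hrR
      constructor <;> nlinarith [hx.1, hx.2]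
    · refine hx.norm_le _ ?_
      constructor <;> nlinarith [hx'.1, hx'.2, ht.2, ht'.1]
  have hom₂ : StartHom (orbitZ f x₀) (fun x => G (-r * x)) (fun x => A (t * x)) := by
    refine startHom_of_norm_sub_le hR₀ hR hO (by fun_prop) (by fun_prop) (by simp [hG0])
      (by simp [hA0]) (by simp [hGneg]) (fun x hx => hGne _ (by nlinarith [mul_pos hr hx.1]))
      (fun x hx => hAne _ (mul_neg_of_neg_of_pos ht.2 hx.1).ne) (fun x hx => ?_) (fun x hx' => ?_)
    · refine (hGle _ ?_).trans hrR
      constructor <;> nlinarith [hx.1, hx.2]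
    · refine hx.norm_le _ ?_
      constructor <;> nlinarith [hx'.1, hx'.2, ht.2, ht'.1]
  have k₃ := PathHom.of_startHom f.continuous hfO hom₁ hom₂
    (m := fun x => A (t' + (1 + t - t') * x)) (by fun_prop) (by simp [hGpos])
    (by simp only [mul_one, hGneg]; rw [hA.equi]; congr 1; ring) (fun x hx => by
      rw [← hA0, ← hA.range_eq]
      apply hA.notMem
      left
      constructor <;> nlinarith [hx.1, hx.2, ht'.1, ht'.2, ht.1, ht.2])
  refine k₁.symm.trans ((k₃.congr (buildPath_congr (fun x hx => ?_) (fun x hx => ?_) fun x hx => ?_)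
    fun _ _ => rfl).trans k₂)
  · exact hA₀G ⟨by nlinarith [hx.1, hx.2], by nlinarith [hx.1, hx.2]⟩
  · have h1 : r + (1 - 2 * r) * x ∈ Icc r (1 - r) := by constructor <;> nlinarith [hx.1, hx.2]
    rw [hA₀c ⟨by linarith [h1.1], h1.2⟩, hchigh _ h1.1]
    congr 1
    simp only [hm]
    linear_combination x * hμe
  · exact hA₀G ⟨by nlinarith [hx.1, hx.2], by nlinarith [hx.1, hx.2]⟩

/-- A curve through `x₀` with prescribed polar angles on both sides. -/
noncomputable def polarGerm (x₀ : ℂ) (θ θ' : ℝ → ℝ) (s : ℝ) : ℂ :=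
  if s ≤ 0 then x₀ + (-s : ℝ) * Complex.exp (θ' (-s) * Complex.I)
  else x₀ + s * Complex.exp (θ s * Complex.I)

theorem polarGerm_neg {x₀ : ℂ} {θ θ' : ℝ → ℝ} {s : ℝ} (hs : 0 ≤ s) :
    polarGerm x₀ θ θ' (-s) = x₀ + s * Complex.exp (θ' s * Complex.I) := by
  rw [polarGerm, if_pos (by linarith), neg_neg]

theorem polarGerm_pos {x₀ : ℂ} {θ θ' : ℝ → ℝ} {s : ℝ} (hs : 0 ≤ s) :
    polarGerm x₀ θ θ' s = x₀ + s * Complex.exp (θ s * Complex.I) := by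
  rcases hs.eq_or_lt with rfl | h
  · simp [polarGerm]
  · rw [polarGerm, if_neg (not_le.2 h)]

theorem continuous_polarGerm {x₀ : ℂ} {θ θ' : ℝ → ℝ} (hθ : Continuous θ) (hθ' : Continuous θ') :
    Continuous (polarGerm x₀ θ θ') :=
  Continuous.if_le (by fun_prop) (by fun_prop) continuous_id continuous_const
    fun s h => by simp [h]

theorem norm_polarGerm_sub (x₀ : ℂ) (θ θ' : ℝ → ℝ) (s : ℝ) : ‖polarGerm x₀ θ θ' s - x₀‖ = |s| := by
  rcases le_total 0 s with h | h
  · rw [polarGerm_pos h, add_sub_cancel_left, norm_mul, Complex.norm_exp_ofReal_mul_I, mul_one,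
      Complex.norm_real, Real.norm_eq_abs]
  · obtain ⟨u, rfl⟩ : ∃ u, s = -u := ⟨-s, by ring⟩
    rw [polarGerm_neg (by linarith), add_sub_cancel_left, norm_mul, Complex.norm_exp_ofReal_mul_I,
      mul_one, Complex.norm_real, Real.norm_eq_abs, abs_neg]

theorem polarGerm_injective {x₀ : ℂ} {θ θ' : ℝ → ℝ}
    (h : ∀ s, 0 < θ' s - θ s ∧ θ' s - θ s < 2 * Real.pi) :
    Function.Injective (polarGerm x₀ θ θ') := by
  have key : ∀ s, 0 < s → polarGerm x₀ θ θ' s ≠ polarGerm x₀ θ θ' (-s) := by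
    intro s hs heq
    rw [polarGerm_pos hs.le, polarGerm_neg hs.le] at heq
    have h1 := mul_left_cancel₀ (Complex.ofReal_ne_zero.2 hs.ne') (add_left_cancel heq)
    obtain ⟨n, hn⟩ := Complex.exp_eq_exp_iff_exists_int.1 h1
    have h2 : θ s = θ' s + n * (2 * Real.pi) := by
      have h3 := congrArg Complex.im hn
      simpa using h3
    obtain ⟨h4, h5⟩ := h s
    have hpi := Real.pi_pos
    have h6 : (-1 : ℝ) < n := by nlinarith
    have h7 : (n : ℝ) < 0 := by nlinarith
    have h8 : (-1 : ℤ) < n := by exact_mod_cast h6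
    have h9 : n < 0 := by exact_mod_cast h7
    lia
  intro s t heq
  have h1 : |s| = |t| := by
    rw [← norm_polarGerm_sub x₀ θ θ' s, heq, norm_polarGerm_sub]
  rcases abs_eq_abs.1 h1 with h2 | h2
  · exact h2
  subst h2
  rcases lt_trichotomy t 0 with h3 | rfl | h3
  · exact absurd (by rw [neg_neg]; exact heq) (key (-t) (by linarith))
  · simp
  · exact absurd heq.symm (key t h3)

theorem exists_angles {x₀ z w : ℂ} {r : ℝ} (hz : ‖z - x₀‖ = r) (hw : ‖w - x₀‖ = r)
    (hne : z ≠ w) : ∃ α α' : ℝ, z = x₀ + r * Complex.exp (α * Complex.I) ∧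
      w = x₀ + r * Complex.exp (α' * Complex.I) ∧ 0 < α' - α ∧ α' - α < 2 * Real.pi := by
  have hz' : z = x₀ + r * Complex.exp ((z - x₀).arg * Complex.I) := by
    rw [← hz, Complex.norm_mul_exp_arg_mul_I]; ring
  have hw' : w = x₀ + r * Complex.exp ((w - x₀).arg * Complex.I) := by
    rw [← hw, Complex.norm_mul_exp_arg_mul_I]; ring
  have h1 := Complex.neg_pi_lt_arg (z - x₀)
  have h2 := Complex.neg_pi_lt_arg (w - x₀)
  have h3 := Complex.arg_le_pi (z - x₀)
  have h4 := Complex.arg_le_pi (w - x₀)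
  rcases lt_trichotomy (z - x₀).arg (w - x₀).arg with h | h | h
  · exact ⟨_, _, hz', hw', by linarith, by linarith⟩
  · rw [hz', h] at hne
    exact absurd hw'.symm hne
  · refine ⟨_, (w - x₀).arg + 2 * Real.pi, hz', ?_, by linarith, by linarith⟩
    push_cast
    rw [add_mul, Complex.exp_add, Complex.exp_two_pi_mul_I, mul_one]
    exact hw'

theorem HasIdx.exists_disc {f : ℂ ≃ₜ ℂ} (hf : HasIdx f) (x₀ : ℂ) :
    ∃ R > 0, ∀ r ≤ R, ∀ z, ‖z - x₀‖ ≤ r → r < ‖f z - x₀‖ := by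
  have hm : 0 < ‖f x₀ - x₀‖ := norm_pos_iff.2 (sub_ne_zero.2 (hf.free x₀))
  have hfc := f.continuous
  have hev : ∀ᶠ z in 𝓝 x₀, ‖f x₀ - x₀‖ / 2 < ‖f z - x₀‖ :=
    continuousAt_const.eventually_lt (by fun_prop) (by linarith)
  obtain ⟨ρ, hρ, h⟩ := Metric.eventually_nhds_iff.1 hev
  refine ⟨min (ρ / 2) (‖f x₀ - x₀‖ / 2), by positivity, fun r hr z hz => ?_⟩
  have h1 := hr.trans (min_le_left _ _)
  have h2 := hr.trans (min_le_right _ _)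
  exact h2.trans_lt (h (by rw [dist_eq_norm]; linarith))

theorem exists_isolating_radius {O : Set ℂ} (hfin : ∀ R : ℝ, (O ∩ Metric.closedBall 0 R).Finite)
    (x₀ : ℂ) : ∃ R > 0, ∀ z ∈ O, ‖z - x₀‖ < R → z = x₀ := by
  have hcl : IsClosed (O \ {x₀}) := isClosed_of_finite_inter_closedBall fun R =>
    (hfin R).subset (inter_subset_inter_left _ sdiff_subset)
  obtain ⟨R, hR, h⟩ := Metric.isOpen_iff.1 hcl.isOpen_compl x₀ (by simp)
  refine ⟨R, hR, fun z hz hzR => ?_⟩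
  by_contra hne
  exact h (by rwa [Metric.mem_ball, dist_eq_norm]) ⟨hz, hne⟩

/-- Two lines of period one through `x₀` have homotopic fundamental pieces. -/
theorem Line.pathHom {f : ℂ ≃ₜ ℂ} (hf : HasIdx f) {A B : ℝ → ℂ} {x₀ : ℂ} (hA : Line f 1 A)
    (hB : Line f 1 B) (hA0 : A 0 = x₀) (hB0 : B 0 = x₀)
    (hfin : ∀ R : ℝ, (orbitZ f x₀ ∩ Metric.closedBall 0 R).Finite) :
    PathHom (orbitZ f x₀) (fun s => A (1 * s)) (fun s => B (1 * s)) := by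
  obtain ⟨R₁, hR₁, hO⟩ := exists_isolating_radius hfin x₀
  obtain ⟨R₂, hR₂, hdisc⟩ := hf.exists_disc x₀
  obtain ⟨rA, hrA, hexA⟩ := exists_isExit hA.cont hA.inj hA0 (half_pos hR₁)
  obtain ⟨rB, hrB, hexB⟩ := exists_isExit hB.cont hB.inj hB0 (half_pos hR₁)
  obtain ⟨r, hr, hr'⟩ := exists_between (show (0 : ℝ) <
    min (min rA rB) (min R₂ (min (1 / 2) (R₁ / 2))) by positivity)
  simp only [lt_min_iff] at hr'
  obtain ⟨⟨h1, h2⟩, h3, h4, h5⟩ := hr'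
  obtain ⟨t, t', hxA⟩ := hexA r ⟨hr, h1.le⟩
  obtain ⟨u, u', hxB⟩ := hexB r ⟨hr, h2.le⟩
  obtain ⟨α, α', hα, hα', hα1, hα2⟩ := exists_angles hxA.norm_pos hxA.norm_neg fun h => by
    linarith [hA.inj h, hxA.neg_mem.2, hxA.pos_mem.1]
  obtain ⟨β, β', hβ, hβ', hβ1, hβ2⟩ := exists_angles hxB.norm_pos hxB.norm_neg fun h => by
    linarith [hB.inj h, hxB.neg_mem.2, hxB.pos_mem.1]
  set l : ℝ → ℝ := fun s => max 0 (min 1 (2 * s / r - 1)) with hl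
  have hlc : Continuous l := by fun_prop
  have hl01 : ∀ s, l s ∈ Icc (0 : ℝ) 1 := fun s =>
    ⟨le_max_left _ _, max_le zero_le_one (min_le_left _ _)⟩
  have hlr : l r = 1 := by
    simp only [hl]
    rw [mul_div_assoc, div_self hr.ne']
    norm_num
  have hl0 : ∀ s ≤ r / 2, l s = 0 := fun s hs => by
    have : 2 * s / r - 1 ≤ 0 := by
      rw [sub_nonpos, div_le_one hr]; linarith
    exact max_eq_left ((min_le_right _ _).trans this)
  have hang : ∀ s, 0 < (α' + l s * (β' - α')) - (α + l s * (β - α)) ∧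
      (α' + l s * (β' - α')) - (α + l s * (β - α)) < 2 * Real.pi := fun s => by
    have := convexComb_mem (convex_Ioo _ _) ⟨hα1, hα2⟩ ⟨hβ1, hβ2⟩ (hl01 s)
    rw [show (α' + l s * (β' - α')) - (α + l s * (β - α)) =
      (1 - l s) * (α' - α) + l s * (β' - β) by ring]
    exact this
  obtain ⟨A₀, hA₀, hA₀G, homA⟩ := hA.exists_replace hf hA0 (half_pos hR₁) (half_lt_self hR₁) hO hxA
    hr h4 h5.le (hdisc r h3.le)
    (continuous_polarGerm (x₀ := x₀) (continuous_const (y := α)) (continuous_const (y := α')))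
    (norm_polarGerm_sub x₀ _ _) (polarGerm_injective fun _ => ⟨hα1, hα2⟩)
    (by rw [polarGerm_neg hr.le, hα']) (by rw [polarGerm_pos hr.le, hα])
  obtain ⟨B₀, hB₀, hB₀G, homB⟩ := hB.exists_replace hf hB0 (half_pos hR₁) (half_lt_self hR₁) hO hxB
    hr h4 h5.le (hdisc r h3.le)
    (continuous_polarGerm (x₀ := x₀) (θ := fun s => α + l s * (β - α))
      (θ' := fun s => α' + l s * (β' - α')) (by fun_prop) (by fun_prop))
    (norm_polarGerm_sub x₀ _ _) (polarGerm_injective hang)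
    (by rw [polarGerm_neg hr.le, hlr, hβ', one_mul, add_sub_cancel])
    (by rw [polarGerm_pos hr.le, hlr, hβ, one_mul, add_sub_cancel])
  have hagree : ∀ s ∈ Icc (-(r / 2)) (r / 2), A₀ s = B₀ s := fun s hs => by
    rw [hA₀G ⟨by linarith [hs.1], by linarith [hs.2]⟩, hB₀G ⟨by linarith [hs.1], by linarith [hs.2]⟩]
    rcases le_total 0 s with h | h
    · rw [polarGerm_pos h, polarGerm_pos h, hl0 s hs.2, zero_mul, add_zero]
    · obtain ⟨v, rfl⟩ : ∃ v, s = -v := ⟨-s, by ring⟩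
      rw [polarGerm_neg (by linarith), polarGerm_neg (by linarith), hl0 v (by linarith [hs.1]),
        zero_mul, add_zero]
  have hA₀0 : A₀ 0 = x₀ := by
    rw [hA₀G ⟨by linarith, hr.le⟩, polarGerm_pos le_rfl]; simp
  have hpair : LinePair f (r / 2) A₀ B₀ (orbitZ f x₀) :=
    ⟨hf, hA₀, hB₀, by linarith, by linarith, hagree, by rw [hA₀0], hfin⟩
  exact homA.symm.trans (hpair.pathHom.trans homB)

/-- A translation arc extends to a line of period one. -/
theorem TranslationArc.exists_line {f : ℂ ≃ₜ ℂ} (hf : HasIdx f) {x : ℂ} {γ : C(unitInterval, ℂ)}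
    (h : TranslationArc f x γ) : ∃ A, Line f 1 A ∧ ∀ s : unitInterval, A s = γ s := by
  obtain ⟨hinj, h0, h1, hrange⟩ := h
  set c : ℝ → ℂ := fun s => γ (projIcc 0 1 zero_le_one s) with hc
  have hcc : Continuous c := γ.continuous.comp continuous_projIcc
  have hcs : ∀ s : unitInterval, c s = γ s := fun s => by simp [hc]
  obtain ⟨A, hA, hAc⟩ := hf.exists_line (T := 1) (s₀ := 0) (c := c) one_pos hcc.continuousOn
    (by simp [hc, h0, h1]) (by
      rw [zero_add]
      intro s hs t ht heq
      have := hinj (((hcs ⟨s, hs⟩).symm.trans heq).trans (hcs ⟨t, ht⟩))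
      exact congrArg Subtype.val this) (by
      rw [zero_add]
      intro y hy s hs _ heq
      have h2 : c s ∈ range γ ∩ f '' range γ := ⟨⟨_, rfl⟩, ⟨_, ⟨_, rfl⟩, heq.symm⟩⟩
      rw [hrange] at h2
      have h3 := hinj (((hcs ⟨s, Ioo_subset_Icc_self hs⟩).symm.trans h2))
      exact hs.2.ne (congrArg Subtype.val h3))
  refine ⟨A, hA, fun s => ?_⟩
  rw [hAc (by simp), hcs]

end

/-- Any two translation arcs at a point `x₀` with proper orbit of a Brouwer homeomorphism
are homotopic with fixed end-points relative to the orbit of `x₀`. -/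
theorem stmt_16 (f : ℂ ≃ₜ ℂ) (hor : OrientationPreserving f)
    (hfree : ∀ x : ℂ, f x ≠ x) (x₀ : ℂ)
    (hproper : ∀ K : Set ℂ, IsCompact K → {n : ℤ | (f.toEquiv ^ n) x₀ ∈ K}.Finite)
    (α₀ α₁ : C(unitInterval, ℂ))
    (h₀ : TranslationArc f x₀ α₀) (h₁ : TranslationArc f x₀ α₁) :
    HomotopicRelSet (orbitZ f x₀) α₀ α₁ := by
  have hf := hor.hasIdx hfree
  obtain ⟨A, hA, hAα⟩ := h₀.exists_line hf
  obtain ⟨B, hB, hBα⟩ := h₁.exists_line hf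
  have hfin : ∀ R : ℝ, (orbitZ f x₀ ∩ Metric.closedBall 0 R).Finite := fun R => by
    refine ((hproper _ (isCompact_closedBall 0 R)).image fun n : ℤ => (f.toEquiv ^ n) x₀).subset ?_
    rintro z ⟨⟨n, rfl⟩, hn⟩
    exact ⟨n, hn, rfl⟩
  have hA0 : A 0 = x₀ := by simpa [h₀.2.1] using hAα 0
  have hB0 : B 0 = x₀ := by simpa [h₁.2.1] using hBα 0
  refine (hA.pathHom hf hB hA0 hB0 hfin).homotopicRelSet (fun s => ?_) fun s => ?_
  · rw [one_mul, hAα]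
  · rw [one_mul, hBα]
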